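/- Let 2 ≤ k ≤ n and let Λ be a Poisson tensor on M whose rank equals 2k at every point of an open dense subset 𝒰 of M. Then every point of 𝒰 has an open neighborhood V ⊆ 𝒰 on which there exist smooth functions f₁,…,f_{2n−2k}, functionally independent at every point of V, an almost symplectic structure ω₀ on V with f = ⟨df₁∧⋯∧df_{2n−2k}, Λ₀^{n−k}/(n−k)!⟩ nonvanishing on V, and a 2-form σ on V with σ(X_{f_i},·) = 0 for all i, of rank 2k at every point of V, satisfying 2σ∧δ(σ) = δ(σ∧σ), such that Λ = Λ₀^#(σ), Ψ(Λ) = −(1/f)(σ + (g/(k−1))ω₀)∧(ω₀^{k−2}/(k−2)!)∧df₁∧⋯∧df_{2n−2k} where g = i_{Λ₀}σ, and the bracket of Λ satisfies {h₁,h₂}·Ω = −(1/f) dh₁∧dh₂∧(σ + (g/(k−1))ω₀)∧(ω₀^{k−2}/(k−2)!)∧df₁∧⋯∧df_{2n−2k} for all smooth h₁,h₂ on V. -/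

import Mathlib

namespace Damianou

noncomputable section

/-- Points of `ℝ^N`. -/
abbrev Pt (N : ℕ) := Fin N → ℝ

/-- Raw coordinate representation of a differential `p`-form (or, dually, of a
`p`-vector field): to each point we assign the array of its components. -/
abbrev Form (N p : ℕ) := Pt N → (Fin p → Fin N) → ℝ

/-- The component array of an alternating (antisymmetric) tensor. -/
def AltArr {N p : ℕ} (f : (Fin p → Fin N) → ℝ) : Prop :=
  (∀ (I : Fin p → Fin N) (σ : Equiv.Perm (Fin p)),
      f (I ∘ σ) = ((Equiv.Perm.sign σ : ℤ) : ℝ) * f I) ∧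
  ∀ I : Fin p → Fin N, ¬ Function.Injective I → f I = 0

/-- `ω` is a (smooth) differential `p`-form on the set `M`. -/
def IsFormOn {N p : ℕ} (ω : Form N p) (M : Set (Pt N)) : Prop :=
  (∀ x ∈ M, AltArr (ω x)) ∧ ∀ I, ContDiffOn ℝ (⊤ : ℕ∞) (fun x => ω x I) M

/-- The pairing `⟨η, P⟩` of a `p`-form with a `p`-vector field, determined by
`⟨η₁∧⋯∧η_p, X₁∧⋯∧X_p⟩ = det (⟨η_i, X_j⟩)`. -/
def pairF {N p : ℕ} (η P : Form N p) : Pt N → ℝ :=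
  fun x => (p.factorial : ℝ)⁻¹ * ∑ I : Fin p → Fin N, η x I * P x I

/-- Wedge product (determinant convention). -/
def wedgeF {N : ℕ} (p q : ℕ) (ω : Form N p) (η : Form N q) : Form N (p + q) :=
  fun x I => ((p.factorial : ℝ) * (q.factorial : ℝ))⁻¹ *
    ∑ σ : Equiv.Perm (Fin (p + q)), ((Equiv.Perm.sign σ : ℤ) : ℝ) *
      (ω x fun i => I (σ (Fin.castAdd q i))) * (η x fun j => I (σ (Fin.natAdd p j)))

def smulF {N p : ℕ} (c : ℝ) (ω : Form N p) : Form N p := fun x I => c * ω x I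
def fsmulF {N p : ℕ} (c : Pt N → ℝ) (ω : Form N p) : Form N p := fun x I => c x * ω x I
def addF {N p : ℕ} (ω η : Form N p) : Form N p := fun x I => ω x I + η x I
def subF {N p : ℕ} (ω η : Form N p) : Form N p := fun x I => ω x I - η x I

/-- Cast between (propositionally) equal degrees. -/
def castF {N p q : ℕ} (h : p = q) (ω : Form N p) : Form N q :=
  fun x J => ω x fun t => J (Fin.cast h t)

/-- Total cast, defaulting to `0` when the degrees differ. -/
def castT {N p q : ℕ} (ω : Form N p) : Form N q :=
  if h : p = q then castF h ω else fun _ _ => 0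

/-- Partial derivative `∂f/∂x_i`. -/
def pd {N : ℕ} (f : Pt N → ℝ) (i : Fin N) (x : Pt N) : ℝ :=
  fderiv ℝ f x (Pi.single i 1)

/-- The gradient covector of a function. -/
def grad {N : ℕ} (f : Pt N → ℝ) (x : Pt N) : Fin N → ℝ := fun i => pd f i x

/-- The differential of a function, as a `1`-form. -/
def dF {N : ℕ} (f : Pt N → ℝ) : Form N 1 := fun x I => pd f (I 0) x

/-- Exterior derivative. -/
def extd {N p : ℕ} (ω : Form N p) : Form N (p + 1) :=
  fun x I => ∑ i : Fin (p + 1), (-1 : ℝ) ^ (i : ℕ) *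
    fderiv ℝ (fun y => ω y fun j => I (i.succAbove j)) x (Pi.single (I i) 1)

/-- Concatenation of index blocks of lengths `a` and `b - a` into `Fin b`. -/
def catIdx {N a b : ℕ} (u : Fin a → Fin N) (v : Fin (b - a) → Fin N) : Fin b → Fin N :=
  fun t => if h : (t : ℕ) < a then u ⟨t, h⟩
    else v ⟨(t : ℕ) - a, by have := t.isLt; omega⟩

/-- Concatenation of index blocks of lengths `b - c` and `c` into `Fin b`. -/
def catIdx' {N c b : ℕ} (u : Fin (b - c) → Fin N) (v : Fin c → Fin N) : Fin b → Fin N :=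
  fun t => if h : (t : ℕ) < b - c then u ⟨t, h⟩
    else v ⟨(t : ℕ) - (b - c), by have := t.isLt; omega⟩

/-- Interior product `i_P η` of a `q`-form `η` by a `p`-vector field `P`;
it satisfies `⟨i_P η, Q⟩ = (-1)^{p(p-1)/2} ⟨η, P ∧ Q⟩`. -/
def iF {N : ℕ} (p q : ℕ) (P : Form N p) (η : Form N q) : Form N (q - p) :=
  fun x J => (-1 : ℝ) ^ (p * (p - 1) / 2) * (p.factorial : ℝ)⁻¹ *
    ∑ I : Fin p → Fin N, P x I * η x (catIdx I J)

/-- Interior product `j_η P` of an `r`-vector field `P` by a `q`-form `η`;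
it satisfies `⟨ζ, j_η P⟩ = ⟨ζ ∧ η, P⟩`. -/
def jF {N : ℕ} (q r : ℕ) (η : Form N q) (P : Form N r) : Form N (r - q) :=
  fun x B => (q.factorial : ℝ)⁻¹ * ∑ A : Fin q → Fin N, η x A * P x (catIdx' B A)

/-- The extension of `Λ₀^#` to `p`-forms:
`Λ₀^#(ζ)(α₁,…,α_p) = (-1)^p ζ(Λ₀^#(α₁),…,Λ₀^#(α_p))`, in coordinates. -/
def sharpF {N : ℕ} (Λ : Form N 2) (p : ℕ) (ζ : Form N p) : Form N p :=
  fun x J => (-1 : ℝ) ^ p * ∑ I : Fin p → Fin N, ζ x I * ∏ t, Λ x ![I t, J t]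

/-- `Λ^#` applied to a covector: `⟨β, Λ^#(α)⟩ = Λ(α,β)`. -/
def sharpV {N : ℕ} (Λ : Form N 2) (α : Fin N → ℝ) (x : Pt N) : Fin N → ℝ :=
  fun j => ∑ i, Λ x ![i, j] * α i

/-- The hamiltonian vector field `X_f = Λ₀^#(df)`. -/
def hamV {N : ℕ} (Λ : Form N 2) (f : Pt N → ℝ) (x : Pt N) : Fin N → ℝ :=
  sharpV Λ (grad f x) x

/-- Coefficient matrix of a 2-form (or of a bivector field) at a point. -/
def mat2 {N : ℕ} (ω : Form N 2) (x : Pt N) : Matrix (Fin N) (Fin N) ℝ :=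
  Matrix.of fun i j => ω x ![i, j]

/-- The bracket `{g,h} = Λ(dg,dh)` associated with a bivector field. -/
def braF {N : ℕ} (Λ : Form N 2) (g h : Pt N → ℝ) : Pt N → ℝ :=
  fun x => ∑ i, ∑ j, Λ x ![i, j] * pd g i x * pd h j x

/-- The Jacobi identity for the bracket of `Λ`, for all functions smooth on `M`. -/
def JacobiOn {N : ℕ} (Λ : Form N 2) (M : Set (Pt N)) : Prop :=
  ∀ g h k : Pt N → ℝ, ContDiffOn ℝ (⊤ : ℕ∞) g M → ContDiffOn ℝ (⊤ : ℕ∞) h M →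
    ContDiffOn ℝ (⊤ : ℕ∞) k M →
    ∀ x ∈ M, braF Λ g (braF Λ h k) x + braF Λ h (braF Λ k g) x + braF Λ k (braF Λ g h) x = 0

/-- `f` is a Casimir of `Λ` on `M`, i.e. `Λ(df,·) = 0` on `M`. -/
def CasimirOn {N : ℕ} (Λ : Form N 2) (f : Pt N → ℝ) (M : Set (Pt N)) : Prop :=
  ∀ x ∈ M, ∀ b, ∑ a, Λ x ![a, b] * grad f x a = 0

/-- Wedge powers of a `2`-form (or of a bivector field). -/
def wpow {N : ℕ} (ω : Form N 2) : (m : ℕ) → Form N (2 * m)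
  | 0 => fun _ _ => 1
  | m + 1 => wedgeF (2 * m) 2 (wpow ω m) ω

/-- The wedge `α₁ ∧ ⋯ ∧ α_m` of a family of `1`-forms. -/
def wedgeList {N : ℕ} : (m : ℕ) → (Fin m → Form N 1) → Form N m
  | 0, _ => fun _ _ => 1
  | m + 1, α => wedgeF m 1 (wedgeList m fun i => α i.castSucc) (α (Fin.last m))

/-- `ω₀` is an almost symplectic structure on `M` with associated (nondegenerate)
bivector field `Λ₀`:  `Λ₀^#` is the inverse of `X ↦ -ω₀(X,·)`, which in coordinates
reads `(mat2 ω₀ x) * (mat2 Λ₀ x) = -1`. -/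
def AlmostSymp {N : ℕ} (ω₀ Λ₀ : Form N 2) (M : Set (Pt N)) : Prop :=
  IsFormOn ω₀ M ∧ IsFormOn Λ₀ M ∧ ∀ x ∈ M, mat2 ω₀ x * mat2 Λ₀ x = -1

/-- `ωⁿ/n!`; for an almost symplectic `ω₀` on `ℝ^{2n}` this is the volume form `Ω`,
and for `Λ₀` it is the dual `2n`-vector field `Ω̃`. -/
def volF {N : ℕ} (n : ℕ) (ω : Form N 2) : Form N (2 * n) :=
  smulF ((n.factorial : ℝ)⁻¹) (wpow ω n)

/-- The adjoint `*φ = (-1)^{p(p-1)/2} i_{Λ₀^#(φ)} (ω₀ⁿ/n!)` of a `p`-form. -/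
def adjF {n : ℕ} (ω₀ Λ₀ : Form (2 * n) 2) (p : ℕ) (φ : Form (2 * n) p) :
    Form (2 * n) (2 * n - p) :=
  smulF ((-1 : ℝ) ^ (p * (p - 1) / 2)) (iF p (2 * n) (sharpF Λ₀ p φ) (volF n ω₀))

/-- The codifferential `δ = * ∘ d ∘ *`. -/
def codiffF {n : ℕ} (ω₀ Λ₀ : Form (2 * n) 2) (p : ℕ) (φ : Form (2 * n) p) :
    Form (2 * n) (p - 1) :=
  castT (adjF ω₀ Λ₀ (2 * n - p + 1) (extd (adjF ω₀ Λ₀ p φ)))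

/-- The compatibility condition `2 σ ∧ δ(σ) = δ(σ ∧ σ)` on `M`. -/
def DeltaCond {n : ℕ} (ω₀ Λ₀ σ : Form (2 * n) 2) (M : Set (Pt (2 * n))) : Prop :=
  ∀ x ∈ M, ∀ I : Fin 3 → Fin (2 * n),
    smulF 2 (wedgeF 2 1 σ (codiffF ω₀ Λ₀ 2 σ)) x I = codiffF ω₀ Λ₀ 4 (wedgeF 2 2 σ σ) x I

/-!
STATEMENT 6.  Main theorem (converse part), even-dimensional case:  a Poisson
tensor `Λ` of rank `2k` on an open dense `𝒰 ⊆ M` is, near every point of `𝒰`,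
of the form `Λ = Λ₀^#(σ)` with `Ψ(Λ)` and the bracket given by the formula of
Theorem 3.3.
-/

/-- `f = ⟨df₁∧⋯∧df_{2(n-k)}, Λ₀^{n-k}/(n-k)!⟩`. -/
def fEven {n k : ℕ} (Λ₀ : Form (2 * n) 2) (f : Fin (2 * (n - k)) → Pt (2 * n) → ℝ) :
    Pt (2 * n) → ℝ :=
  pairF (wedgeList (2 * (n - k)) fun i => dF (f i))
    (smulF (((n - k).factorial : ℝ)⁻¹) (wpow Λ₀ (n - k)))

/-- `g = i_{Λ₀}σ = -⟨σ,Λ₀⟩`. -/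
def gEven {N : ℕ} (Λ₀ σ : Form N 2) : Pt N → ℝ := fun x => -(pairF σ Λ₀ x)

/-- The core `(2n-2)`-form
`(σ + (g/(k-1))ω₀) ∧ (ω₀^{k-2}/(k-2)!) ∧ df₁∧⋯∧df_{2(n-k)}`. -/
def coreForm {n : ℕ} (k : ℕ) (ω₀ Λ₀ σ : Form (2 * n) 2)
    (f : Fin (2 * (n - k)) → Pt (2 * n) → ℝ) :
    Form (2 * n) (2 + 2 * (k - 2) + 2 * (n - k)) :=
  wedgeF (2 + 2 * (k - 2)) (2 * (n - k))
    (wedgeF 2 (2 * (k - 2))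
      (addF σ (fsmulF (fun x => gEven Λ₀ σ x / ((k : ℝ) - 1)) ω₀))
      (smulF (((k - 2).factorial : ℝ)⁻¹) (wpow ω₀ (k - 2))))
    (wedgeList (2 * (n - k)) fun i => dF (f i))

/-- `Ψ(P) = (-1)^{p(p-1)/2} i_P Ω` for a bivector field (`p = 2`). -/
def PsiBiv {n : ℕ} (ω₀ Λ : Form (2 * n) 2) : Form (2 * n) (2 * n - 2) :=
  smulF ((-1 : ℝ) ^ (2 * (2 - 1) / 2)) (iF 2 (2 * n) Λ (volF n ω₀))

section SmoothNormalForm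

open Topology

section Superposition

variable {K : Type} [TopologicalSpace K] [CompactSpace K]
  {E F : Type} [NormedAddCommGroup E] [NormedSpace ℝ E] [NormedAddCommGroup F] [NormedSpace ℝ F]

/-- Pointwise application of operator-valued curves, as a continuous bilinear map. -/
def pointwiseApply : C(K, E →L[ℝ] F) →L[ℝ] C(K, E) →L[ℝ] C(K, F) :=
  LinearMap.mkContinuous₂
    (LinearMap.mk₂ ℝ (fun (A : C(K, E →L[ℝ] F)) (J : C(K, E)) => (⟨fun t => A t (J t), by fun_prop⟩ : C(K, F)))
      (fun A B J => by ext t; simp) (fun c A J => by ext t; simp)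
      (fun A J L => by ext t; simp) (fun c A J => by ext t; simp)) 1
    (fun A J => by
      rw [one_mul, ContinuousMap.norm_le _ (by positivity)]
      intro t
      exact (A t).le_of_opNorm_le_of_le (A.norm_coe_le_norm t) (J.norm_coe_le_norm t))

@[simp] theorem pointwiseApply_apply (A : C(K, E →L[ℝ] F)) (J : C(K, E)) (t : K) :
    pointwiseApply A J t = A t (J t) := rfl

/-- The superposition operator `γ ↦ X ∘ γ`. -/
def superpose (X : E → F) (hX : Continuous X) (γ : C(K, E)) : C(K, F) := ⟨fun t => X (γ t), by fun_prop⟩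

@[simp] theorem superpose_apply (X : E → F) (hX : Continuous X) (γ : C(K, E)) (t : K) :
    superpose X hX γ t = X (γ t) := rfl

theorem hasFDerivAt_superpose {X : E → F} (hX : ContDiff ℝ 1 X) (γ : C(K, E)) :
    HasFDerivAt (superpose X hX.continuous)
      (pointwiseApply (superpose (fderiv ℝ X) (hX.continuous_fderiv one_ne_zero) γ)) γ := by
  rw [hasFDerivAt_iff_isLittleO_nhds_zero, Asymptotics.isLittleO_iff]
  intro ε hε
  have hc : Continuous (fderiv ℝ X) := hX.continuous_fderiv one_ne_zero
  have hK : IsCompact (Set.range γ) := isCompact_range γ.continuous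
  have hu := hK.uniformContinuousAt_of_continuousAt (fderiv ℝ X) (fun a _ => hc.continuousAt)
    (Metric.dist_mem_uniformity hε)
  obtain ⟨δ, hδ, hδ'⟩ := Metric.mem_uniformity_dist.1 hu
  filter_upwards [Metric.ball_mem_nhds (0 : C(K, E)) hδ] with J hJ
  rw [ContinuousMap.norm_le _ (by positivity)]
  intro t
  have hJt : ‖J t‖ < δ := (J.norm_coe_le_norm t).trans_lt (by simpa using hJ)
  have key := Convex.norm_image_sub_le_of_norm_fderiv_le' (𝕜 := ℝ) (f := X) (C := ε)
    (s := Metric.ball (γ t) δ) (x := γ t) (y := γ t + J t) (φ := fderiv ℝ X (γ t))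
    (fun y _ => (hX.differentiable one_ne_zero).differentiableAt)
    (fun y hy => by
      have := hδ' (a := γ t) (b := y) (by rw [dist_comm]; exact hy) ⟨t, rfl⟩
      rw [← dist_eq_norm, dist_comm]; exact this.le)
    (convex_ball _ _) (Metric.mem_ball_self hδ) (by simpa using hJt)
  simp only [add_sub_cancel_left] at key
  refine le_trans (le_of_eq ?_) (key.trans (mul_le_mul_of_nonneg_left (J.norm_coe_le_norm t) hε.le))
  simp

theorem contDiff_superpose_nat (n : ℕ) : ∀ {F : Type} [NormedAddCommGroup F] [NormedSpace ℝ F]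
    {X : E → F} (hX : ContDiff ℝ (⊤ : ℕ∞) X),
    ContDiff ℝ n (superpose (K := K) X hX.continuous) := by
  induction n with
  | zero =>
    intro F _ _ X hX
    have h1 : ContDiff ℝ 1 X := hX.of_le (by exact_mod_cast le_top)
    exact contDiff_zero.2 (continuous_iff_continuousAt.2
      fun γ => (hasFDerivAt_superpose h1 γ).continuousAt)
  | succ n ih =>
    intro F _ _ X hX
    have h1 : ContDiff ℝ 1 X := hX.of_le (by exact_mod_cast le_top)
    have hd : ContDiff ℝ (⊤ : ℕ∞) (fderiv ℝ X) := hX.fderiv_right (by simp)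
    push_cast
    rw [contDiff_succ_iff_hasFDerivAt]
    exact ⟨_, pointwiseApply.contDiff.comp (ih hd), hasFDerivAt_superpose h1⟩

theorem contDiff_superpose {X : E → F} (hX : ContDiff ℝ (⊤ : ℕ∞) X) :
    ContDiff ℝ (⊤ : ℕ∞) (superpose (K := K) X hX.continuous) :=
  contDiff_infty.2 fun n => contDiff_superpose_nat n hX

end Superposition

/-- The smooth inverse function theorem, with a smooth inverse on a full neighbourhood. -/
theorem exists_smooth_local_inverse {E F : Type} [NormedAddCommGroup E] [NormedSpace ℝ E]
    [CompleteSpace E] [NormedAddCommGroup F] [NormedSpace ℝ F] {f : E → F} {U : Set E} {a : E}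
    (hU : IsOpen U) (ha : a ∈ U) (hf : ContDiffOn ℝ (⊤ : ℕ∞) f U) (f' : E ≃L[ℝ] F)
    (hf' : HasFDerivAt f (f' : E →L[ℝ] F) a) :
    ∃ g : F → E, ∃ V : Set F, IsOpen V ∧ f a ∈ V ∧ ContDiffOn ℝ (⊤ : ℕ∞) g V ∧ g (f a) = a ∧
      ∀ y ∈ V, g y ∈ U ∧ f (g y) = y ∧ ∀ u, fderiv ℝ g y (fderiv ℝ f (g y) u) = u := by
  have hfa : ContDiffAt ℝ (⊤ : ℕ∞) f a := hf.contDiffAt (hU.mem_nhds ha)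
  have hn : ((⊤ : ℕ∞) : WithTop ℕ∞) ≠ 0 := by simp
  set e := hfa.toOpenPartialHomeomorph f hf' hn with he
  have hef : ∀ x, e x = f x := fun x => rfl
  have hcont : ContinuousOn (fderiv ℝ f) U := hf.continuousOn_fderiv_of_isOpen hU (by simp)
  have hequiv : ∀ᶠ x in 𝓝 a, ∃ L : E ≃L[ℝ] F, (L : E →L[ℝ] F) = fderiv ℝ f x := by
    have := (hcont.continuousAt (hU.mem_nhds ha)).eventually
      (by rw [hf'.fderiv]; exact ContinuousLinearEquiv.nhds f')
    exact this
  obtain ⟨U', hU'sub, hU'o, haU'⟩ := mem_nhds_iff.1 (hequiv.and (hU.mem_nhds ha))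
  have has : a ∈ e.source := hfa.mem_toOpenPartialHomeomorph_source hf' hn
  have haU : f a ∈ e.target := e.map_source has
  refine ⟨e.symm, e.target ∩ e.symm ⁻¹' U', e.isOpen_inter_preimage_symm hU'o, ⟨haU, ?_⟩, ?_, ?_, ?_⟩
  · change e.symm (e a) ∈ U'
    rwa [e.left_inv has]
  · intro y hy
    obtain ⟨⟨L, hL⟩, hyU⟩ := hU'sub hy.2
    have hfy := hf.contDiffAt (hU.mem_nhds hyU)
    exact (e.contDiffAt_symm hy.1 (f₀' := L)
      (by rw [hL]; exact (hfy.differentiableAt hn).hasFDerivAt) hfy).contDiffWithinAt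
  · exact e.left_inv has
  · intro y hy
    obtain ⟨⟨L, hL⟩, hyU⟩ := hU'sub hy.2
    refine ⟨hyU, e.right_inv hy.1, fun u => ?_⟩
    have hfy := hf.contDiffAt (hU.mem_nhds hyU)
    have hfd := (hfy.differentiableAt hn).hasFDerivAt
    have hsd := (e.contDiffAt_symm hy.1 (f₀' := L) (by rw [hL]; exact hfd) hfy).differentiableAt hn
    have hs : e.symm y ∈ e.source := e.map_target hy.1
    have hy' : f (e.symm y) = y := e.right_inv hy.1
    have h1 : HasFDerivAt (fun x => e.symm (f x))
        ((fderiv ℝ e.symm y).comp (fderiv ℝ f (e.symm y))) (e.symm y) :=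
      HasFDerivAt.comp (e.symm y) (by rw [hy']; exact hsd.hasFDerivAt) hfd
    have h2 : HasFDerivAt (fun x => e.symm (f x)) (ContinuousLinearMap.id ℝ E) (e.symm y) :=
      (hasFDerivAt_id _).congr_of_eventuallyEq
        (Filter.eventuallyEq_of_mem (e.open_source.mem_nhds hs) fun x hx => e.left_inv hx)
    exact DFunLike.congr_fun (h1.unique h2) u

section Primitive

variable {E : Type} [NormedAddCommGroup E] [NormedSpace ℝ E] [CompleteSpace E]

/-- The extension of a curve on `[0,1]` to the real line, constant outside. -/
def extendCurve (γ : C(unitInterval, E)) (t : ℝ) : E := γ (Set.projIcc 0 1 zero_le_one t)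

theorem continuous_extendCurve (γ : C(unitInterval, E)) : Continuous (extendCurve γ) :=
  γ.continuous.comp continuous_projIcc

theorem hasDerivAt_integral_extendCurve (γ : C(unitInterval, E)) (t : ℝ) :
    HasDerivAt (fun t => ∫ τ in (0 : ℝ)..t, extendCurve γ τ) (extendCurve γ t) t :=
  (continuous_extendCurve γ).integral_hasStrictDerivAt 0 t |>.hasDerivAt

theorem extendCurve_coe (γ : C(unitInterval, E)) (t : unitInterval) : extendCurve γ t = γ t := by
  simp [extendCurve]

/-- The primitive of a curve on `[0,1]` vanishing at `0`. -/
def primitive : C(unitInterval, E) →L[ℝ] C(unitInterval, E) :=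
  LinearMap.mkContinuous
    { toFun := fun γ => ⟨fun t => ∫ τ in (0 : ℝ)..t, extendCurve γ τ,
        (continuous_iff_continuousAt.2 fun t =>
          (hasDerivAt_integral_extendCurve γ t).continuousAt).comp continuous_subtype_val⟩
      map_add' := fun γ η => by
        ext t
        exact intervalIntegral.integral_add ((continuous_extendCurve γ).intervalIntegrable _ _)
          ((continuous_extendCurve η).intervalIntegrable _ _)
      map_smul' := fun c γ => by
        ext t
        exact intervalIntegral.integral_smul c (extendCurve γ) } 1
    (fun γ => by
      rw [one_mul, ContinuousMap.norm_le _ (by positivity)]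
      intro t
      refine (intervalIntegral.norm_integral_le_of_norm_le_const (C := ‖γ‖)
        fun τ _ => γ.norm_coe_le_norm _).trans ?_
      rw [sub_zero, abs_of_nonneg t.2.1]
      exact mul_le_of_le_one_right (norm_nonneg _) t.2.2)

theorem primitive_apply (γ : C(unitInterval, E)) (t : unitInterval) :
    primitive γ t = ∫ τ in (0 : ℝ)..t, extendCurve γ τ := rfl

theorem primitive_const (c : E) (t : unitInterval) :
    primitive (ContinuousMap.const _ c) t = (t : ℝ) • c := by
  simp [primitive_apply, extendCurve]

/-- Uniqueness of primitives. -/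
theorem eq_primitive_of_hasDerivAt {f : ℝ → E} {γ : C(unitInterval, E)} (h0 : f 0 = 0)
    (hf : ∀ t : unitInterval, HasDerivAt f (γ t) t) (t : unitInterval) : f t = primitive γ t := by
  rw [primitive_apply, intervalIntegral.integral_eq_sub_of_hasDerivAt (f := f), h0, sub_zero]
  · intro s hs
    rw [Set.uIcc_of_le t.2.1] at hs
    have hs' : s ∈ unitInterval := ⟨hs.1, hs.2.trans t.2.2⟩
    have := extendCurve_coe γ ⟨s, hs'⟩
    rw [this]
    exact hf ⟨s, hs'⟩
  · exact (continuous_extendCurve γ).intervalIntegrable _ _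

end Primitive

/-- Every locally smooth map agrees near a point with a globally smooth one. -/
theorem exists_contDiff_eventuallyEq {E F : Type} [NormedAddCommGroup E] [NormedSpace ℝ E]
    [FiniteDimensional ℝ E] [NormedAddCommGroup F] [NormedSpace ℝ F] {f : E → F} {U : Set E} {x : E}
    (hU : IsOpen U) (hx : x ∈ U) (hf : ContDiffOn ℝ (⊤ : ℕ∞) f U) :
    ∃ g : E → F, ContDiff ℝ (⊤ : ℕ∞) g ∧ g =ᶠ[𝓝 x] f := by
  obtain ⟨ε, hε, hεU⟩ := Metric.nhds_basis_closedBall.mem_iff.1 (hU.mem_nhds hx)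
  let χ : ContDiffBump x := ⟨ε / 2, ε, by positivity, by linarith⟩
  refine ⟨fun y => χ y • f y, contDiff_iff_contDiffAt.2 fun y => ?_, ?_⟩
  · by_cases hy : y ∈ tsupport fun y => χ y • f y
    swap
    · exact (contDiffAt_const (c := (0 : F))).congr_of_eventuallyEq
        (notMem_tsupport_iff_eventuallyEq.1 hy)
    have hy' : y ∈ tsupport χ := tsupport_smul_subset_left χ f hy
    rw [χ.tsupport_eq] at hy'
    exact χ.contDiff.contDiffAt.smul (hf.contDiffAt (hU.mem_nhds (hεU hy')))
  · filter_upwards [χ.eventuallyEq_one] with y hy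
    simp [hy]

section Straightening

variable {E : Type} [NormedAddCommGroup E] [NormedSpace ℝ E]
  {ι : Type} [Fintype ι]

/-- Constant curves, as a continuous linear map. -/
def constCurve : E →L[ℝ] C(unitInterval, E) :=
  LinearMap.mkContinuous
    { toFun := fun v => ContinuousMap.const _ v
      map_add' := fun v w => rfl
      map_smul' := fun c v => rfl } 1
    (fun v => by
      rw [one_mul, ContinuousMap.norm_le _ (by positivity)]
      exact fun t => le_rfl)

@[simp] theorem constCurve_apply (v : E) (t : unitInterval) : constCurve v t = v := rfl

variable [FiniteDimensional ℝ E]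

/-- The integral equation for the joint flow of the fields `X i` with times prescribed by `R`:
its zeros `(v, γ)` are the integral curves of `∑ (R v)ᵢ Xᵢ` starting at
`p + v - ∑ (R v)ᵢ Xᵢ(p)`. -/
def flowDefect (X : ι → E → E) (hX : ∀ i, Continuous (X i)) (R : E →L[ℝ] ι → ℝ) (p : E)
    (z : E × C(unitInterval, E)) : C(unitInterval, E) :=
  z.2 - constCurve p - constCurve z.1 +
    ∑ i, R z.1 i • (constCurve (X i p) - primitive (superpose (X i) (hX i) z.2))

/-- The derivative of `flowDefect`. -/
def flowDefectDeriv (X : ι → E → E) (hX : ∀ i, ContDiff ℝ (⊤ : ℕ∞) (X i)) (R : E →L[ℝ] ι → ℝ)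
    (p : E) (z : E × C(unitInterval, E)) :
    E × C(unitInterval, E) →L[ℝ] C(unitInterval, E) :=
  ContinuousLinearMap.snd ℝ _ _ - constCurve.comp (ContinuousLinearMap.fst ℝ _ _) +
    ∑ i, (R z.1 i • (-(primitive.comp ((pointwiseApply (superpose (fderiv ℝ (X i))
        ((hX i).continuous_fderiv (by simp)) z.2)).comp (ContinuousLinearMap.snd ℝ _ _)))) +
      (((ContinuousLinearMap.proj i).comp R).comp (ContinuousLinearMap.fst ℝ _ _)).smulRight
        (constCurve (X i p) - primitive (superpose (X i) (hX i).continuous z.2)))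

theorem hasFDerivAt_flowDefect (X : ι → E → E) (hX : ∀ i, ContDiff ℝ (⊤ : ℕ∞) (X i))
    (R : E →L[ℝ] ι → ℝ) (p : E) (z : E × C(unitInterval, E)) :
    HasFDerivAt (flowDefect X (fun i => (hX i).continuous) R p) (flowDefectDeriv X hX R p z) z := by
  have h1 : HasFDerivAt (fun z : E × C(unitInterval, E) => z.2) (ContinuousLinearMap.snd ℝ _ _) z :=
    hasFDerivAt_snd
  have h2 : HasFDerivAt (fun z : E × C(unitInterval, E) => z.1) (ContinuousLinearMap.fst ℝ _ _) z :=
    hasFDerivAt_fst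
  refine ((h1.sub_const (constCurve p)).sub (constCurve.hasFDerivAt.comp z h2)).add
    (HasFDerivAt.fun_sum fun i _ => ?_)
  have h3 : HasFDerivAt (fun z : E × C(unitInterval, E) => R z.1 i)
      (((ContinuousLinearMap.proj i).comp R).comp (ContinuousLinearMap.fst ℝ _ _)) z :=
    ((ContinuousLinearMap.proj i).comp R).hasFDerivAt.comp z h2
  have h4 := (hasFDerivAt_superpose ((hX i).of_le (by exact_mod_cast le_top)) z.2).comp z h1
  exact h3.smul ((primitive.hasFDerivAt.comp z h4).const_sub (constCurve (X i p)))

theorem contDiff_flowDefect (X : ι → E → E) (hX : ∀ i, ContDiff ℝ (⊤ : ℕ∞) (X i))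
    (R : E →L[ℝ] ι → ℝ) (p : E) :
    ContDiff ℝ (⊤ : ℕ∞) (flowDefect X (fun i => (hX i).continuous) R p) := by
  refine ((contDiff_snd.sub contDiff_const).sub ((constCurve : E →L[ℝ] C(unitInterval, E)).contDiff.comp contDiff_fst)).add
    (ContDiff.sum fun i _ => ?_)
  have h3 : ContDiff ℝ (⊤ : ℕ∞) (fun z : E × C(unitInterval, E) => R z.1 i) :=
    ((ContinuousLinearMap.proj i).comp R).contDiff.comp contDiff_fst
  exact h3.smul (contDiff_const.sub
    (primitive.contDiff.comp ((contDiff_superpose (hX i)).comp contDiff_snd)))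

theorem flowDefectDeriv_apply (X : ι → E → E) (hX : ∀ i, ContDiff ℝ (⊤ : ℕ∞) (X i))
    (R : E →L[ℝ] ι → ℝ) (p : E) (v : E) (γ : C(unitInterval, E)) (u : E) (J : C(unitInterval, E)) :
    flowDefectDeriv X hX R p (v, γ) (u, J) = J - constCurve u +
      ∑ i, (-(R v i • primitive (pointwiseApply (superpose (fderiv ℝ (X i))
        ((hX i).continuous_fderiv (by simp)) γ) J)) +
      R u i • (constCurve (X i p) - primitive (superpose (X i) (hX i).continuous γ))) := by
  simp [flowDefectDeriv]

/-- Along a curve solving the integral equation, the flow of commuting fields is infinitesimally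
translated by each of them. -/
theorem flowDefectDeriv_eq_zero [DecidableEq ι] {X : ι → E → E}
    (hX : ∀ i, ContDiff ℝ (⊤ : ℕ∞) (X i))
    {R : E →L[ℝ] ι → ℝ} {p v : E} {γ : C(unitInterval, E)} {U : Set E} (hγU : ∀ t, γ t ∈ U)
    (hcomm : ∀ i j, ∀ x ∈ U, fderiv ℝ (X j) x (X i x) = fderiv ℝ (X i) x (X j x))
    (hR : ∀ i, R (X i p) = Pi.single i 1)
    (hγ : flowDefect X (fun i => (hX i).continuous) R p (v, γ) = 0) (i : ι) :
    ∃ J : C(unitInterval, E), J 1 = X i (γ 1) ∧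
      flowDefectDeriv X hX R p (v, γ) (X i p, J) = 0 := by
  set σ : C(unitInterval, E) := ∑ j, R v j • superpose (X j) (hX j).continuous γ with hσ
  set c : E := p + v - ∑ j, R v j • X j p with hc
  have hγeq : ∀ t, γ t = c + primitive σ t := by
    intro t
    have := DFunLike.congr_fun hγ t
    simp only [flowDefect, ContinuousMap.add_apply, ContinuousMap.sub_apply, constCurve_apply,
      ContinuousMap.coe_sum, Finset.sum_apply, ContinuousMap.smul_apply, ContinuousMap.zero_apply,
      smul_sub, Finset.sum_sub_distrib] at this
    rw [hc, hσ, map_sum]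
    simp only [map_smul, ContinuousMap.coe_sum, Finset.sum_apply, ContinuousMap.smul_apply]
    rw [← sub_eq_zero, ← this]
    abel
  set γ' : ℝ → E := fun t => c + ∫ τ in (0 : ℝ)..t, extendCurve σ τ with hγ'
  have hγ'd : ∀ t : unitInterval, HasDerivAt γ' (σ t) t := fun t => by
    have := (hasDerivAt_integral_extendCurve σ t).const_add c
    rwa [extendCurve_coe] at this
  have hγ'eq : ∀ t : unitInterval, γ' t = γ t := fun t => (hγeq t).symm
  let J : C(unitInterval, E) := ⟨fun t => (t : ℝ) • X i (γ t),
    continuous_subtype_val.smul ((hX i).continuous.comp γ.continuous)⟩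
  refine ⟨J, by simp [J], ?_⟩
  set D : C(unitInterval, E) := superpose (X i) (hX i).continuous γ +
    ∑ j, R v j • pointwiseApply (superpose (fderiv ℝ (X j))
        ((hX j).continuous_fderiv (by simp)) γ) J with hD
  have hJ : J = primitive D := by
    ext t
    have key := eq_primitive_of_hasDerivAt (f := fun s : ℝ => s • X i (γ' s)) (γ := D)
      (by simp) ?_ t
    · rw [← key]
      simp [J, hγ'eq]
    · intro s
      have hXd : HasFDerivAt (X i) (fderiv ℝ (X i) (γ' s)) (γ' s) :=
        ((hX i).differentiable (by simp)).differentiableAt.hasFDerivAt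
      have := (hasDerivAt_id (s : ℝ)).smul (hXd.comp_hasDerivAt (s : ℝ) (hγ'd s))
      refine HasDerivAt.congr_deriv this ?_
      simp only [hD, hσ, ContinuousMap.add_apply, superpose_apply, ContinuousMap.coe_sum,
        Finset.sum_apply, ContinuousMap.smul_apply, pointwiseApply_apply, hγ'eq, id, one_smul,
        map_sum, map_smul, Function.comp, Finset.smul_sum, J, ContinuousMap.coe_mk]
      rw [add_comm]
      congr 1
      refine Finset.sum_congr rfl fun j _ => ?_
      rw [hcomm i j _ (hγU s), smul_comm]
  rw [flowDefectDeriv_apply, Finset.sum_add_distrib, hR]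
  simp only [Pi.single_apply, ite_smul, one_smul, zero_smul, Finset.sum_ite_eq', Finset.mem_univ,
    if_true]
  nth_rewrite 1 [hJ]
  rw [hD, map_add, map_sum]
  simp only [map_smul, Finset.sum_neg_distrib]
  abel

/-- The base solution of `flowDefectDeriv` at the constant curve. -/
theorem flowDefectDeriv_const_eq_zero {X : ι → E → E} (hX : ∀ i, ContDiff ℝ (⊤ : ℕ∞) (X i))
    (R : E →L[ℝ] ι → ℝ) (p u : E) :
    ∃ J : C(unitInterval, E), J 1 = u ∧
      flowDefectDeriv X hX R p (0, constCurve p) (u, J) = 0 := by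
  have hs : ∀ i, superpose (X i) (hX i).continuous (constCurve (E := E) p) =
      ContinuousMap.const unitInterval (X i p) := fun i => rfl
  refine ⟨constCurve u - ∑ i, R u i • (constCurve (X i p) -
    primitive (superpose (X i) (hX i).continuous (constCurve p))), ?_, ?_⟩
  · simp [hs, primitive_const]
  · rw [flowDefectDeriv_apply]
    simp

/-- Simultaneous straightening of commuting independent vector fields: every covector at `p`
extends to the differential of a function along which all the fields have constant derivative. -/
theorem exists_straightening_of_contDiff {X : ι → E → E}
    (hX : ∀ i, ContDiff ℝ (⊤ : ℕ∞) (X i)) {U : Set E} {p : E} (hU : IsOpen U) (hp : p ∈ U)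
    (hcomm : ∀ i j, ∀ x ∈ U, fderiv ℝ (X j) x (X i x) = fderiv ℝ (X i) x (X j x))
    (hli : LinearIndependent ℝ fun i => X i p) (α : E →L[ℝ] ℝ) :
    ∃ V : Set E, IsOpen V ∧ p ∈ V ∧ V ⊆ U ∧ ∃ h : E → ℝ, ContDiffOn ℝ (⊤ : ℕ∞) h V ∧
      fderiv ℝ h p = α ∧ ∀ x ∈ V, ∀ i, fderiv ℝ h x (X i x) = α (X i p) := by
  classical
  obtain ⟨R, hR⟩ : ∃ R : E →L[ℝ] ι → ℝ, ∀ i, R (X i p) = Pi.single i 1 := by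
    have hinj : LinearMap.ker (Fintype.linearCombination ℝ fun i => X i p) = ⊥ :=
      LinearMap.ker_eq_bot.2 (linearIndependent_iff_injective_fintypeLinearCombination.1 hli)
    obtain ⟨r, hr⟩ := LinearMap.exists_leftInverse_of_injective _ hinj
    refine ⟨LinearMap.toContinuousLinearMap r, fun i => ?_⟩
    have := LinearMap.congr_fun hr (Pi.single i 1)
    simpa using this
  let H : E × C(unitInterval, E) → E × C(unitInterval, E) := fun z =>
    (z.1, flowDefect X (fun i => (hX i).continuous) R p z)
  have hHs : ContDiff ℝ (⊤ : ℕ∞) H := contDiff_fst.prodMk (contDiff_flowDefect X hX R p)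
  have hHd : ∀ z, HasFDerivAt H ((ContinuousLinearMap.fst ℝ _ _).prod
      (flowDefectDeriv X hX R p z)) z :=
    fun z => hasFDerivAt_fst.prodMk (hasFDerivAt_flowDefect X hX R p z)
  let B : E →L[ℝ] C(unitInterval, E) :=
    (flowDefectDeriv X hX R p (0, constCurve p)).comp (ContinuousLinearMap.inl ℝ _ _)
  let Heq : (E × C(unitInterval, E)) ≃L[ℝ] E × C(unitInterval, E) :=
    (ContinuousLinearEquiv.refl ℝ E).skewProd (ContinuousLinearEquiv.refl ℝ _) B
  have hHeq : HasFDerivAt H (Heq : E × C(unitInterval, E) →L[ℝ] E × C(unitInterval, E))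
      (0, constCurve p) := by
    convert hHd (0, constCurve p) using 1
    refine ContinuousLinearMap.ext fun z => Prod.ext rfl ?_
    change z.2 + B z.1 = flowDefectDeriv X hX R p (0, constCurve p) (z.1, z.2)
    simp only [B, ContinuousLinearMap.comp_apply, ContinuousLinearMap.inl_apply,
      flowDefectDeriv_apply]
    simp
    abel
  have hUo : IsOpen {z : E × C(unitInterval, E) | Set.MapsTo z.2 Set.univ U} :=
    (ContinuousMap.isOpen_setOfPred_mapsTo isCompact_univ hU).preimage continuous_snd
  obtain ⟨g, V₁, hV₁o, hV₁, hgs, hgp, hg⟩ := exists_smooth_local_inverse (f := H) hUo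
    (a := (0, constCurve p)) (fun t _ => hp) hHs.contDiffOn Heq hHeq
  have hH0 : H (0, constCurve p) = 0 := by
    refine Prod.ext rfl ?_
    simp [H, flowDefect]
  rw [hH0] at hV₁ hgp
  let G : E → E := fun v => (g (v, 0)).2 1
  have hev : ∀ z : E × C(unitInterval, E), z.2 1 =
    ((ContinuousMap.evalCLM ℝ (1 : unitInterval)).comp (ContinuousLinearMap.snd ℝ E _)) z :=
    fun z => rfl
  set V₂ : Set E := (fun v : E => ((v, 0) : E × C(unitInterval, E))) ⁻¹' V₁ with hV₂
  have hV₂o : IsOpen V₂ := hV₁o.preimage (by fun_prop)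
  have hinl : ContDiff ℝ (⊤ : ℕ∞) (fun v : E => ((v, 0) : E × C(unitInterval, E))) :=
    contDiff_id.prodMk contDiff_const
  have hGs : ContDiffOn ℝ (⊤ : ℕ∞) G V₂ :=
    ContDiff.comp_contDiffOn (g := fun z : E × C(unitInterval, E) => z.2 1)
      ((ContinuousMap.evalCLM ℝ (1 : unitInterval)).comp
        (ContinuousLinearMap.snd ℝ E C(unitInterval, E))).contDiff
      (hgs.comp hinl.contDiffOn fun v hv => hv)
  have hGd : ∀ v ∈ V₂, ∀ u J, flowDefectDeriv X hX R p (g (v, 0)) (u, J) = 0 →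
      fderiv ℝ G v u = J 1 := by
    intro v hv u J hJ
    have h1 : HasFDerivAt g (fderiv ℝ g (v, 0)) (v, 0) :=
      ((hgs.contDiffAt (hV₁o.mem_nhds hv)).differentiableAt (by simp)).hasFDerivAt
    have h2 : HasFDerivAt (fun v : E => ((v, 0) : E × C(unitInterval, E)))
      (ContinuousLinearMap.inl ℝ E _) v :=
      (ContinuousLinearMap.inl ℝ E C(unitInterval, E)).hasFDerivAt (x := v)
    have h3 := ((ContinuousMap.evalCLM ℝ (1 : unitInterval)).comp
        (ContinuousLinearMap.snd ℝ E C(unitInterval, E))).hasFDerivAt.comp v (h1.comp v h2)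
    have h4 : HasFDerivAt G _ v := h3
    rw [h4.fderiv]
    have h5 := (hg _ hv).2.2 (u, J)
    rw [(hHd _).fderiv] at h5
    have h6 : ((ContinuousLinearMap.fst ℝ E C(unitInterval, E)).prod
      (flowDefectDeriv X hX R p (g (v, 0)))) (u, J) = (u, 0) := Prod.ext rfl hJ
    rw [h6] at h5
    change (fderiv ℝ g (v, 0) (u, 0)).2 1 = J 1
    rw [h5]
  have h0 : (0 : E) ∈ V₂ := hV₁
  have hG0 : G 0 = p := by
    change (g 0).2 1 = p
    rw [hgp]; rfl
  have hGd0 : fderiv ℝ G 0 = ContinuousLinearMap.id ℝ E := by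
    ext u
    obtain ⟨J, hJ1, hJ⟩ := flowDefectDeriv_const_eq_zero hX R p u
    rw [hGd 0 h0 u J (by change flowDefectDeriv X hX R p (g 0) _ = 0; rw [hgp, hJ]), hJ1]
    rfl
  have hGX : ∀ v ∈ V₂, ∀ i, fderiv ℝ G v (X i p) = X i (G v) := by
    intro v hv i
    obtain ⟨hgU, hHg, -⟩ := hg _ hv
    have hg1 : (g (v, 0)).1 = v := congrArg Prod.fst hHg
    have hg2 : flowDefect X (fun i => (hX i).continuous) R p (v, (g (v, 0)).2) = 0 := by
      have h := congrArg Prod.snd hHg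
      rwa [show g (v, 0) = (v, (g (v, 0)).2) from Prod.ext hg1 rfl] at h
    obtain ⟨J, hJ1, hJ⟩ := flowDefectDeriv_eq_zero hX (fun t => hgU (Set.mem_univ t)) hcomm hR hg2 i
    rw [hGd v hv _ J (by rw [show g (v, 0) = (v, (g (v, 0)).2) from Prod.ext hg1 rfl]; exact hJ),
      hJ1]
  have hGd0' : HasFDerivAt G ((ContinuousLinearEquiv.refl ℝ E : E ≃L[ℝ] E) : E →L[ℝ] E) 0 := by
    have := ((hGs.contDiffAt (hV₂o.mem_nhds h0)).differentiableAt (by simp)).hasFDerivAt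
    rw [hGd0] at this
    exact this
  obtain ⟨φ, V₃, hV₃o, hV₃, hφs, hφp, hφ⟩ := exists_smooth_local_inverse hV₂o h0 hGs _ hGd0'
  rw [hG0] at hV₃ hφp
  have hhd : ∀ x ∈ V₃, HasFDerivAt (fun x => α (φ x)) (α.comp (fderiv ℝ φ x)) x := fun x hx =>
    α.hasFDerivAt.comp x
      ((hφs.contDiffAt (hV₃o.mem_nhds hx)).differentiableAt (by simp)).hasFDerivAt
  refine ⟨V₃ ∩ U, hV₃o.inter hU, ⟨hV₃, hp⟩, Set.inter_subset_right, fun x => α (φ x),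
    (α.contDiff.comp_contDiffOn hφs).mono Set.inter_subset_left, ?_, ?_⟩
  · rw [(hhd p hV₃).fderiv]
    ext u
    have := (hφ p hV₃).2.2 u
    rw [hφp, hGd0] at this
    exact congrArg α this
  · intro x hx i
    obtain ⟨hxU, hGx, hu⟩ := hφ x hx.1
    have h1 := hGX _ hxU i
    rw [hGx] at h1
    rw [(hhd x hx.1).fderiv, ContinuousLinearMap.comp_apply, ← h1, hu]

theorem exists_straightening {X : ι → E → E} {U : Set E} {p : E} (hU : IsOpen U) (hp : p ∈ U)
    (hX : ∀ i, ContDiffOn ℝ (⊤ : ℕ∞) (X i) U)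
    (hcomm : ∀ i j, ∀ x ∈ U, fderiv ℝ (X j) x (X i x) = fderiv ℝ (X i) x (X j x))
    (hli : LinearIndependent ℝ fun i => X i p) (α : E →L[ℝ] ℝ) :
    ∃ V : Set E, IsOpen V ∧ p ∈ V ∧ V ⊆ U ∧ ∃ h : E → ℝ, ContDiffOn ℝ (⊤ : ℕ∞) h V ∧
      fderiv ℝ h p = α ∧ ∀ x ∈ V, ∀ i, fderiv ℝ h x (X i x) = α (X i p) := by
  choose Y hYs hY using fun i => exists_contDiff_eventuallyEq hU hp (hX i)
  have hev : ∀ᶠ x in 𝓝 p, ∀ i, Y i =ᶠ[𝓝 x] X i :=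
    Filter.eventually_all.2 fun i => (hY i).eventuallyEq_nhds
  obtain ⟨U', hU'sub, hU'o, hpU'⟩ := mem_nhds_iff.1 (hev.and (hU.mem_nhds hp))
  have hYX : ∀ x ∈ U', ∀ i, Y i x = X i x := fun x hx i => ((hU'sub hx).1 i).eq_of_nhds
  obtain ⟨V, hVo, hpV, hVU, h, hh⟩ := exists_straightening_of_contDiff hYs hU'o hpU'
    (fun i j x hx => by
      rw [((hU'sub hx).1 i).fderiv_eq, ((hU'sub hx).1 j).fderiv_eq, hYX x hx, hYX x hx]
      exact hcomm i j x (hU'sub hx).2)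
    (by simpa only [hYX p hpU'] using hli) α
  refine ⟨V, hVo, hpV, fun x hx => (hU'sub (hVU hx)).2, h, hh.1, hh.2.1, fun x hx i => ?_⟩
  rw [← hYX x (hVU hx) i, ← hYX p hpU' i]
  exact hh.2.2 x hx i

end Straightening

section Bracket

variable {N : ℕ}

theorem fderiv_apply_eq_sum_pd (h : Pt N → ℝ) (x v : Pt N) :
    fderiv ℝ h x v = ∑ j, v j * pd h j x := by
  conv_lhs => rw [← Finset.univ_sum_single v, map_sum]
  refine Finset.sum_congr rfl fun j _ => ?_
  rw [show (Pi.single j (v j) : Pt N) = v j • Pi.single j 1 by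
    rw [← Pi.single_smul, smul_eq_mul, mul_one], map_smul, smul_eq_mul, pd]

theorem braF_eq_fderiv (Λ : Form N 2) (g h : Pt N → ℝ) (x : Pt N) :
    braF Λ g h x = fderiv ℝ h x (hamV Λ g x) := by
  rw [fderiv_apply_eq_sum_pd, braF, Finset.sum_comm]
  refine Finset.sum_congr rfl fun j _ => ?_
  rw [hamV, sharpV, Finset.sum_mul]
  rfl

theorem pd_eventuallyEq {g g' : Pt N → ℝ} {x : Pt N} (h : g =ᶠ[𝓝 x] g') (i : Fin N) :
    pd g i x = pd g' i x := by
  rw [pd, pd, h.fderiv_eq]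

theorem braF_eventuallyEq (Λ : Form N 2) {g g' h h' : Pt N → ℝ} {x : Pt N} (hg : g =ᶠ[𝓝 x] g')
    (hh : h =ᶠ[𝓝 x] h') : braF Λ g h =ᶠ[𝓝 x] braF Λ g' h' := by
  filter_upwards [hg.eventuallyEq_nhds, hh.eventuallyEq_nhds] with y hy hy'
  simp only [braF, pd_eventuallyEq hy, pd_eventuallyEq hy']

theorem AltArr.swap {f : (Fin 2 → Fin N) → ℝ} (hf : AltArr f) (i j : Fin N) :
    f ![i, j] = -f ![j, i] := by
  have := hf.1 ![j, i] (Equiv.swap 0 1)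
  rw [show (![j, i] ∘ Equiv.swap (0 : Fin 2) 1) = ![i, j] by
    ext t; fin_cases t <;> simp] at this
  rw [this, Equiv.Perm.sign_swap (by decide)]
  simp

theorem braF_swap {Λ : Form N 2} {M : Set (Pt N)} (hΛ : IsFormOn Λ M) (g h : Pt N → ℝ) {x : Pt N}
    (hx : x ∈ M) : braF Λ g h x = -braF Λ h g x := by
  rw [braF, braF, Finset.sum_comm, ← Finset.sum_neg_distrib]
  refine Finset.sum_congr rfl fun i _ => ?_
  rw [← Finset.sum_neg_distrib]
  refine Finset.sum_congr rfl fun j _ => ?_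
  rw [(hΛ.1 x hx).swap]
  ring

theorem contDiffOn_pd {g : Pt N → ℝ} {V : Set (Pt N)} (hV : IsOpen V)
    (hg : ContDiffOn ℝ (⊤ : ℕ∞) g V) (i : Fin N) : ContDiffOn ℝ (⊤ : ℕ∞) (pd g i) V :=
  (hg.fderiv_of_isOpen hV (by simp)).clm_apply contDiffOn_const

theorem contDiffOn_hamV {Λ : Form N 2} {M V : Set (Pt N)} (hΛ : IsFormOn Λ M) (hV : IsOpen V)
    (hVM : V ⊆ M) {g : Pt N → ℝ} (hg : ContDiffOn ℝ (⊤ : ℕ∞) g V) :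
    ContDiffOn ℝ (⊤ : ℕ∞) (hamV Λ g) V :=
  contDiffOn_pi.2 fun j =>
    show ContDiffOn ℝ (⊤ : ℕ∞) (fun x => ∑ i, Λ x ![i, j] * pd g i x) V from
      ContDiffOn.sum fun i _ => ((hΛ.2 ![i, j]).mono hVM).mul (contDiffOn_pd hV hg i)

theorem JacobiOn.mono {Λ : Form N 2} {M V : Set (Pt N)} (hJ : JacobiOn Λ M) (hV : IsOpen V)
    (hVM : V ⊆ M) : JacobiOn Λ V := by
  intro g h k hg hh hk x hx
  obtain ⟨g', hg's, hg'⟩ := exists_contDiff_eventuallyEq hV hx hg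
  obtain ⟨h', hh's, hh'⟩ := exists_contDiff_eventuallyEq hV hx hh
  obtain ⟨k', hk's, hk'⟩ := exists_contDiff_eventuallyEq hV hx hk
  have := hJ g' h' k' hg's.contDiffOn hh's.contDiffOn hk's.contDiffOn x (hVM hx)
  rwa [(braF_eventuallyEq Λ hg' (braF_eventuallyEq Λ hh' hk')).eq_of_nhds,
    (braF_eventuallyEq Λ hh' (braF_eventuallyEq Λ hk' hg')).eq_of_nhds,
    (braF_eventuallyEq Λ hk' (braF_eventuallyEq Λ hg' hh')).eq_of_nhds] at this

theorem braF_coord (Λ : Form N 2) (g : Pt N → ℝ) (j : Fin N) (x : Pt N) :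
    braF Λ g (fun y => y j) x = hamV Λ g x j := by
  rw [braF_eq_fderiv, (hasFDerivAt_apply (𝕜 := ℝ) j x).fderiv]
  rfl

/-- Functions with locally constant bracket have commuting hamiltonian fields. -/
theorem hamV_commute {Λ : Form N 2} {M V : Set (Pt N)} (hΛ : IsFormOn Λ M) (hJ : JacobiOn Λ M)
    (hV : IsOpen V) (hVM : V ⊆ M) {g h : Pt N → ℝ} (hg : ContDiffOn ℝ (⊤ : ℕ∞) g V)
    (hh : ContDiffOn ℝ (⊤ : ℕ∞) h V) {c : ℝ} (hc : ∀ x ∈ V, braF Λ g h x = c) {x : Pt N}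
    (hx : x ∈ V) :
    fderiv ℝ (hamV Λ h) x (hamV Λ g x) = fderiv ℝ (hamV Λ g) x (hamV Λ h x) := by
  have hcomp : ∀ {u : Pt N → ℝ}, ContDiffOn ℝ (⊤ : ℕ∞) u V → ∀ (v : Pt N) (j : Fin N),
      fderiv ℝ (hamV Λ u) x v j = fderiv ℝ (braF Λ u fun y => y j) x v := by
    intro u hu v j
    have hd := ((contDiffOn_hamV hΛ hV hVM hu).contDiffAt (hV.mem_nhds hx)).differentiableAt
      (by simp)
    have h1 : HasFDerivAt (fun y => hamV Λ u y j)
        ((ContinuousLinearMap.proj j).comp (fderiv ℝ (hamV Λ u) x)) x :=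
      (hasFDerivAt_apply (𝕜 := ℝ) j (hamV Λ u x)).comp x hd.hasFDerivAt
    rw [show (braF Λ u fun y => y j) = fun y => hamV Λ u y j from
      funext fun y => braF_coord Λ u j y, h1.fderiv]
    rfl
  funext j
  rw [hcomp hh, hcomp hg, ← braF_eq_fderiv, ← braF_eq_fderiv]
  have hs : ContDiffOn ℝ (⊤ : ℕ∞) (fun y : Pt N => y j) V := (contDiff_apply ℝ ℝ j).contDiffOn
  have hjac := hJ.mono hV hVM g h (fun y => y j) hg hh hs x hx
  have h2 : braF Λ h (braF Λ (fun y => y j) g) x = -braF Λ h (braF Λ g fun y => y j) x := by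
    have : braF Λ (fun y => y j) g =ᶠ[𝓝 x] fun y => -braF Λ g (fun y => y j) y :=
      Filter.eventuallyEq_of_mem (hV.mem_nhds hx) fun y hy => braF_swap hΛ _ _ (hVM hy)
    rw [braF_eq_fderiv, braF_eq_fderiv, this.fderiv_eq, fderiv_fun_neg]
    rfl
  have h3 : braF Λ (fun y => y j) (braF Λ g h) x = 0 := by
    have : braF Λ g h =ᶠ[𝓝 x] fun _ => c :=
      Filter.eventuallyEq_of_mem (hV.mem_nhds hx) fun y hy => hc y hy
    rw [braF_eq_fderiv, this.fderiv_eq]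
    simp
  rw [h2, h3] at hjac
  linarith

/-- The covector `a` as a continuous linear form. -/
def covecL (a : Fin N → ℝ) : Pt N →L[ℝ] ℝ := ∑ i, a i • ContinuousLinearMap.proj i

theorem covecL_apply (a v : Fin N → ℝ) : covecL a v = ∑ i, a i * v i := by
  simp [covecL]

theorem grad_eq_of_fderiv_eq {h : Pt N → ℝ} {x : Pt N} {a : Fin N → ℝ}
    (hh : fderiv ℝ h x = covecL a) : grad h x = a := by
  funext i
  rw [grad, pd, hh, covecL_apply]
  simp [Pi.single_apply]

/-- The value at two covectors of a bivector array. -/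
def bival (P : (Fin 2 → Fin N) → ℝ) (a b : Fin N → ℝ) : ℝ := ∑ i, ∑ j, P ![i, j] * a i * b j

theorem braF_eq_bival (Λ : Form N 2) (g h : Pt N → ℝ) (x : Pt N) :
    braF Λ g h x = bival (Λ x) (grad g x) (grad h x) := rfl

theorem bival_eq_covecL (Λ : Form N 2) (x : Pt N) (a b : Fin N → ℝ) :
    bival (Λ x) a b = covecL b (sharpV Λ a x) := by
  rw [covecL_apply, bival, Finset.sum_comm]
  refine Finset.sum_congr rfl fun j _ => ?_
  rw [sharpV, Finset.mul_sum]
  exact Finset.sum_congr rfl fun i _ => by ring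

theorem bival_self {P : (Fin 2 → Fin N) → ℝ} (hP : AltArr P) (a : Fin N → ℝ) :
    bival P a a = 0 := by
  have : bival P a a = -bival P a a := by
    conv_rhs => rw [bival, Finset.sum_comm]
    rw [bival, ← Finset.sum_neg_distrib]
    refine Finset.sum_congr rfl fun i _ => ?_
    rw [← Finset.sum_neg_distrib]
    refine Finset.sum_congr rfl fun j _ => ?_
    rw [hP.swap]
    ring
  linarith

theorem exists_function_with_constant_brackets {Λ : Form N 2} {M V : Set (Pt N)}
    (hΛ : IsFormOn Λ M) (hJ : JacobiOn Λ M) (hV : IsOpen V) (hVM : V ⊆ M) {p : Pt N} (hp : p ∈ V)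
    {I : Type} (s : Finset I) {α : I → Fin N → ℝ}
    (hli : LinearIndependent ℝ fun l : s => sharpV Λ (α l) p) {Y : I → Pt N → ℝ}
    (hY : ∀ l ∈ s, ContDiffOn ℝ (⊤ : ℕ∞) (Y l) V) (hYα : ∀ l ∈ s, grad (Y l) p = α l)
    (hYY : ∀ l ∈ s, ∀ l' ∈ s, ∀ x ∈ V, braF Λ (Y l) (Y l') x = bival (Λ p) (α l) (α l'))
    (a : Fin N → ℝ) :
    ∃ W : Set (Pt N), IsOpen W ∧ p ∈ W ∧ W ⊆ V ∧ ∃ h : Pt N → ℝ, ContDiffOn ℝ (⊤ : ℕ∞) h W ∧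
      grad h p = a ∧ ∀ l ∈ s, ∀ x ∈ W, braF Λ (Y l) h x = bival (Λ p) (α l) a := by
  have hham : ∀ l : s, hamV Λ (Y l) p = sharpV Λ (α l) p := fun l => by
    rw [hamV, hYα l l.2]
  obtain ⟨W, hW, hpW, hWV, h, hh, hhp, hhx⟩ := exists_straightening
    (X := fun l : s => hamV Λ (Y l)) hV hp (fun l => contDiffOn_hamV hΛ hV hVM (hY l l.2))
    (fun l l' x hx => hamV_commute hΛ hJ hV hVM (hY l l.2) (hY l' l'.2) (hYY l l.2 l' l'.2) hx)
    (by simpa only [hham] using hli) (covecL a)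
  refine ⟨W, hW, hpW, hWV, h, hh, grad_eq_of_fderiv_eq hhp, fun l hl x hx => ?_⟩
  rw [braF_eq_fderiv, hhx x hx ⟨l, hl⟩, hham ⟨l, hl⟩, bival_eq_covecL]

theorem exists_canonical_functions {Λ : Form N 2} {M U : Set (Pt N)}
    (hΛ : IsFormOn Λ M) (hJ : JacobiOn Λ M) (hU : IsOpen U) (hUM : U ⊆ M) {p : Pt N} (hp : p ∈ U)
    {I : Type} [DecidableEq I] {α : I → Fin N → ℝ} (s : Finset I)
    (hli : LinearIndependent ℝ fun l : s => sharpV Λ (α l) p) :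
    ∃ V : Set (Pt N), IsOpen V ∧ p ∈ V ∧ V ⊆ U ∧ ∃ Y : I → Pt N → ℝ,
      (∀ l ∈ s, ContDiffOn ℝ (⊤ : ℕ∞) (Y l) V) ∧ (∀ l ∈ s, grad (Y l) p = α l) ∧
      ∀ l ∈ s, ∀ l' ∈ s, ∀ x ∈ V, braF Λ (Y l) (Y l') x = bival (Λ p) (α l) (α l') := by
  induction s using Finset.induction_on with
  | empty => exact ⟨U, hU, hp, subset_rfl, fun _ _ => 0, by simp, by simp, by simp⟩
  | insert l₀ s hl₀ ih =>
    have hli' : LinearIndependent ℝ fun l : s => sharpV Λ (α l) p :=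
      hli.comp (fun l : s => (⟨l, Finset.mem_insert_of_mem l.2⟩ : (insert l₀ s : Finset I)))
        fun a b hab => Subtype.ext (by simpa using hab)
    obtain ⟨V, hV, hpV, hVU, Y, hY, hYα, hYY⟩ := ih hli'
    obtain ⟨W, hW, hpW, hWV, h, hh, hhp, hhb⟩ := exists_function_with_constant_brackets hΛ hJ hV
      (hVU.trans hUM) hpV s hli' hY hYα hYY (α l₀)
    have hne : ∀ l ∈ s, l ≠ l₀ := fun l hl e => hl₀ (e ▸ hl)
    refine ⟨W, hW, hpW, hWV.trans hVU, Function.update Y l₀ h, ?_, ?_, ?_⟩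
    · intro l hl
      obtain rfl | hl := Finset.mem_insert.1 hl
      · simpa using hh
      · simpa [hne l hl] using (hY l hl).mono hWV
    · intro l hl
      obtain rfl | hl := Finset.mem_insert.1 hl
      · simpa using hhp
      · simpa [hne l hl] using hYα l hl
    · have hMp := hΛ.1 p (hUM hp)
      intro l hl l' hl' x hx
      have hMx : x ∈ M := hUM (hVU (hWV hx))
      have hswap : ∀ a b, bival (Λ p) a b = -bival (Λ p) b a := fun a b => by
        have h := braF_swap hΛ (covecL a) (covecL b) (hUM hp)
        have hg : ∀ a : Fin N → ℝ, grad (covecL a) p = a := fun a =>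
          grad_eq_of_fderiv_eq (ContinuousLinearMap.fderiv _)
        rwa [braF_eq_bival, braF_eq_bival, hg, hg] at h
      rcases Finset.mem_insert.1 hl with h1 | h1 <;>
        rcases Finset.mem_insert.1 hl' with h2 | h2
      · rw [h1, h2, braF_eq_bival, bival_self (hΛ.1 x hMx), bival_self hMp]
      · rw [h1, Function.update_self, Function.update_of_ne (hne _ h2), braF_swap hΛ _ _ hMx,
          hhb l' h2 x hx, ← hswap]
      · rw [h2, Function.update_self, Function.update_of_ne (hne _ h1), hhb l h1 x hx]
      · rw [Function.update_of_ne (hne _ h1), Function.update_of_ne (hne _ h2),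
          hYY l h1 l' h2 x (hWV hx)]

/-- Local functions with prescribed independent differentials at `p`, whose brackets with those
indexed by `s` are constant. -/
theorem exists_canonical_coordinates {Λ : Form N 2} {M U : Set (Pt N)}
    (hΛ : IsFormOn Λ M) (hJ : JacobiOn Λ M) (hU : IsOpen U) (hUM : U ⊆ M) {p : Pt N} (hp : p ∈ U)
    {I : Type} [DecidableEq I] [Fintype I] {α : I → Fin N → ℝ} (s : Finset I)
    (hli : LinearIndependent ℝ fun l : s => sharpV Λ (α l) p) :
    ∃ V : Set (Pt N), IsOpen V ∧ p ∈ V ∧ V ⊆ U ∧ ∃ Y : I → Pt N → ℝ,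
      (∀ l, ContDiffOn ℝ (⊤ : ℕ∞) (Y l) V) ∧ (∀ l, grad (Y l) p = α l) ∧
      ∀ l ∈ s, ∀ l', ∀ x ∈ V, braF Λ (Y l) (Y l') x = bival (Λ p) (α l) (α l') := by
  obtain ⟨V, hV, hpV, hVU, Y, hY, hYα, hYY⟩ :=
    exists_canonical_functions hΛ hJ hU hUM hp s hli
  choose W hW hpW hWV h hh hhp hhb using fun l =>
    exists_function_with_constant_brackets hΛ hJ hV (hVU.trans hUM) hpV s hli hY hYα hYY (α l)
  have hsub : ∀ l, V ∩ ⋂ l, W l ⊆ W l := fun l => Set.inter_subset_right.trans (Set.iInter_subset W l)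
  refine ⟨V ∩ ⋂ l, W l, hV.inter (isOpen_iInter_of_finite hW), ⟨hpV, Set.mem_iInter.2 hpW⟩,
    Set.inter_subset_left.trans hVU, fun l => if l ∈ s then Y l else h l, ?_, ?_, ?_⟩
  · intro l
    dsimp only
    split_ifs with hl
    · exact (hY l hl).mono Set.inter_subset_left
    · exact (hh l).mono (hsub l)
  · intro l
    dsimp only
    split_ifs with hl
    · exact hYα l hl
    · exact hhp l
  · intro l hl l' x hx
    simp only [hl, if_true]
    split_ifs with hl'
    · exact hYY l hl l' hl' x hx.1
    · exact hhb l' l hl x (hsub l' hx)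

end Bracket

section SymplecticBasis

/-- The Gram matrix of a family of hyperbolic pairs. -/
def hyp {ι : Type} [DecidableEq ι] (l m : ι × Fin 2) : ℝ :=
  if l.1 = m.1 then ((m.2 : ℕ) : ℝ) - ((l.2 : ℕ) : ℝ) else 0

variable {V : Type*} [AddCommGroup V] [Module ℝ V]

theorem sum_mul_hyp {ι : Type} [DecidableEq ι] [Fintype ι] (c : ι × Fin 2 → ℝ) (i : ι) :
    ∑ l, c l * hyp l (i, 0) = -c (i, 1) ∧ ∑ l, c l * hyp l (i, 1) = c (i, 0) := by
  constructor <;> simp [Fintype.sum_prod_type, hyp]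

theorem linearIndependent_of_hyp {ι : Type} [DecidableEq ι] [Fintype ι]
    {B : LinearMap.BilinForm ℝ V} {v : ι × Fin 2 → V} (hv : ∀ l m, B (v l) (v m) = hyp l m) :
    LinearIndependent ℝ fun l => B (v l) := by
  rw [Fintype.linearIndependent_iff]
  intro c hc
  have h : ∀ m, ∑ l, c l * hyp l m = 0 := fun m => by
    simpa [hv] using LinearMap.congr_fun hc (v m)
  rintro ⟨i, s⟩
  fin_cases s
  · exact (sum_mul_hyp c i).2.symm.trans (h _)
  · exact neg_eq_zero.1 ((sum_mul_hyp c i).1.symm.trans (h _))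

/-- The component of `y` orthogonal to a family of hyperbolic pairs. -/
def hypResidue {ι : Type} [Fintype ι] (B : LinearMap.BilinForm ℝ V) (v : ι × Fin 2 → V) (y : V) :
    V :=
  y - ∑ i, (B y (v (i, 1)) • v (i, 0) - B y (v (i, 0)) • v (i, 1))

theorem hypResidue_orthogonal {ι : Type} [DecidableEq ι] [Fintype ι]
    {B : LinearMap.BilinForm ℝ V} {v : ι × Fin 2 → V} (hv : ∀ l m, B (v l) (v m) = hyp l m)
    (y : V) (m : ι × Fin 2) : B (hypResidue B v y) (v m) = 0 := by
  obtain ⟨i, s⟩ := m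
  fin_cases s <;> simp [hypResidue, hv, hyp]

theorem sub_hypResidue_mem_span {ι : Type} [Fintype ι] (B : LinearMap.BilinForm ℝ V)
    (v : ι × Fin 2 → V) (y : V) : y - hypResidue B v y ∈ Submodule.span ℝ (Set.range v) := by
  rw [hypResidue, sub_sub_cancel]
  exact Submodule.sum_mem _ fun i _ => Submodule.sub_mem _
    (Submodule.smul_mem _ _ (Submodule.subset_span ⟨_, rfl⟩))
    (Submodule.smul_mem _ _ (Submodule.subset_span ⟨_, rfl⟩))

theorem exists_hyp_succ {B : LinearMap.BilinForm ℝ V} (hB : B.IsAlt) {j : ℕ}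
    {v : Fin j × Fin 2 → V} (hv : ∀ l m, B (v l) (v m) = hyp l m) {y z : V}
    (hy : ∀ m, B y (v m) = 0) (hz : ∀ m, B z (v m) = 0) (hyz : B y z ≠ 0) :
    ∃ v' : Fin (j + 1) × Fin 2 → V, ∀ l m, B (v' l) (v' m) = hyp l m := by
  refine ⟨fun l => Fin.cases (![y, (B y z)⁻¹ • z] l.2) (fun i => v (i, l.2)) l.1, ?_⟩
  have hneg : ∀ a b, B a b = -B b a := fun a b => (hB.neg_eq b a).symm
  rintro ⟨l, s⟩ ⟨m, t⟩
  refine Fin.cases ?_ (fun i => ?_) l <;> refine Fin.cases ?_ (fun i' => ?_) m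
  · fin_cases s <;> fin_cases t <;> simp [hyp, hB y, hB z, hyz]
    rw [hneg z y]
    simp [hyz]
  · fin_cases s <;> simp [hyp, hy, hz, Ne.symm (Fin.succ_ne_zero i')]
  · rw [hneg]
    fin_cases t <;> simp [hyp, hy, hz, Fin.succ_ne_zero]
  · simp [hyp, hv]

theorem hypResidue_mem_ker {B : LinearMap.BilinForm ℝ V} (hB : B.IsAlt) {j : ℕ}
    {v : Fin j × Fin 2 → V} (hv : ∀ l m, B (v l) (v m) = hyp l m)
    (hmax : ¬ ∃ v' : Fin (j + 1) × Fin 2 → V, ∀ l m, B (v' l) (v' m) = hyp l m) (y : V) :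
    hypResidue B v y ∈ LinearMap.ker B := by
  refine LinearMap.ext fun z => ?_
  by_contra hne
  have hspan : B (hypResidue B v y) (z - hypResidue B v z) = 0 := by
    refine Submodule.span_induction (p := fun w _ => B (hypResidue B v y) w = 0) ?_ (by simp)
      (fun a b _ _ ha hb => by rw [map_add, ha, hb, add_zero])
      (fun c a _ ha => by rw [map_smul, ha, smul_zero]) (sub_hypResidue_mem_span B v z)
    rintro _ ⟨m, rfl⟩
    exact hypResidue_orthogonal hv y m
  rw [map_sub, sub_eq_zero] at hspan
  exact hmax (exists_hyp_succ hB hv (hypResidue_orthogonal hv y) (hypResidue_orthogonal hv z)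
    (by rwa [← hspan]))

theorem two_mul_le_finrank_range [FiniteDimensional ℝ V] {B : LinearMap.BilinForm ℝ V} {j : ℕ}
    {v : Fin j × Fin 2 → V} (hv : ∀ l m, B (v l) (v m) = hyp l m) :
    2 * j ≤ Module.finrank ℝ (LinearMap.range B) := by
  have hli : LinearIndependent ℝ fun l => (⟨B (v l), ⟨_, rfl⟩⟩ : LinearMap.range B) :=
    LinearIndependent.of_comp (LinearMap.range B).subtype (linearIndependent_of_hyp hv)
  have := hli.fintype_card_le_finrank
  simp only [Fintype.card_prod, Fintype.card_fin] at this
  omega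

theorem exists_maximal_hyp [FiniteDimensional ℝ V] (B : LinearMap.BilinForm ℝ V) :
    ∃ (j : ℕ) (v : Fin j × Fin 2 → V), (∀ l m, B (v l) (v m) = hyp l m) ∧
      ¬ ∃ v' : Fin (j + 1) × Fin 2 → V, ∀ l m, B (v' l) (v' m) = hyp l m := by
  by_contra! h
  have : ∀ j, ∃ v : Fin j × Fin 2 → V, ∀ l m, B (v l) (v m) = hyp l m := fun j => by
    induction j with
    | zero => exact ⟨fun _ => 0, fun l => l.1.elim0⟩
    | succ j ih => exact ih.elim (h j)
  obtain ⟨v, hv⟩ := this (Module.finrank ℝ (LinearMap.range B) + 1)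
  have := two_mul_le_finrank_range hv
  omega

/-- A vector orthogonal to a family of hyperbolic pairs of maximal size is in the kernel. -/
theorem mem_ker_of_orthogonal [FiniteDimensional ℝ V] {B : LinearMap.BilinForm ℝ V} (hB : B.IsAlt)
    {k : ℕ} (hr : Module.finrank ℝ (LinearMap.range B) = 2 * k) {v : Fin k × Fin 2 → V}
    (hv : ∀ l m, B (v l) (v m) = hyp l m) {y : V} (hy : ∀ m, B y (v m) = 0) : B y = 0 := by
  have h := hypResidue_mem_ker hB hv (fun ⟨v', hv'⟩ => by
    have := two_mul_le_finrank_range hv'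
    omega) y
  simpa [hypResidue, hy] using h

/-- An alternating form of rank `2k` on a `2n`-dimensional space has a symplectic basis. -/
theorem exists_symplectic_basis [FiniteDimensional ℝ V] {B : LinearMap.BilinForm ℝ V}
    (hB : B.IsAlt) {n k : ℕ} (hV : Module.finrank ℝ V = 2 * n)
    (hr : Module.finrank ℝ (LinearMap.range B) = 2 * k) :
    ∃ α : Fin n × Fin 2 → V, LinearIndependent ℝ α ∧
      ∀ l m, B (α l) (α m) = if (l.1 : ℕ) < k then hyp l m else 0 := by
  obtain ⟨j, v, hv, hmax⟩ := exists_maximal_hyp B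
  have hres := hypResidue_mem_ker hB hv hmax
  have hrn := LinearMap.finrank_range_add_finrank_ker B
  have hle : 2 * j ≤ 2 * k := hr ▸ two_mul_le_finrank_range hv
  have hmem : ∀ y, y ∈ Submodule.span ℝ (Set.range v) ⊔ LinearMap.ker B := fun y => by
    rw [← sub_add_cancel y (hypResidue B v y)]
    exact Submodule.add_mem_sup (sub_hypResidue_mem_span B v y) (hres y)
  have hge : 2 * k ≤ 2 * j := by
    have h1 : Submodule.span ℝ (Set.range v) ⊔ LinearMap.ker B = ⊤ :=
      eq_top_iff.2 fun y _ => hmem y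
    have h2 := Submodule.finrank_add_le_finrank_add_finrank
      (Submodule.span ℝ (Set.range v)) (LinearMap.ker B)
    have h3 := finrank_range_le_card (R := ℝ) v
    rw [h1, finrank_top] at h2
    simp [Set.finrank] at h3
    omega
  obtain rfl : j = k := by omega
  have hker : Module.finrank ℝ (LinearMap.ker B) = Fintype.card (Fin (n - j) × Fin 2) := by
    simp
    omega
  let w := (Module.finBasisOfFinrankEq ℝ (LinearMap.ker B) rfl).reindex
    (Fintype.equivOfCardEq (by simpa using hker) : _ ≃ Fin (n - j) × Fin 2)
  have hw : ∀ l z, B (w l) z = 0 := fun l z => by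
    rw [LinearMap.mem_ker.1 (w l).2, LinearMap.zero_apply]
  have hw' : ∀ l z, B z (w l) = 0 := fun l z => by rw [← hB.neg_eq, hw, neg_zero]
  have hjn : j ≤ n := by omega
  refine ⟨fun l => if h : (l.1 : ℕ) < j then v (⟨l.1, h⟩, l.2)
    else w (⟨l.1 - j, by omega⟩, l.2), ?_, ?_⟩
  · refine linearIndependent_of_top_le_span_of_card_eq_finrank ?_ (by simp [hV, mul_comm])
    intro y _
    refine (sup_le ?_ ?_ : Submodule.span ℝ (Set.range v) ⊔ LinearMap.ker B ≤ _) (hmem y)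
    · rw [Submodule.span_le]
      rintro _ ⟨⟨i, s⟩, rfl⟩
      exact Submodule.subset_span ⟨(⟨i, by omega⟩, s), by simp⟩
    · intro z hz
      have := congrArg (LinearMap.ker B).subtype (w.sum_repr ⟨z, hz⟩)
      rw [map_sum] at this
      rw [show z = _ from this.symm]
      refine Submodule.sum_mem _ fun l _ => ?_
      rw [map_smul]
      refine Submodule.smul_mem _ _ (Submodule.subset_span ⟨(⟨l.1 + j, by omega⟩, l.2), ?_⟩)
      simp
  · rintro ⟨l, s⟩ ⟨m, t⟩
    by_cases hl : (l : ℕ) < j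
    · by_cases hm : (m : ℕ) < j
      · simp [hl, hm, hv, hyp, Fin.ext_iff]
      · have : l ≠ m := fun e => hm (e ▸ hl)
        simp [hl, hm, hw', hyp, this]
    · simp [hl]

end SymplecticBasis

section DarbouxWeinstein

theorem contDiffOn_det {E ι : Type*} [NormedAddCommGroup E] [NormedSpace ℝ E] [Fintype ι]
    [DecidableEq ι] {A : E → Matrix ι ι ℝ} {V : Set E}
    (hA : ∀ i j, ContDiffOn ℝ (⊤ : ℕ∞) (fun x => A x i j) V) :
    ContDiffOn ℝ (⊤ : ℕ∞) (fun x => (A x).det) V := by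
  simp only [Matrix.det_apply']
  exact ContDiffOn.sum fun σ _ =>
    contDiffOn_const.mul (contDiffOn_prod fun i _ => hA (σ i) i)

theorem contDiffOn_matrix_inv {E ι : Type*} [NormedAddCommGroup E] [NormedSpace ℝ E] [Fintype ι]
    [DecidableEq ι] {A : E → Matrix ι ι ℝ} {V : Set E}
    (hA : ∀ i j, ContDiffOn ℝ (⊤ : ℕ∞) (fun x => A x i j) V) (hdet : ∀ x ∈ V, (A x).det ≠ 0)
    (i j : ι) : ContDiffOn ℝ (⊤ : ℕ∞) (fun x => (A x)⁻¹ i j) V := by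
  have hadj : ContDiffOn ℝ (⊤ : ℕ∞) (fun x => (A x).adjugate i j) V := by
    simp only [Matrix.adjugate_apply]
    refine contDiffOn_det fun a b => ?_
    by_cases h : a = j
    · subst h
      simpa using contDiffOn_const
    · simpa [Matrix.updateRow_ne h] using hA a b
  refine ((contDiffOn_det hA).inv hdet).mul hadj |>.congr fun x _ => ?_
  rw [Matrix.inv_def, Ring.inverse_eq_inv', Matrix.smul_apply, smul_eq_mul, Pi.inv_apply]

variable {N : ℕ}

/-- The bilinear form on covectors defined by a bivector. -/
def bivalForm (Λ : Form N 2) (x : Pt N) : LinearMap.BilinForm ℝ (Fin N → ℝ) :=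
  Matrix.toBilin' (mat2 Λ x)

theorem bivalForm_apply (Λ : Form N 2) (x : Pt N) (a b : Fin N → ℝ) :
    bivalForm Λ x a b = bival (Λ x) a b := by
  rw [bivalForm, Matrix.toBilin'_apply, bival]
  exact Finset.sum_congr rfl fun i _ => Finset.sum_congr rfl fun j _ => by
    rw [mat2, Matrix.of_apply]; ring

theorem bivalForm_eq (Λ : Form N 2) (x : Pt N) (a : Fin N → ℝ) :
    bivalForm Λ x a = dotProductEquiv ℝ (Fin N) (sharpV Λ a x) := by
  refine LinearMap.ext fun b => ?_
  rw [bivalForm_apply, bival_eq_covecL, covecL_apply]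
  exact Finset.sum_congr rfl fun i _ => mul_comm _ _

theorem finrank_range_bivalForm (Λ : Form N 2) (x : Pt N) :
    Module.finrank ℝ (LinearMap.range (bivalForm Λ x)) = (mat2 Λ x).rank := by
  have : bivalForm Λ x =
      (dotProductEquiv ℝ (Fin N)).toLinearMap ∘ₗ (mat2 Λ x).transpose.mulVecLin :=
    LinearMap.ext fun a => bivalForm_eq Λ x a
  rw [this, LinearMap.range_comp, LinearEquiv.finrank_map_eq, ← Matrix.rank_transpose]
  rfl

theorem isAlt_bivalForm {Λ : Form N 2} {x : Pt N} (hΛ : AltArr (Λ x)) : (bivalForm Λ x).IsAlt :=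
  fun a => (bivalForm_apply Λ x a a).trans (bival_self hΛ a)

/-- The first `k` hyperbolic pairs of a family of `n` pairs. -/
def firstPairs {n k : ℕ} (hkn : k ≤ n) (l : Fin k × Fin 2) : Fin n × Fin 2 :=
  (Fin.castLE hkn l.1, l.2)

theorem hyp_firstPairs {n k : ℕ} (hkn : k ≤ n) (l m : Fin k × Fin 2) :
    hyp (firstPairs hkn l) (firstPairs hkn m) = hyp l m := by
  simp [hyp, firstPairs]

/-- The Gram matrix of the standard alternating form of rank `2k`. -/
def hypTrunc {n : ℕ} (k : ℕ) (l m : Fin n × Fin 2) : ℝ := if (l.1 : ℕ) < k then hyp l m else 0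

theorem hypTrunc_firstPairs {n k : ℕ} (hkn : k ≤ n) (l m : Fin k × Fin 2) :
    hypTrunc k (firstPairs hkn l) (firstPairs hkn m) = hyp l m := by
  rw [← hyp_firstPairs hkn l m, hypTrunc, if_pos]
  exact l.1.isLt

/-- Darboux coordinates on a neighbourhood of `p`, together with the dual frame. -/
theorem exists_darboux {n k : ℕ} (hkn : k ≤ n) {M U : Set (Pt (2 * n))} {Λ : Form (2 * n) 2}
    (hΛ : IsFormOn Λ M) (hJ : JacobiOn Λ M) (hU : IsOpen U) (hUM : U ⊆ M)
    (hrank : ∀ x ∈ U, (mat2 Λ x).rank = 2 * k) {p : Pt (2 * n)} (hp : p ∈ U) :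
    ∃ V : Set (Pt (2 * n)), IsOpen V ∧ p ∈ V ∧ V ⊆ U ∧
      ∃ (Y : Fin n × Fin 2 → Pt (2 * n) → ℝ) (v : Fin n × Fin 2 → Pt (2 * n) → Fin (2 * n) → ℝ),
        (∀ l, ContDiffOn ℝ (⊤ : ℕ∞) (Y l) V) ∧
        (∀ l j, ContDiffOn ℝ (⊤ : ℕ∞) (fun x => v l x j) V) ∧
        ∀ x ∈ V, (∀ l m, ∑ j, grad (Y l) x j * v m x j = if l = m then 1 else 0) ∧
          (∀ i j, ∑ l, grad (Y l) x i * v l x j = if i = j then 1 else 0) ∧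
          ∀ l m, bival (Λ x) (grad (Y l) x) (grad (Y m) x) = hypTrunc k l m := by
  obtain ⟨α, hαi, hα⟩ := exists_symplectic_basis (isAlt_bivalForm (hΛ.1 p (hUM hp)))
    (n := n) (k := k) (by simp) ((finrank_range_bivalForm Λ p).trans (hrank p hp))
  have hα' : ∀ l m, bival (Λ p) (α l) (α m) = hypTrunc k l m := fun l m => by
    rw [← bivalForm_apply, hα]; rfl
  let s : Finset (Fin n × Fin 2) := Finset.univ.filter fun l => (l.1 : ℕ) < k
  have hs : ∀ l : s, (l.1.1 : ℕ) < k := fun l => (Finset.mem_filter.1 l.2).2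
  have hli : LinearIndependent ℝ fun l : s => sharpV Λ (α l) p := by
    have h1 : LinearIndependent ℝ fun l : Fin k × Fin 2 => bivalForm Λ p (α (firstPairs hkn l)) :=
      linearIndependent_of_hyp fun l m => by
        rw [bivalForm_apply, hα', hypTrunc_firstPairs]
    refine LinearIndependent.of_comp (dotProductEquiv ℝ (Fin (2 * n))).toLinearMap ?_
    convert h1.comp (fun l : s => ((⟨l.1.1, hs l⟩ : Fin k), l.1.2)) (fun a b hab => ?_) using 1
    · funext l
      exact (bivalForm_eq Λ p _).symm
    · simp only [Prod.mk.injEq, Fin.mk.injEq] at hab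
      exact Subtype.ext (Prod.ext (Fin.ext hab.1) hab.2)
  obtain ⟨V, hV, hpV, hVU, Y, hYs, hYp, hYY⟩ := exists_canonical_coordinates hΛ hJ hU hUM hp s hli
  let e : Fin (2 * n) ≃ Fin n × Fin 2 := Fintype.equivOfCardEq (by simp [mul_comm])
  let A : Pt (2 * n) → Matrix (Fin (2 * n)) (Fin (2 * n)) ℝ := fun x =>
    Matrix.of fun i j => grad (Y (e i)) x j
  have hA : ∀ i j, ContDiffOn ℝ (⊤ : ℕ∞) (fun x => A x i j) V := fun i j =>
    contDiffOn_pd hV (hYs (e i)) j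
  have hAp : (A p).det ≠ 0 := by
    have : LinearIndependent ℝ (A p).row := by
      rw [show (A p).row = fun i => α (e i) from funext fun i => hYp (e i)]
      exact hαi.comp e e.injective
    exact ((Matrix.isUnit_iff_isUnit_det _).1
      (Matrix.linearIndependent_rows_iff_isUnit.1 this)).ne_zero
  let W : Set (Pt (2 * n)) := V ∩ (fun x => (A x).det) ⁻¹' {0}ᶜ
  have hW : IsOpen W := (contDiffOn_det hA).continuousOn.isOpen_inter_preimage hV
    isOpen_compl_singleton
  have hWV : W ⊆ V := Set.inter_subset_left
  have hinv : ∀ x ∈ W, A x * (A x)⁻¹ = 1 ∧ (A x)⁻¹ * A x = 1 := fun x hx =>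
    have h : IsUnit (A x).det := isUnit_iff_ne_zero.2 hx.2
    ⟨Matrix.mul_nonsing_inv _ h, Matrix.nonsing_inv_mul _ h⟩
  refine ⟨W, hW, ⟨hpV, hAp⟩, hWV.trans hVU, Y, fun l x j => (A x)⁻¹ j (e.symm l),
    fun l => (hYs l).mono hWV, fun l j =>
      contDiffOn_matrix_inv (fun a b => (hA a b).mono hWV) (fun x hx => hx.2) _ _,
    fun x hx => ⟨fun l m => ?_, fun i j => ?_, ?_⟩⟩
  · have := congrFun (congrFun (hinv x hx).1 (e.symm l)) (e.symm m)
    simpa [Matrix.mul_apply, Matrix.one_apply, A] using this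
  · have := congrFun (congrFun (hinv x hx).2 j) i
    rw [Matrix.mul_apply, Matrix.one_apply, ← e.symm.sum_comp] at this
    simpa [A, mul_comm, eq_comm] using this
  · have hxU : x ∈ U := hVU (hWV hx)
    have hfirst : ∀ l m, (l.1 : ℕ) < k →
        bival (Λ x) (grad (Y l) x) (grad (Y m) x) = hypTrunc k l m := fun l m hl => by
      rw [← braF_eq_bival, hYY l (by simpa [s] using hl) m x (hWV hx), hα']
    intro l m
    by_cases hl : (l.1 : ℕ) < k
    · exact hfirst l m hl
    · have hker := mem_ker_of_orthogonal (isAlt_bivalForm (hΛ.1 x (hUM hxU)))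
        ((finrank_range_bivalForm Λ x).trans (hrank x hxU))
        (v := fun l => grad (Y (firstPairs hkn l)) x) (y := grad (Y l) x)
        (fun l m => by
          rw [bivalForm_apply, hfirst _ _ (by exact l.1.isLt), hypTrunc_firstPairs])
        (fun m => by
          have hne : (firstPairs hkn m).1 ≠ l.1 := fun h => hl (h ▸ m.1.isLt)
          rw [← (isAlt_bivalForm (hΛ.1 x (hUM hxU))).neg_eq, bivalForm_apply,
            hfirst _ _ (by exact m.1.isLt), hypTrunc, hyp, if_neg hne, ite_self, neg_zero])
      rw [← bivalForm_apply, hker, hypTrunc, if_neg hl, LinearMap.zero_apply]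

end DarbouxWeinstein

end SmoothNormalForm

section PlaneSum

open Matrix

variable {N : ℕ}

theorem eq_vec2 (I : Fin 2 → Fin N) : I = ![I 0, I 1] := by
  funext t; fin_cases t <;> rfl

theorem altArr_of_perm {p : ℕ} {f : (Fin p → Fin N) → ℝ}
    (hf : ∀ (I : Fin p → Fin N) (σ : Equiv.Perm (Fin p)),
      f (I ∘ σ) = ((Equiv.Perm.sign σ : ℤ) : ℝ) * f I) : AltArr f := by
  refine ⟨hf, fun I hI => ?_⟩
  obtain ⟨a, b, hab, hne⟩ := Function.not_injective_iff.1 hI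
  have h := hf I (Equiv.swap a b)
  rw [Equiv.Perm.sign_swap hne, show I ∘ Equiv.swap a b = I by
    funext t
    rw [Function.comp_apply, Equiv.swap_apply_def]
    split_ifs with h1 h2
    · rw [h1, hab]
    · rw [h2, hab]
    · rfl] at h
  push_cast at h
  linarith

theorem altArr_two {f : (Fin 2 → Fin N) → ℝ} (hf : ∀ i j, f ![i, j] = -f ![j, i]) : AltArr f := by
  refine altArr_of_perm fun I σ => ?_
  have hσ : σ = 1 ∨ σ = Equiv.swap 0 1 := by
    revert σ; decide
  obtain rfl | rfl := hσ
  · simp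
  · rw [eq_vec2 (I ∘ _), Equiv.Perm.sign_swap (by decide), eq_vec2 I]
    simpa using hf (I 1) (I 0)

variable {ι : Type}

/-- The sum `∑_{i ∈ s} θ_{i,0} ∧ θ_{i,1}`, as an array. -/
def planeSum (s : Finset ι) (θ : ι × Fin 2 → Fin N → ℝ) : (Fin 2 → Fin N) → ℝ :=
  fun I => ∑ i ∈ s, (θ (i, 0) (I 0) * θ (i, 1) (I 1) - θ (i, 1) (I 0) * θ (i, 0) (I 1))

theorem altArr_planeSum (s : Finset ι) (θ : ι × Fin 2 → Fin N → ℝ) : AltArr (planeSum s θ) :=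
  altArr_two fun i j => by
    rw [planeSum, planeSum, ← Finset.sum_neg_distrib]
    exact Finset.sum_congr rfl fun a _ => by simp; ring

variable [DecidableEq ι]

/-- The block diagonal matrix with standard hyperbolic blocks over `s`. -/
def hypMat (s : Finset ι) : Matrix (ι × Fin 2) (ι × Fin 2) ℝ :=
  Matrix.of fun l m => if l.1 ∈ s then hyp l m else 0

theorem hypMat_transpose (s : Finset ι) : (hypMat s)ᵀ = -hypMat s := by
  ext ⟨i, a⟩ ⟨j, b⟩
  by_cases hij : i = j
  · subst hij
    by_cases hi : i ∈ s <;> simp [hypMat, hyp, hi]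
  · simp [hypMat, hyp, hij, Ne.symm hij]

variable [Fintype ι]

theorem planeSum_eq_mul (s : Finset ι) (θ : ι × Fin 2 → Fin N → ℝ) :
    (Matrix.of fun i j => planeSum s θ ![i, j]) = (Matrix.of θ)ᵀ * hypMat s * Matrix.of θ := by
  ext a b
  simp only [Matrix.mul_apply, Matrix.of_apply, Matrix.transpose_apply, hypMat, planeSum,
    Fintype.sum_prod_type, Fin.sum_univ_two, hyp, Finset.sum_add_distrib]
  simp only [mul_ite, mul_zero]
  simp [Finset.sum_ite_mem]
  rw [← sub_eq_neg_add, ← Finset.sum_sub_distrib]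

theorem hypMat_univ_mul (s : Finset ι) :
    hypMat Finset.univ * hypMat s = -diagonal fun l : ι × Fin 2 => if l.1 ∈ s then 1 else 0 := by
  ext ⟨i, a⟩ ⟨j, b⟩
  simp only [Matrix.mul_apply, Matrix.of_apply, hypMat, Fintype.sum_prod_type, hyp,
    Fin.sum_univ_two, Matrix.neg_apply, Matrix.diagonal_apply, Prod.mk.injEq]
  simp only [Finset.mem_univ, if_true, ite_mul, zero_mul]
  by_cases hij : i = j
  · subst hij
    by_cases hi : i ∈ s <;> fin_cases a <;> fin_cases b <;> simp [hi]
  · by_cases hi : i ∈ s <;> simp [hij, hi, Finset.sum_add_distrib]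

theorem hypMat_mul_univ (s : Finset ι) :
    hypMat s * hypMat Finset.univ = -diagonal fun l : ι × Fin 2 => if l.1 ∈ s then 1 else 0 := by
  have := congrArg transpose (hypMat_univ_mul s)
  rwa [transpose_mul, hypMat_transpose, hypMat_transpose, neg_mul_neg, transpose_neg,
    diagonal_transpose] at this

theorem hypMat_univ_conj (s : Finset ι) :
    (hypMat (Finset.univ : Finset ι))ᵀ * hypMat s * hypMat Finset.univ = hypMat s := by
  rw [hypMat_transpose, mul_assoc, hypMat_mul_univ, neg_mul_neg]
  ext ⟨i, a⟩ ⟨j, b⟩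
  rw [Matrix.mul_diagonal]
  by_cases hij : i = j
  · subst hij
    simp [hypMat]
  · simp [hypMat, hyp, hij]

variable {θ v : ι × Fin 2 → Fin N → ℝ}

theorem planeSum_mul_planeSum_univ (h1 : Matrix.of θ * (Matrix.of v)ᵀ = 1)
    (h2 : (Matrix.of θ)ᵀ * Matrix.of v = 1) :
    (Matrix.of fun i j => planeSum Finset.univ θ ![i, j]) *
      (Matrix.of fun i j => planeSum Finset.univ v ![i, j]) = -1 := by
  have h3 : hypMat (Finset.univ : Finset ι) * hypMat Finset.univ = -1 := by
    rw [hypMat_univ_mul]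
    simp
  calc _ = (Matrix.of θ)ᵀ * (hypMat Finset.univ * (Matrix.of θ * (Matrix.of v)ᵀ) *
        hypMat Finset.univ) * Matrix.of v := by
        rw [planeSum_eq_mul, planeSum_eq_mul]
        simp only [Matrix.mul_assoc]
    _ = _ := by
        rw [h1, mul_one, h3, Matrix.mul_neg, Matrix.mul_one, Matrix.neg_mul, h2]

/-- Raising the indices of `∑_{i ∈ s} θ_{i,0} ∧ θ_{i,1}` gives `∑_{i ∈ s} v_{i,0} ∧ v_{i,1}`. -/
theorem planeSum_conj (h1 : Matrix.of θ * (Matrix.of v)ᵀ = 1) (s : Finset ι) :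
    (Matrix.of fun i j => planeSum Finset.univ v ![i, j])ᵀ *
      (Matrix.of fun i j => planeSum s θ ![i, j]) *
      (Matrix.of fun i j => planeSum Finset.univ v ![i, j]) =
        Matrix.of fun i j => planeSum s v ![i, j] := by
  have h1' : Matrix.of v * (Matrix.of θ)ᵀ = 1 := by
    simpa using congrArg transpose h1
  calc _ = (Matrix.of v)ᵀ * ((hypMat Finset.univ)ᵀ * (Matrix.of v * (Matrix.of θ)ᵀ) * hypMat s *
        (Matrix.of θ * (Matrix.of v)ᵀ) * hypMat Finset.univ) * Matrix.of v := by
        simp only [planeSum_eq_mul, transpose_mul, transpose_transpose, Matrix.mul_assoc]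
    _ = _ := by
        rw [h1, h1', mul_one, mul_one, hypMat_univ_conj, planeSum_eq_mul]

theorem rank_planeSum_le (h1 : Matrix.of θ * (Matrix.of v)ᵀ = 1) (s : Finset ι) :
    (Matrix.of fun i j => planeSum s v ![i, j]).rank ≤
      (Matrix.of fun i j => planeSum s θ ![i, j]).rank := by
  rw [← planeSum_conj h1 s]
  exact (rank_mul_le_left _ _).trans (rank_mul_le_right _ _)

theorem rank_planeSum (h1 : Matrix.of θ * (Matrix.of v)ᵀ = 1) (s : Finset ι) :
    (Matrix.of fun i j => planeSum s θ ![i, j]).rank =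
      (Matrix.of fun i j => planeSum s v ![i, j]).rank :=
  le_antisymm (rank_planeSum_le (by simpa using congrArg transpose h1) s) (rank_planeSum_le h1 s)

theorem planeSum_univ_mul_planeSum_apply (h1 : Matrix.of θ * (Matrix.of v)ᵀ = 1) (s : Finset ι)
    {l : ι × Fin 2} (hl : l.1 ∉ s) (b : Fin N) :
    ∑ a, planeSum s θ ![a, b] * ∑ i, planeSum Finset.univ v ![i, a] * θ l i = 0 := by
  have h1' : Matrix.of v * (Matrix.of θ)ᵀ = 1 := by
    simpa using congrArg transpose h1
  have h : Matrix.of θ * (Matrix.of fun i j => planeSum Finset.univ v ![i, j]) *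
      (Matrix.of fun i j => planeSum s θ ![i, j]) =
        -(diagonal (fun l : ι × Fin 2 => if l.1 ∈ s then (1 : ℝ) else 0) * Matrix.of θ) := by
    calc _ = (Matrix.of θ * (Matrix.of v)ᵀ) * (hypMat Finset.univ *
          (Matrix.of v * (Matrix.of θ)ᵀ) * hypMat s) * Matrix.of θ := by
          simp only [planeSum_eq_mul, Matrix.mul_assoc]
      _ = _ := by rw [h1, h1', mul_one, one_mul, hypMat_univ_mul, Matrix.neg_mul]
  have := congrFun (congrFun h l) b
  rw [Matrix.neg_apply, Matrix.diagonal_mul, if_neg hl, zero_mul, neg_zero, Matrix.mul_apply] at this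
  rw [← this]
  refine Finset.sum_congr rfl fun a _ => ?_
  rw [Matrix.mul_apply, mul_comm]
  exact congrArg (· * _) (Finset.sum_congr rfl fun i _ => mul_comm _ _)

theorem sharpF_two (Λ ζ : Form N 2) (x : Pt N) (I : Fin 2 → Fin N) :
    sharpF Λ 2 ζ x I = ((mat2 Λ x)ᵀ * mat2 ζ x * mat2 Λ x) (I 0) (I 1) := by
  rw [sharpF, mul_assoc, Matrix.mul_apply, ← (finTwoArrowEquiv (Fin N)).symm.sum_comp,
    Fintype.sum_prod_type]
  simp only [Matrix.mul_apply, Finset.mul_sum, mat2, Matrix.of_apply, Matrix.transpose_apply]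
  refine Finset.sum_congr rfl fun i _ => Finset.sum_congr rfl fun j _ => ?_
  simp [Fin.prod_univ_two, finTwoArrowEquiv]
  ring

theorem eq_planeSum_of_bival {P : (Fin 2 → Fin N) → ℝ} {s : Finset ι}
    (h1 : (Matrix.of v)ᵀ * Matrix.of θ = 1)
    (hP : ∀ l m, bival P (θ l) (θ m) = hypMat s l m) : P = planeSum s v := by
  have h1' : (Matrix.of θ)ᵀ * Matrix.of v = 1 := by
    simpa using congrArg transpose h1
  have hmat : Matrix.of θ * (Matrix.of fun i j => P ![i, j]) * (Matrix.of θ)ᵀ = hypMat s := by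
    ext l m
    rw [← hP, bival, Matrix.mul_apply, Finset.sum_comm]
    refine Finset.sum_congr rfl fun j _ => ?_
    rw [Matrix.mul_apply, Finset.sum_mul]
    exact Finset.sum_congr rfl fun i _ => by
      simp only [Matrix.of_apply, Matrix.transpose_apply]; ring
  have : (Matrix.of fun i j => P ![i, j]) = Matrix.of fun i j => planeSum s v ![i, j] := by
    rw [planeSum_eq_mul, ← hmat]
    calc _ = ((Matrix.of v)ᵀ * Matrix.of θ) * (Matrix.of fun i j => P ![i, j]) *
          ((Matrix.of θ)ᵀ * Matrix.of v) := by rw [h1, h1', one_mul, mul_one]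
      _ = _ := by simp only [Matrix.mul_assoc]
  funext I
  rw [eq_vec2 I]
  exact congrFun (congrFun this _) _

end PlaneSum

section ExteriorArrays

open ExteriorAlgebra

variable {N : ℕ}

/-- The exterior algebra of `ℝ^N`. -/
abbrev Ext (N : ℕ) := ExteriorAlgebra ℝ (Fin N → ℝ)

/-- The product of the basis vectors with indices `I`. -/
def extBasis {p : ℕ} (I : Fin p → Fin N) : Ext N :=
  ιMulti ℝ p fun t => (Pi.single (I t) 1 : Fin N → ℝ)

theorem extBasis_comp_perm {p : ℕ} (I : Fin p → Fin N) (σ : Equiv.Perm (Fin p)) :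
    extBasis (I ∘ σ) = ((Equiv.Perm.sign σ : ℤ) : ℝ) • extBasis I := by
  rw [extBasis, extBasis, Int.cast_smul_eq_zsmul]
  exact (ιMulti ℝ p).map_perm (fun t => (Pi.single (I t) 1 : Fin N → ℝ)) σ

theorem extBasis_append {p q : ℕ} (I : Fin p → Fin N) (J : Fin q → Fin N) :
    extBasis (Fin.append I J) = extBasis I * extBasis J := by
  rw [extBasis, extBasis, extBasis, ιMulti_mul_ιMulti]
  congr 1
  funext t
  refine Fin.addCases (fun i => ?_) (fun i => ?_) t <;> simp

/-- The element of the exterior algebra with a given array of components. -/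
def ofArr (p : ℕ) : ((Fin p → Fin N) → ℝ) →ₗ[ℝ] Ext N :=
  (p.factorial : ℝ)⁻¹ • ∑ I : Fin p → Fin N, (LinearMap.proj I).smulRight (extBasis I)

theorem ofArr_apply {p : ℕ} (α : (Fin p → Fin N) → ℝ) :
    ofArr p α = (p.factorial : ℝ)⁻¹ • ∑ I : Fin p → Fin N, α I • extBasis I := by
  simp [ofArr]

theorem ofArr_wedgeF {p q : ℕ} (ω : Form N p) (η : Form N q) (x : Pt N) :
    ofArr (p + q) (wedgeF p q ω η x) = ofArr p (ω x) * ofArr q (η x) := by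
  have hσ : ∀ σ : Equiv.Perm (Fin (p + q)), ∑ I : Fin (p + q) → Fin N,
      (((Equiv.Perm.sign σ : ℤ) : ℝ) * (ω x fun i => I (σ (Fin.castAdd q i))) *
        (η x fun j => I (σ (Fin.natAdd p j)))) • extBasis I =
      ∑ I : Fin p → Fin N, ∑ J : Fin q → Fin N, (ω x I * η x J) • (extBasis I * extBasis J) := by
    intro σ
    rw [← (σ.arrowCongr (Equiv.refl (Fin N))).sum_comp, ← (Fin.appendEquiv p q).sum_comp,
      Fintype.sum_prod_type]
    refine Finset.sum_congr rfl fun I _ => Finset.sum_congr rfl fun J _ => ?_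
    have : (σ.arrowCongr (Equiv.refl (Fin N))) (Fin.appendEquiv p q (I, J)) =
        Fin.append I J ∘ (σ⁻¹ : Equiv.Perm _) := rfl
    rw [this, extBasis_comp_perm, extBasis_append, smul_smul]
    congr 1
    simp only [Function.comp_apply, Equiv.Perm.coe_inv, Equiv.symm_apply_apply, Fin.append_left,
      Fin.append_right, Equiv.Perm.sign_inv]
    have : ((Equiv.Perm.sign σ : ℤ) : ℝ) * ((Equiv.Perm.sign σ : ℤ) : ℝ) = 1 := by
      rw [← Int.cast_mul, ← Units.val_mul, Int.units_mul_self]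
      simp
    linear_combination (ω x I * η x J) * this
  have hw : wedgeF p q ω η x = ((p.factorial : ℝ) * (q.factorial : ℝ))⁻¹ •
      ∑ σ : Equiv.Perm (Fin (p + q)), fun I => ((Equiv.Perm.sign σ : ℤ) : ℝ) *
        (ω x fun i => I (σ (Fin.castAdd q i))) * (η x fun j => I (σ (Fin.natAdd p j))) := by
    funext I
    simp [wedgeF]
  have hc : ((p + q).factorial : ℝ) ≠ 0 := by positivity
  rw [hw, map_smul, map_sum]
  simp only [ofArr_apply, hσ, smul_mul_smul_comm, Finset.sum_mul_sum, Finset.sum_const,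
    Finset.card_univ, Fintype.card_perm, Fintype.card_fin, ← Nat.cast_smul_eq_nsmul ℝ, smul_smul,
    mul_inv_cancel₀ hc, mul_inv, mul_one]

theorem ofArr_one (f : (Fin 0 → Fin N) → ℝ) : ofArr 0 f = algebraMap ℝ (Ext N) (f Fin.elim0) := by
  rw [ofArr_apply, Fintype.sum_unique, extBasis, ιMulti_zero_apply, Algebra.algebraMap_eq_smul_one]
  rw [Subsingleton.elim (default : Fin 0 → Fin N) Fin.elim0]
  simp

theorem ofArr_prod {p : ℕ} (a : Fin p → Fin N → ℝ) :
    ofArr p (fun I => ∏ t, a t (I t)) = (p.factorial : ℝ)⁻¹ • ιMulti ℝ p a := by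
  rw [ofArr_apply]
  congr 1
  have ha : a = fun t => ∑ i, a t i • (Pi.single i 1 : Fin N → ℝ) := by
    funext t j
    simp [Finset.sum_apply, Pi.single_apply]
  conv_rhs => rw [ha]
  rw [← AlternatingMap.coe_multilinearMap, MultilinearMap.map_sum]
  refine Finset.sum_congr rfl fun I _ => ?_
  rw [MultilinearMap.map_smul_univ]
  rfl

theorem ofArr_dF (h : Pt N → ℝ) (x : Pt N) : ofArr 1 (dF h x) = ι ℝ (grad h x) := by
  have : ofArr 1 (fun I => pd h (I 0) x) = ι ℝ (grad h x) := by
    simpa [ιMulti_apply, grad] using ofArr_prod fun _ : Fin 1 => grad h x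
  exact this

theorem ofArr_planeSum {κ : Type} (s : Finset κ) (θ : κ × Fin 2 → Fin N → ℝ) :
    ofArr 2 (planeSum s θ) = ∑ i ∈ s, ι ℝ (θ (i, 0)) * ι ℝ (θ (i, 1)) := by
  have h2 : ∀ a b : Fin N → ℝ, ofArr 2 (fun I => a (I 0) * b (I 1)) =
      (2 : ℝ)⁻¹ • (ι ℝ a * ι ℝ b) := fun a b => by
    simpa [Fin.prod_univ_two, ιMulti_apply] using ofArr_prod ![a, b]
  have hp : planeSum s θ = ∑ i ∈ s, ((fun I => θ (i, 0) (I 0) * θ (i, 1) (I 1)) -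
      fun I => θ (i, 1) (I 0) * θ (i, 0) (I 1)) := by
    funext I
    simp [planeSum]
  rw [hp, map_sum]
  refine Finset.sum_congr rfl fun i _ => ?_
  rw [map_sub, h2, h2, eq_neg_of_add_eq_zero_right (ι_add_mul_swap (θ (i, 0)) (θ (i, 1))), smul_neg,
    sub_neg_eq_add, ← add_smul]
  norm_num

theorem ofArr_wpow (ω : Form N 2) (m : ℕ) (x : Pt N) :
    ofArr (2 * m) (wpow ω m x) = ofArr 2 (ω x) ^ m := by
  induction m with
  | zero => rw [pow_zero]; exact (ofArr_one _).trans (map_one _)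
  | succ m ih => rw [pow_succ, ← ih]; exact ofArr_wedgeF _ _ x

theorem ofArr_wedgeList {m : ℕ} (f : Fin m → Pt N → ℝ) (x : Pt N) :
    ofArr m (wedgeList m (fun i => dF (f i)) x) = ιMulti ℝ m fun i => grad (f i) x := by
  induction m with
  | zero => exact (ofArr_one _).trans ((map_one _).trans (ιMulti_zero_apply _).symm)
  | succ m ih =>
    rw [wedgeList, ofArr_wedgeF, ih, ofArr_dF, ιMulti_apply, ιMulti_apply, List.ofFn_succ',
      List.concat_eq_append, List.prod_append, List.prod_singleton]

theorem ofArr_castF {p q : ℕ} (h : p = q) (ω : Form N p) (x : Pt N) :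
    ofArr q (castF h ω x) = ofArr p (ω x) := by
  subst h
  rfl

/-- The determinants `det (φ_s(w_t))` as a linear functional on the exterior algebra. -/
def detFunctional {p : ℕ} (φ : Fin p → (Fin N → ℝ) →ₗ[ℝ] ℝ) : Ext N →ₗ[ℝ] ℝ :=
  liftAlternating (Pi.single p (Matrix.detRowAlternating.compLinearMap (LinearMap.pi φ)))

theorem detFunctional_ιMulti {p : ℕ} (φ : Fin p → (Fin N → ℝ) →ₗ[ℝ] ℝ) (w : Fin p → Fin N → ℝ) :
    detFunctional φ (ιMulti ℝ p w) = (Matrix.of fun t s => φ s (w t)).det := by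
  rw [detFunctional, liftAlternating_apply_ιMulti, Pi.single_eq_same]
  rfl

theorem detFunctional_of_ne {p q : ℕ} (φ : Fin p → (Fin N → ℝ) →ₗ[ℝ] ℝ) (w : Fin q → Fin N → ℝ)
    (h : q ≠ p) : detFunctional φ (ιMulti ℝ q w) = 0 := by
  rw [detFunctional, liftAlternating_apply_ιMulti, Pi.single_eq_of_ne h]
  rfl

/-- Alternating arrays are the component arrays of elements of the exterior algebra. -/
theorem AltArr.eq_detFunctional {p : ℕ} {α : (Fin p → Fin N) → ℝ} (hα : AltArr α)
    (J : Fin p → Fin N) : α J = detFunctional (fun s => LinearMap.proj (J s)) (ofArr p α) := by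
  have hdet : ∀ I : Fin p → Fin N, detFunctional (fun s => LinearMap.proj (J s)) (extBasis I) =
      ∑ σ : Equiv.Perm (Fin p), ((Equiv.Perm.sign σ : ℤ) : ℝ) * if I = J ∘ σ then 1 else 0 := by
    intro I
    rw [extBasis, detFunctional_ιMulti, ← Matrix.det_transpose, Matrix.det_apply']
    refine Finset.sum_congr rfl fun σ _ => ?_
    congr 1
    simp [Pi.single_apply, Finset.prod_ite_zero, funext_iff, eq_comm]
  have hc : (p.factorial : ℝ) ≠ 0 := by positivity
  simp only [ofArr_apply, map_smul, map_sum, smul_eq_mul, hdet]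
  simp only [Finset.mul_sum]
  rw [Finset.sum_comm]
  have : ∀ σ : Equiv.Perm (Fin p), ∑ I, (p.factorial : ℝ)⁻¹ * (α I *
      (((Equiv.Perm.sign σ : ℤ) : ℝ) * if I = J ∘ σ then 1 else 0)) = (p.factorial : ℝ)⁻¹ * α J := by
    intro σ
    have hs : ((Equiv.Perm.sign σ : ℤ) : ℝ) * ((Equiv.Perm.sign σ : ℤ) : ℝ) = 1 := by
      rw [← Int.cast_mul, ← Units.val_mul, Int.units_mul_self]
      simp
    simp only [mul_ite, mul_one, mul_zero, Finset.sum_ite_eq', Finset.mem_univ, if_true, hα.1]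
    linear_combination (p.factorial : ℝ)⁻¹ * α J * hs
  simp only [this, Finset.sum_const, Finset.card_univ, Fintype.card_perm, Fintype.card_fin,
    nsmul_eq_mul]
  field_simp

theorem AltArr.ext_ofArr {p : ℕ} {α β : (Fin p → Fin N) → ℝ} (hα : AltArr α) (hβ : AltArr β)
    (h : ofArr p α = ofArr p β) : α = β :=
  funext fun J => by rw [hα.eq_detFunctional, hβ.eq_detFunctional, h]

theorem altArr_wedgeF {p q : ℕ} (ω : Form N p) (η : Form N q) (x : Pt N) :
    AltArr (wedgeF p q ω η x) := by
  refine altArr_of_perm fun I τ => ?_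
  rw [wedgeF, wedgeF, mul_left_comm]
  congr 1
  rw [Finset.mul_sum]
  rw [← Equiv.sum_comp (Equiv.mulLeft τ) (fun σ => ((Equiv.Perm.sign τ : ℤ) : ℝ) *
    (((Equiv.Perm.sign σ : ℤ) : ℝ) * (ω x fun i => I (σ (Fin.castAdd q i))) *
      (η x fun j => I (σ (Fin.natAdd p j)))))]
  refine Finset.sum_congr rfl fun σ _ => ?_
  have hs : ((Equiv.Perm.sign τ : ℤ) : ℝ) * ((Equiv.Perm.sign τ : ℤ) : ℝ) = 1 := by
    rw [← Int.cast_mul, ← Units.val_mul, Int.units_mul_self]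
    simp
  simp only [Equiv.coe_mulLeft, Equiv.Perm.sign_mul, Units.val_mul, Int.cast_mul,
    Equiv.Perm.mul_apply, Function.comp_apply]
  linear_combination -(((Equiv.Perm.sign σ : ℤ) : ℝ) * (ω x fun i => I (τ (σ (Fin.castAdd q i)))) *
      (η x fun j => I (τ (σ (Fin.natAdd p j))))) * hs

theorem altArr_zero_degree (f : (Fin 0 → Fin N) → ℝ) : AltArr f :=
  altArr_of_perm fun I σ => by
    rw [Subsingleton.elim (I ∘ σ) I, Subsingleton.elim σ 1]
    simp

theorem altArr_wpow (ω : Form N 2) (m : ℕ) (x : Pt N) : AltArr (wpow ω m x) := by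
  cases m with
  | zero => exact altArr_zero_degree _
  | succ m => exact altArr_wedgeF _ _ x

theorem altArr_wedgeList {m : ℕ} (φ : Fin m → Form N 1) (x : Pt N) :
    AltArr (wedgeList m φ x) := by
  cases m with
  | zero => exact altArr_zero_degree _
  | succ m => exact altArr_wedgeF _ _ x

theorem AltArr.smul {p : ℕ} {α : (Fin p → Fin N) → ℝ} (hα : AltArr α) (c : ℝ) :
    AltArr fun I => c * α I :=
  altArr_of_perm fun I σ => by rw [hα.1]; ring

theorem altArr_castF {p q : ℕ} (h : p = q) {ω : Form N p} {x : Pt N} (hω : AltArr (ω x)) :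
    AltArr (castF h ω x) := by
  subst h
  exact hω

end ExteriorArrays

section SquareZero

variable {R κ : Type*} [CommRing R]

theorem add_pow_of_sq_zero {x : R} (hx : x * x = 0) (y : R) (m : ℕ) :
    (x + y) ^ (m + 1) = y ^ (m + 1) + (m + 1) * (x * y ^ m) := by
  induction m with
  | zero => simp; ring
  | succ m ih =>
    rw [pow_succ, ih]
    push_cast
    linear_combination ((m : R) + 1) * y ^ m * hx

/-- Powers of a sum of square-zero elements are multiples of elementary symmetric functions. -/
theorem sum_pow_of_sq_zero [DecidableEq κ] {a : κ → R} (ha : ∀ i, a i * a i = 0) (s : Finset κ)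
    (m : ℕ) : (∑ i ∈ s, a i) ^ m = m.factorial * ∑ t ∈ s.powersetCard m, ∏ i ∈ t, a i := by
  induction s using Finset.induction_on generalizing m with
  | empty =>
    cases m with
    | zero => simp
    | succ m => simp [Finset.powersetCard_eq_empty.2 (show (∅ : Finset κ).card < m + 1 by simp)]
  | insert i s hi ih =>
    cases m with
    | zero => simp
    | succ m =>
      have hd : Disjoint (s.powersetCard (m + 1)) ((s.powersetCard m).image (insert i)) := by
        rw [Finset.disjoint_left]
        intro t ht ht'
        obtain ⟨u, -, rfl⟩ := Finset.mem_image.1 ht'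
        exact hi ((Finset.mem_powersetCard.1 ht).1 (Finset.mem_insert_self i u))
      have hmem : ∀ t ∈ s.powersetCard m, i ∉ t := fun t ht h =>
        hi ((Finset.mem_powersetCard.1 ht).1 h)
      rw [Finset.sum_insert hi, add_pow_of_sq_zero (ha i), ih, ih, Finset.powersetCard_succ_insert hi,
        Finset.sum_union hd, Finset.sum_image (fun t ht u hu h => by
          rw [← Finset.erase_insert (hmem t ht), h, Finset.erase_insert (hmem u hu)]),
        Finset.sum_congr rfl fun t ht => Finset.prod_insert (hmem t ht), ← Finset.mul_sum,
        Nat.factorial_succ]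
      push_cast
      ring

theorem sum_pow_card_of_sq_zero [DecidableEq κ] {a : κ → R} (ha : ∀ i, a i * a i = 0)
    (s : Finset κ) : (∑ i ∈ s, a i) ^ s.card = s.card.factorial * ∏ i ∈ s, a i := by
  rw [sum_pow_of_sq_zero ha, Finset.powersetCard_self, Finset.sum_singleton]

theorem sum_pow_pred_card_of_sq_zero [DecidableEq κ] {a : κ → R} (ha : ∀ i, a i * a i = 0)
    {s : Finset κ} {m : ℕ} (hm : s.card = m + 1) :
    (∑ i ∈ s, a i) ^ m = m.factorial * ∑ i ∈ s, ∏ j ∈ s.erase i, a j := by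
  rw [sum_pow_of_sq_zero ha]
  congr 1
  symm
  refine Finset.sum_bij (fun i _ => s.erase i) (fun i hi => ?_) (fun i hi j hj h => ?_)
    (fun t ht => ?_) fun i hi => rfl
  · rw [Finset.mem_powersetCard, Finset.card_erase_of_mem hi, hm]
    exact ⟨Finset.erase_subset _ _, rfl⟩
  · exact Finset.erase_injOn s hi hj h
  · obtain ⟨hts, htc⟩ := Finset.mem_powersetCard.1 ht
    obtain ⟨i, hi⟩ : ∃ i, s \ t = {i} := by
      rw [← Finset.card_eq_one, Finset.card_sdiff_of_subset hts]
      omega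
    have his : i ∈ s \ t := hi ▸ Finset.mem_singleton_self i
    refine ⟨i, (Finset.mem_sdiff.1 his).1, ?_⟩
    rw [Finset.erase_eq, ← hi, Finset.sdiff_sdiff_eq_self hts]

theorem mul_prod_of_sq_zero [DecidableEq κ] {a : κ → R} (ha : ∀ i, a i * a i = 0) {s : Finset κ}
    {i : κ} (hi : i ∈ s) : a i * ∏ j ∈ s, a j = 0 := by
  rw [← Finset.mul_prod_erase s a hi, ← mul_assoc, ha, zero_mul]

end SquareZero

section Bivectors

open ExteriorAlgebra

variable {N : ℕ}

theorem ι_mul_ι_mem_center (u w : Fin N → ℝ) :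
    ι ℝ u * ι ℝ w ∈ Subalgebra.center ℝ (Ext N) := by
  rw [Subalgebra.mem_center_iff]
  intro b
  induction b using ExteriorAlgebra.induction with
  | algebraMap r => exact Algebra.commutes r _
  | ι y =>
    have h1 : ι ℝ y * ι ℝ u = -(ι ℝ u * ι ℝ y) := eq_neg_of_add_eq_zero_left (ι_add_mul_swap y u)
    have h2 : ι ℝ y * ι ℝ w = -(ι ℝ w * ι ℝ y) := eq_neg_of_add_eq_zero_left (ι_add_mul_swap y w)
    rw [← mul_assoc, h1, neg_mul, mul_assoc, h2, mul_neg, neg_neg, mul_assoc]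
  | mul a b ha hb => rw [mul_assoc, hb, ← mul_assoc, ha, mul_assoc]
  | add a b ha hb => rw [add_mul, ha, hb, mul_add]

/-- The bivector `u ∧ w`, as an element of the center of the exterior algebra. -/
def bivec (u w : Fin N → ℝ) : Subalgebra.center ℝ (Ext N) := ⟨_, ι_mul_ι_mem_center u w⟩

theorem coe_bivec (u w : Fin N → ℝ) : (bivec u w : Ext N) = ι ℝ u * ι ℝ w := rfl

theorem ι_mul_bivec_left (u w : Fin N → ℝ) : ι ℝ u * (bivec u w : Ext N) = 0 := by
  rw [coe_bivec, ← mul_assoc, ι_sq_zero, zero_mul]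

theorem ι_mul_bivec_right (u w : Fin N → ℝ) : ι ℝ w * (bivec u w : Ext N) = 0 := by
  rw [Subalgebra.mem_center_iff.1 (bivec u w).2, coe_bivec, mul_assoc, ι_sq_zero, mul_zero]

theorem bivec_mul_self (u w : Fin N → ℝ) : bivec u w * bivec u w = 0 :=
  Subtype.ext <| by
    rw [Subalgebra.coe_mul, coe_bivec, mul_assoc, ← coe_bivec, ι_mul_bivec_right, mul_zero]
    rfl

variable {κ : Type}

/-- The product of the bivectors attached to the planes in `s`. -/
def planeProd (s : Finset κ) (θ : κ × Fin 2 → Fin N → ℝ) : Subalgebra.center ℝ (Ext N) :=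
  ∏ i ∈ s, bivec (θ (i, 0)) (θ (i, 1))

/-- The sum of the bivectors attached to the planes in `s`. -/
def planeAdd (s : Finset κ) (θ : κ × Fin 2 → Fin N → ℝ) : Subalgebra.center ℝ (Ext N) :=
  ∑ i ∈ s, bivec (θ (i, 0)) (θ (i, 1))

theorem ofArr_planeSum_eq_coe (s : Finset κ) (θ : κ × Fin 2 → Fin N → ℝ) :
    ofArr 2 (planeSum s θ) = (planeAdd s θ : Ext N) := by
  rw [ofArr_planeSum, planeAdd, AddSubmonoidClass.coe_finsetSum]
  rfl

theorem planeAdd_pow_card [DecidableEq κ] (s : Finset κ) (θ : κ × Fin 2 → Fin N → ℝ) {m : ℕ} (hm : s.card = m) :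
    (m.factorial : ℝ)⁻¹ • planeAdd s θ ^ m = planeProd s θ := by
  have hc : (m.factorial : ℝ) ≠ 0 := by positivity
  rw [planeAdd, ← hm, sum_pow_card_of_sq_zero (fun i => bivec_mul_self _ _), hm, ← nsmul_eq_mul,
    ← Nat.cast_smul_eq_nsmul ℝ, smul_smul, inv_mul_cancel₀ hc, one_smul, planeProd]

theorem planeAdd_mul_planeProd [DecidableEq κ] (s : Finset κ) (θ : κ × Fin 2 → Fin N → ℝ) :
    planeAdd s θ * planeProd s θ = 0 := by
  rw [planeAdd, planeProd, Finset.sum_mul]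
  exact Finset.sum_eq_zero fun i hi => mul_prod_of_sq_zero (fun i => bivec_mul_self _ _) hi

variable [Fintype κ] [DecidableEq κ]

theorem planeAdd_add_compl (s : Finset κ) (θ : κ × Fin 2 → Fin N → ℝ) :
    planeAdd s θ + planeAdd sᶜ θ = planeAdd Finset.univ θ :=
  Finset.sum_add_sum_compl s _

/-- The `(2n-2)`-vector of the normal form, in terms of the planes. -/
theorem core_eq_neg_sum_planeProd {s : Finset κ} (θ : κ × Fin 2 → Fin N → ℝ) {k : ℕ} (hk : 2 ≤ k)
    (hs : s.card = k) :
    (planeAdd s θ + (-(k : ℝ) / ((k : ℝ) - 1)) • planeAdd Finset.univ θ) *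
        (((k - 2).factorial : ℝ)⁻¹ • planeAdd Finset.univ θ ^ (k - 2)) * planeProd sᶜ θ =
      -∑ i ∈ s, planeProd (Finset.univ.erase i) θ := by
  obtain ⟨m, rfl⟩ : ∃ m, k = m + 2 := ⟨k - 2, by omega⟩
  set F := planeProd sᶜ θ
  set S := planeAdd s θ
  have hTF : planeAdd sᶜ θ * F = 0 := planeAdd_mul_planeProd _ _
  have hF : planeAdd Finset.univ θ * F = S * F := by
    rw [← planeAdd_add_compl s, add_mul, hTF, add_zero]
  have hFm : ∀ m : ℕ, planeAdd Finset.univ θ ^ m * F = S ^ m * F := by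
    intro m
    induction m with
    | zero => simp
    | succ m ih =>
      rw [pow_succ, mul_assoc, hF, mul_left_comm, ih]
      ring
  have hP : S ^ (m + 1) * F =
      ((m + 1).factorial : ℝ) • ∑ i ∈ s, planeProd (Finset.univ.erase i) θ := by
    rw [Nat.cast_smul_eq_nsmul, nsmul_eq_mul]
    simp only [S, planeAdd]
    rw [sum_pow_pred_card_of_sq_zero (fun i => bivec_mul_self _ _) hs, mul_assoc,
      Finset.sum_mul]
    congr 1
    refine Finset.sum_congr rfl fun i hi => ?_
    have hd : Disjoint (s.erase i) sᶜ := disjoint_compl_right.mono_left (Finset.erase_subset _ _)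
    simp only [F, planeProd]
    rw [← Finset.prod_union hd]
    congr 1
    ext j
    simp only [Finset.mem_union, Finset.mem_erase, Finset.mem_compl, Finset.mem_univ, and_true]
    by_cases hj : j = i
    · simp [hj, hi]
    · simp [hj, em]
  have h1 : ((m + 1 : ℕ) : ℝ) ≠ 0 := by positivity
  have h2 : (m.factorial : ℝ) ≠ 0 := by positivity
  rw [Nat.add_sub_cancel, mul_assoc, smul_mul_assoc, hFm, add_mul, smul_mul_assoc, mul_smul_comm,
    mul_smul_comm, mul_left_comm (planeAdd Finset.univ θ), hF, mul_left_comm (S ^ m),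
    ← mul_assoc S, ← pow_succ', hP, smul_smul, smul_smul, ← add_smul, Nat.factorial_succ,
    ← neg_one_smul ℝ (∑ i ∈ s, planeProd (Finset.univ.erase i) θ)]
  congr 1
  push_cast at h1 ⊢
  have h3 : (m : ℝ) + 2 - 1 ≠ 0 := by convert h1 using 1; ring
  field_simp
  ring

end Bivectors

section Contraction

open ExteriorAlgebra

variable {N : ℕ}

/-- Contraction of the first slot of an array with a basis vector. -/
def slot {p : ℕ} (i : Fin N) (α : (Fin (p + 1) → Fin N) → ℝ) : (Fin p → Fin N) → ℝ :=
  fun J => α (Fin.cons i J)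

theorem AltArr.slot {p : ℕ} {α : (Fin (p + 1) → Fin N) → ℝ} (hα : AltArr α) (i : Fin N) :
    AltArr (slot i α) := by
  refine altArr_of_perm fun J σ => ?_
  have : (Fin.cons i (J ∘ σ) : Fin (p + 1) → Fin N) =
      (Fin.cons i J : Fin (p + 1) → Fin N) ∘ Equiv.Perm.decomposeFin.symm (0, σ) := by
    funext t
    refine Fin.cases ?_ (fun t => ?_) t <;> simp
  rw [Damianou.slot, this, hα.1, Equiv.Perm.decomposeFin.symm_sign]
  simp [Damianou.slot]

theorem AltArr.slot_slot {p : ℕ} {α : (Fin (p + 2) → Fin N) → ℝ} (hα : AltArr α) (i j : Fin N) :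
    Damianou.slot j (Damianou.slot i α) = -Damianou.slot i (Damianou.slot j α) := by
  funext J
  have : (Fin.cons i (Fin.cons j J : Fin (p + 1) → Fin N) : Fin (p + 2) → Fin N) =
      (Fin.cons j (Fin.cons i J : Fin (p + 1) → Fin N) : Fin (p + 2) → Fin N) ∘
        Equiv.swap 0 1 := by
    funext t
    refine Fin.cases ?_ (fun t => ?_) t
    · rw [Function.comp_apply, Equiv.swap_apply_left, ← Fin.succ_zero_eq_one, Fin.cons_succ]
      simp
    · refine Fin.cases ?_ (fun t => ?_) t
      · simp
      · rw [Function.comp_apply, Equiv.swap_apply_of_ne_of_ne (Fin.succ_ne_zero _)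
          (by rw [← Fin.succ_zero_eq_one, Ne, Fin.succ_inj]; exact Fin.succ_ne_zero _)]
        simp
  simp only [Damianou.slot, Pi.neg_apply]
  rw [this, hα.1, Equiv.Perm.sign_swap (by simp)]
  simp

theorem ofArr_succ {p : ℕ} (α : (Fin (p + 1) → Fin N) → ℝ) :
    ofArr (p + 1) α = ((p + 1 : ℕ) : ℝ)⁻¹ •
      ∑ i, ι ℝ (Pi.single i 1 : Fin N → ℝ) * ofArr p (slot i α) := by
  have : ∀ (i : Fin N) (J : Fin p → Fin N), extBasis (Fin.cons i J : Fin (p + 1) → Fin N) =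
      ι ℝ (Pi.single i 1 : Fin N → ℝ) * extBasis J := fun i J => by
    rw [extBasis, extBasis, ιMulti_succ_apply]
    rfl
  rw [ofArr_apply, ← (Fin.consEquiv fun _ => Fin N).sum_comp, Fintype.sum_prod_type,
    Nat.factorial_succ, Nat.cast_mul, mul_inv, mul_smul, Finset.smul_sum]
  congr 1
  refine Finset.sum_congr rfl fun i _ => ?_
  rw [ofArr_apply, mul_smul_comm, Finset.mul_sum]
  congr 1
  refine Finset.sum_congr rfl fun J _ => ?_
  rw [mul_smul_comm, ← this]
  rfl

/-- Contraction with a vector. -/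
def contr (w : Fin N → ℝ) : Ext N →ₗ[ℝ] Ext N :=
  CliffordAlgebra.contractLeft (∑ i, w i • LinearMap.proj i : Module.Dual ℝ (Fin N → ℝ))

theorem contr_ι_mul (w a : Fin N → ℝ) (b : Ext N) :
    contr w (ι ℝ a * b) = (∑ i, a i * w i) • b - ι ℝ a * contr w b := by
  rw [contr]
  refine (CliffordAlgebra.contractLeft_ι_mul _ a b).trans ?_
  congr 2
  simp [mul_comm]

theorem contr_algebraMap (w : Fin N → ℝ) (r : ℝ) : contr w (algebraMap ℝ _ r) = 0 :=
  CliffordAlgebra.contractLeft_algebraMap _ _ r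

theorem contr_one (w : Fin N → ℝ) : contr w 1 = 0 :=
  CliffordAlgebra.contractLeft_one _ _

theorem contr_comm (w w' : Fin N → ℝ) (b : Ext N) : contr w (contr w' b) = -contr w' (contr w b) :=
  CliffordAlgebra.contractLeft_comm _ _ b

theorem contr_eq_sum (w : Fin N → ℝ) (b : Ext N) :
    contr w b = ∑ i, w i • contr (Pi.single i 1) b := by
  simp [contr, LinearMap.sum_apply, Pi.single_apply]

theorem AltArr.contr_ofArr {p : ℕ} {α : (Fin (p + 1) → Fin N) → ℝ} (hα : AltArr α) (j : Fin N) :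
    contr (Pi.single j 1) (ofArr (p + 1) α) = ofArr p (Damianou.slot j α) := by
  have key : ∀ {p : ℕ} (α : (Fin (p + 1) → Fin N) → ℝ),
      contr (Pi.single j 1) (ofArr (p + 1) α) = ((p + 1 : ℕ) : ℝ)⁻¹ •
        (ofArr p (Damianou.slot j α) - ∑ i, ι ℝ (Pi.single i 1 : Fin N → ℝ) *
          contr (Pi.single j 1) (ofArr p (Damianou.slot i α))) := by
    intro p α
    rw [ofArr_succ, map_smul, map_sum]
    simp only [contr_ι_mul, Finset.sum_sub_distrib]
    congr 2
    simp [Pi.single_apply]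
  induction p with
  | zero =>
    rw [key]
    simp [ofArr_one, contr_algebraMap]
  | succ p ih =>
    rw [key]
    simp only [ih (hα.slot _), hα.slot_slot _ j, map_neg, mul_neg, Finset.sum_neg_distrib,
      sub_neg_eq_add]
    have h := ofArr_succ (Damianou.slot j α)
    have hc : ((p + 1 : ℕ) : ℝ) ≠ 0 := by positivity
    rw [eq_inv_smul_iff₀ hc] at h
    have h1 := add_smul 1 ((p + 1 : ℕ) : ℝ) (ofArr (p + 1) (Damianou.slot j α))
    rw [one_smul] at h1
    rw [← h, ← h1, smul_smul]
    have : (((p + 1 + 1 : ℕ) : ℝ)⁻¹ * (1 + ((p + 1 : ℕ) : ℝ))) = 1 := by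
      push_cast
      field_simp
      ring
    rw [this, one_smul]

end Contraction

section PlaneContraction

open ExteriorAlgebra

variable {N : ℕ} {κ : Type}

/-- Contraction of an alternating array with a sum of planes. -/
theorem ofArr_contract_planeSum {p : ℕ} {α : (Fin (p + 2) → Fin N) → ℝ} (hα : AltArr α)
    (s : Finset κ) (u : κ × Fin 2 → Fin N → ℝ) :
    ofArr p (∑ a, ∑ b, ((2 : ℝ)⁻¹ * planeSum s u ![a, b]) • slot b (slot a α)) =
      ∑ i ∈ s, contr (u (i, 1)) (contr (u (i, 0)) (ofArr (p + 2) α)) := by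
  have hterm : ∀ w w' : Fin N → ℝ, ∑ a, ∑ b, (w a * w' b) • ofArr p (slot b (slot a α)) =
      contr w' (contr w (ofArr (p + 2) α)) := by
    intro w w'
    rw [contr_eq_sum w, map_sum]
    refine Finset.sum_congr rfl fun a _ => ?_
    rw [map_smul, contr_eq_sum w', Finset.smul_sum]
    refine Finset.sum_congr rfl fun b _ => ?_
    rw [smul_smul, hα.contr_ofArr, (hα.slot a).contr_ofArr]
  have hs : ∀ a b, ((2 : ℝ)⁻¹ * planeSum s u ![a, b]) • ofArr p (slot b (slot a α)) =
      (2 : ℝ)⁻¹ • (∑ i ∈ s, (u (i, 0) a * u (i, 1) b) • ofArr p (slot b (slot a α)) -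
        ∑ i ∈ s, (u (i, 1) a * u (i, 0) b) • ofArr p (slot b (slot a α))) := by
    intro a b
    simp [planeSum, mul_smul, Finset.sum_smul, sub_smul]
  simp only [map_sum, map_smul, hs]
  simp only [Finset.sum_comm (s := Finset.univ) (t := s), ← Finset.smul_sum,
    Finset.sum_sub_distrib, hterm]
  rw [← Finset.sum_sub_distrib, Finset.smul_sum]
  refine Finset.sum_congr rfl fun i _ => ?_
  rw [contr_comm (u (i, 0)), sub_neg_eq_add, ← two_smul ℝ, smul_smul, inv_mul_cancel₀ two_ne_zero,
    one_smul]

variable [DecidableEq κ] {θ v : κ × Fin 2 → Fin N → ℝ}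

theorem sum_mul_eq_ite (h1 : Matrix.of θ * (Matrix.of v).transpose = 1) (l m : κ × Fin 2) :
    ∑ i, θ l i * v m i = if l = m then 1 else 0 := by
  have := congrFun (congrFun h1 l) m
  rwa [Matrix.mul_apply, Matrix.one_apply] at this

theorem contr_planeProd {w : Fin N → ℝ} {t : Finset κ}
    (hw : ∀ j ∈ t, ∀ a, ∑ i, θ (j, a) i * w i = 0) : contr w (planeProd t θ : Ext N) = 0 := by
  induction t using Finset.induction_on with
  | empty => exact contr_one w
  | insert j t hj ih =>
    rw [planeProd, Finset.prod_insert hj, Subalgebra.coe_mul, coe_bivec, mul_assoc, contr_ι_mul,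
      contr_ι_mul, hw j (Finset.mem_insert_self j t), hw j (Finset.mem_insert_self j t)]
    have := ih fun i hi => hw i (Finset.mem_insert_of_mem hi)
    rw [planeProd] at this
    simp [this]

theorem contr_contr_planeProd [Fintype κ] (h1 : Matrix.of θ * (Matrix.of v).transpose = 1) (s : κ) :
    contr (v (s, 1)) (contr (v (s, 0)) (planeProd Finset.univ θ : Ext N)) =
      (planeProd (Finset.univ.erase s) θ : Ext N) := by
  have h0 : ∀ b, contr (v (s, b)) (planeProd (Finset.univ.erase s) θ : Ext N) = 0 := fun b =>
    contr_planeProd fun j hj a => by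
      rw [sum_mul_eq_ite h1, if_neg]
      rintro ⟨⟩
      exact Finset.ne_of_mem_erase hj rfl
  have hu : (planeProd Finset.univ θ : Ext N) = ι ℝ (θ (s, 0)) * (ι ℝ (θ (s, 1)) *
      (planeProd (Finset.univ.erase s) θ : Ext N)) := by
    rw [← mul_assoc, ← coe_bivec, ← Subalgebra.coe_mul, planeProd, planeProd,
      Finset.mul_prod_erase Finset.univ (fun i => bivec (θ (i, 0)) (θ (i, 1)))
        (Finset.mem_univ s)]
  simp [hu, contr_ι_mul, h0, sum_mul_eq_ite h1]

theorem AltArr.sum {ι' : Type*} {p : ℕ} {s : Finset ι'} {α : ι' → (Fin p → Fin N) → ℝ}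
    (hα : ∀ i ∈ s, AltArr (α i)) : AltArr (∑ i ∈ s, α i) :=
  altArr_of_perm fun I σ => by
    rw [Finset.sum_apply, Finset.sum_apply, Finset.mul_sum]
    exact Finset.sum_congr rfl fun i hi => (hα i hi).1 I σ

theorem altArr_volF (m : ℕ) (ω : Form N 2) (x : Pt N) : AltArr (volF m ω x) :=
  (altArr_wpow ω m x).smul _

theorem ofArr_volF {m : ℕ} (ω : Form N 2) (x : Pt N) :
    ofArr (2 * m) (volF m ω x) = (m.factorial : ℝ)⁻¹ • ofArr 2 (ω x) ^ m := by
  rw [← ofArr_wpow, ← map_smul]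
  rfl

theorem ofArr_volF_planeSum {m : ℕ} {ω : Form N 2} {x : Pt N} {s : Finset κ} (hs : s.card = m)
    (hω : ω x = planeSum s θ) : ofArr (2 * m) (volF m ω x) = (planeProd s θ : Ext N) := by
  rw [ofArr_volF, hω, ofArr_planeSum_eq_coe, ← planeAdd_pow_card s θ hs]
  rfl

theorem PsiBiv_eq_sum {m : ℕ} (ω Λ : Form (2 * (m + 1)) 2) (x : Pt (2 * (m + 1))) :
    PsiBiv ω Λ x = ∑ a, ∑ b, ((2 : ℝ)⁻¹ * Λ x ![a, b]) •
      slot (p := 2 * m) b (slot (p := 2 * m + 1) a (volF (m + 1) ω x)) := by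
  funext J
  have hcat : ∀ a b : Fin (2 * (m + 1)), catIdx (b := 2 * (m + 1)) ![a, b] J =
      (Fin.cons a (Fin.cons b J : Fin (2 * m + 1) → _) : Fin (2 * m + 2) → _) := by
    intro a b
    funext t
    refine Fin.cases rfl (fun t => Fin.cases rfl (fun t => ?_) t) t
    simp [catIdx]
  have hI : ∀ F : (Fin 2 → Fin (2 * (m + 1))) → ℝ, ∑ I, F I = ∑ a, ∑ b, F ![a, b] := by
    intro F
    rw [← (finTwoArrowEquiv _).symm.sum_comp, Fintype.sum_prod_type]
    rfl
  simp only [PsiBiv, smulF, iF, hI, hcat, Finset.sum_apply, Pi.smul_apply, smul_eq_mul, slot,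
    Finset.mul_sum]
  refine Finset.sum_congr rfl fun a _ => Finset.sum_congr rfl fun b _ => ?_
  norm_num
  ring

theorem altArr_PsiBiv {m : ℕ} (ω Λ : Form (2 * (m + 1)) 2) (x : Pt (2 * (m + 1))) :
    AltArr (p := 2 * m) (PsiBiv ω Λ x) := by
  rw [PsiBiv_eq_sum]
  exact AltArr.sum fun a _ => AltArr.sum fun b _ =>
    (AltArr.slot (AltArr.slot (p := 2 * m + 1) (altArr_volF (m + 1) ω x) a) b).smul _

theorem ofArr_PsiBiv {m : ℕ} {ω Λ : Form (2 * (m + 1)) 2} {x : Pt (2 * (m + 1))}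
    {θ v : Fin (m + 1) × Fin 2 → Fin (2 * (m + 1)) → ℝ} {s : Finset (Fin (m + 1))}
    (h1 : Matrix.of θ * (Matrix.of v).transpose = 1) (hω : ω x = planeSum Finset.univ θ)
    (hΛ : Λ x = planeSum s v) : ofArr (2 * m) (PsiBiv ω Λ x) =
      ∑ i ∈ s, (planeProd (Finset.univ.erase i) θ : Ext (2 * (m + 1))) := by
  rw [PsiBiv_eq_sum, hΛ, ofArr_contract_planeSum (p := 2 * m) (altArr_volF (m + 1) ω x)]
  refine Finset.sum_congr rfl fun i _ => ?_
  rw [← contr_contr_planeProd h1, ← ofArr_volF_planeSum (Finset.card_fin (m + 1)) hω]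
  rfl

end PlaneContraction

section NormalForm

open ExteriorAlgebra

variable {N : ℕ}

theorem detFunctional_ι_mul {p : ℕ} {φ : Fin p → (Fin N → ℝ) →ₗ[ℝ] ℝ} {w : Fin N → ℝ}
    (hw : ∀ s, φ s w = 0) (y : Ext N) : detFunctional φ (ι ℝ w * y) = 0 := by
  have hy : y ∈ Submodule.span ℝ (Set.range fun x : Σ n, (Fin n → Fin N → ℝ) =>
      ιMulti ℝ x.1 x.2) := by
    rw [ιMulti_span]
    trivial
  induction hy using Submodule.span_induction with
  | mem y hy =>
    obtain ⟨⟨q, a⟩, rfl⟩ := hy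
    have : ι ℝ w * ιMulti ℝ q a = ιMulti ℝ (q + 1) (Fin.cons w a : Fin (q + 1) → Fin N → ℝ) := by
      rw [ιMulti_succ_apply]
      rfl
    simp only [this]
    by_cases h : q + 1 = p
    · subst h
      rw [detFunctional_ιMulti]
      exact Matrix.det_eq_zero_of_row_eq_zero 0 hw
    · exact detFunctional_of_ne φ _ h
  | zero => simp
  | add a b _ _ ha hb => rw [mul_add, map_add, ha, hb, add_zero]
  | smul c a _ ha => rw [mul_smul_comm, map_smul, ha, smul_zero]

theorem pairF_wedgeList {p : ℕ} (f : Fin p → Pt N → ℝ) (P : Form N p) (x : Pt N) :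
    pairF (wedgeList p fun i => dF (f i)) P x =
      detFunctional (fun s => ∑ i, grad (f s) x i • LinearMap.proj i) (ofArr p (P x)) := by
  rw [pairF, ofArr_apply, map_smul, map_sum, smul_eq_mul]
  congr 1
  refine Finset.sum_congr rfl fun I _ => ?_
  rw [(altArr_wedgeList _ x).eq_detFunctional, ofArr_wedgeList, detFunctional_ιMulti, map_smul,
    extBasis, detFunctional_ιMulti, ← Matrix.det_transpose, smul_eq_mul, mul_comm]
  congr 2
  ext t s
  simp [Pi.single_apply]

/-- The indices of the planes beyond the first `k`, one after another. -/
def tailIdx {n k : ℕ} (hkn : k ≤ n) (t : Fin (2 * (n - k))) : Fin n × Fin 2 :=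
  (⟨k + t / 2, by have := t.isLt; omega⟩, ⟨t % 2, Nat.mod_lt _ two_pos⟩)

theorem tailIdx_injective {n k : ℕ} (hkn : k ≤ n) : Function.Injective (tailIdx hkn) := by
  intro s t h
  simp only [tailIdx, Prod.mk.injEq, Fin.mk.injEq] at h
  ext
  omega

/-- The first `k` planes. -/
def headSet (n k : ℕ) : Finset (Fin n) := Finset.univ.filter fun i => (i : ℕ) < k

theorem mem_headSet {n k : ℕ} {i : Fin n} : i ∈ headSet n k ↔ (i : ℕ) < k := by simp [headSet]

theorem tailIdx_notMem {n k : ℕ} (hkn : k ≤ n) (t : Fin (2 * (n - k))) :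
    (tailIdx hkn t).1 ∉ headSet n k := by
  simp [mem_headSet, tailIdx]

theorem card_headSet {n k : ℕ} (hkn : k ≤ n) : (headSet n k).card = k := by
  rw [headSet, Fin.card_filter_val_lt, min_eq_right hkn]

theorem ιMulti_tailIdx {n k : ℕ} (hkn : k ≤ n) (θ : Fin n × Fin 2 → Fin N → ℝ) :
    ιMulti ℝ _ (fun t => θ (tailIdx hkn t)) = (planeProd (headSet n k)ᶜ θ : Ext N) := by
  have hprod : planeProd (headSet n k)ᶜ θ = (List.ofFn fun i : Fin (n - k) =>
      bivec (θ (⟨k + i, by omega⟩, 0)) (θ (⟨k + i, by omega⟩, 1))).prod := by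
    rw [List.prod_ofFn, planeProd]
    symm
    refine Finset.prod_bij (fun i _ => ⟨k + i, by omega⟩) (fun i _ => ?_) (fun i _ j _ h => ?_)
      (fun j hj => ?_) fun i _ => rfl
    · simp [mem_headSet]
    · simpa [Fin.ext_iff] using h
    · rw [Finset.mem_compl, mem_headSet, not_lt] at hj
      exact ⟨⟨j - k, by omega⟩, Finset.mem_univ _, Fin.ext (by simp; omega)⟩
  have hval : ((planeProd (headSet n k)ᶜ θ : Subalgebra.center ℝ (Ext N)) : Ext N) =
      (List.ofFn fun i : Fin (n - k) =>
        ι ℝ (θ (⟨k + i, by omega⟩, 0)) * ι ℝ (θ (⟨k + i, by omega⟩, 1))).prod := by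
    rw [hprod, ← Subalgebra.coe_val, map_list_prod, List.map_ofFn]
    rfl
  rw [hval, ιMulti_apply, List.ofFn_mul', List.prod_flatten, List.map_ofFn]
  congr 2
  funext i
  simp [List.ofFn_succ, tailIdx, Nat.mul_add_div]

variable {κ : Type} [Fintype κ] [DecidableEq κ]

theorem detFunctional_planeAdd_pow {p : ℕ} {φ : Fin p → (Fin N → ℝ) →ₗ[ℝ] ℝ} {s : Finset κ}
    {v : κ × Fin 2 → Fin N → ℝ} (hv : ∀ i ∈ s, ∀ t, φ t (v (i, 0)) = 0) (m : ℕ) :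
    detFunctional φ ((planeAdd Finset.univ v ^ m : Subalgebra.center ℝ (Ext N)) : Ext N) =
      detFunctional φ ((planeAdd sᶜ v ^ m : Subalgebra.center ℝ (Ext N)) : Ext N) := by
  obtain ⟨c, hc⟩ := sub_dvd_pow_sub_pow (planeAdd Finset.univ v) (planeAdd sᶜ v) m
  have hsub := sub_eq_of_eq_add (planeAdd_add_compl s v).symm
  rw [eq_add_of_sub_eq (hc.trans (congrArg (· * c) hsub)), Subalgebra.coe_add, Subalgebra.coe_mul, map_add, add_eq_right, planeAdd,
    AddSubmonoidClass.coe_finsetSum, Finset.sum_mul, map_sum]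
  refine Finset.sum_eq_zero fun i hi => ?_
  rw [coe_bivec, mul_assoc]
  exact detFunctional_ι_mul (hv i hi) _

variable {θ v : κ × Fin 2 → Fin N → ℝ}

theorem pairF_planeSum {σ Λ₀ : Form N 2} {x : Pt N} {s : Finset κ}
    (h1 : Matrix.of θ * (Matrix.of v).transpose = 1) (hσ : σ x = planeSum s θ)
    (hΛ₀ : Λ₀ x = planeSum Finset.univ v) : pairF σ Λ₀ x = s.card := by
  have h3 : Matrix.of v * (Matrix.of θ).transpose = 1 := by
    simpa using congrArg Matrix.transpose h1
  have htr : ∑ I : Fin 2 → Fin N, σ x I * Λ₀ x I =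
      Matrix.trace ((Matrix.of fun i j => planeSum s θ ![i, j]) *
        (Matrix.of fun i j => planeSum Finset.univ v ![i, j]).transpose) := by
    rw [← (finTwoArrowEquiv _).symm.sum_comp, Fintype.sum_prod_type, hσ, hΛ₀]
    simp [Matrix.trace, Matrix.mul_apply, finTwoArrowEquiv]
  have hm : Matrix.trace ((Matrix.of fun i j => planeSum s θ ![i, j]) *
      (Matrix.of fun i j => planeSum Finset.univ v ![i, j]).transpose) =
        -Matrix.trace (hypMat s * hypMat Finset.univ) := by
    rw [planeSum_eq_mul, planeSum_eq_mul, Matrix.transpose_mul, Matrix.transpose_mul,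
      Matrix.transpose_transpose, hypMat_transpose, Matrix.mul_assoc, Matrix.mul_assoc,
      Matrix.trace_mul_comm, Matrix.mul_assoc, ← Matrix.mul_assoc (Matrix.of θ), h1, Matrix.one_mul,
      Matrix.mul_assoc (-_), h3]
    simp
  rw [pairF, htr, hm, hypMat_mul_univ, Matrix.trace_neg, neg_neg, Matrix.trace_diagonal,
    Fintype.sum_prod_type]
  simp only [Fin.sum_univ_two, ← two_mul, ← Finset.mul_sum]
  simp

end NormalForm

section PointwiseFormulas

open ExteriorAlgebra

variable {n k : ℕ} {x : Pt (2 * n)} {θ v : Fin n × Fin 2 → Fin (2 * n) → ℝ}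
  {Λ ω₀ Λ₀ σ : Form (2 * n) 2} {f : Fin (2 * (n - k)) → Pt (2 * n) → ℝ}

theorem fEven_eq_one (hkn : k ≤ n) (h1 : Matrix.of θ * (Matrix.of v).transpose = 1)
    (hΛ₀ : Λ₀ x = planeSum Finset.univ v) (hf : ∀ t, grad (f t) x = θ (tailIdx hkn t)) :
    fEven Λ₀ f x = 1 := by
  have happ : ∀ t w, (∑ i, grad (f t) x i • LinearMap.proj i : (Fin (2 * n) → ℝ) →ₗ[ℝ] ℝ) w =
      ∑ i, θ (tailIdx hkn t) i * w i := fun t w => by simp [hf]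
  have hcard : (headSet n k)ᶜ.card = n - k := by
    rw [Finset.card_compl, card_headSet hkn, Fintype.card_fin]
  rw [fEven, pairF_wedgeList]
  have hP : ofArr (2 * (n - k)) (smulF (((n - k).factorial : ℝ)⁻¹) (wpow Λ₀ (n - k)) x) =
      ((n - k).factorial : ℝ)⁻¹ • ((planeAdd Finset.univ v ^ (n - k) :
        Subalgebra.center ℝ (Ext (2 * n))) : Ext (2 * n)) := by
    refine (ofArr_volF Λ₀ x).trans ?_
    rw [hΛ₀, ofArr_planeSum_eq_coe, SubmonoidClass.coe_pow]
  rw [hP, map_smul, detFunctional_planeAdd_pow (s := headSet n k) (fun i hi t => ?_), ← map_smul]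
  · have hW : ((n - k).factorial : ℝ)⁻¹ • ((planeAdd (headSet n k)ᶜ v ^ (n - k) :
        Subalgebra.center ℝ (Ext (2 * n))) : Ext (2 * n)) =
          ιMulti ℝ _ fun t => v (tailIdx hkn t) := by
      rw [ιMulti_tailIdx, ← planeAdd_pow_card _ v hcard]
      rfl
    rw [hW, detFunctional_ιMulti, ← Matrix.det_one (n := Fin (2 * (n - k)))]
    congr 1
    ext t s
    rw [Matrix.of_apply, happ, sum_mul_eq_ite h1, Matrix.one_apply]
    simp [(tailIdx_injective hkn).eq_iff, eq_comm]
  · rw [happ, sum_mul_eq_ite h1, if_neg]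
    intro h
    exact tailIdx_notMem hkn t (h ▸ hi)

theorem gEven_eq (hkn : k ≤ n) (h1 : Matrix.of θ * (Matrix.of v).transpose = 1)
    (hΛ₀ : Λ₀ x = planeSum Finset.univ v) (hσ : σ x = planeSum (headSet n k) θ) :
    gEven Λ₀ σ x = -k := by
  rw [gEven, pairF_planeSum h1 hσ hΛ₀, card_headSet hkn]

theorem ofArr_coreForm (hk : 2 ≤ k) (hkn : k ≤ n)
    (h1 : Matrix.of θ * (Matrix.of v).transpose = 1) (hω : ω₀ x = planeSum Finset.univ θ)
    (hΛ₀ : Λ₀ x = planeSum Finset.univ v) (hσ : σ x = planeSum (headSet n k) θ)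
    (hf : ∀ t, grad (f t) x = θ (tailIdx hkn t)) :
    ofArr _ (coreForm k ω₀ Λ₀ σ f x) =
      -∑ i ∈ headSet n k, (planeProd (Finset.univ.erase i) θ : Ext (2 * n)) := by
  have hadd : ofArr 2 (addF σ (fsmulF (fun x => gEven Λ₀ σ x / ((k : ℝ) - 1)) ω₀) x) =
      ((planeAdd (headSet n k) θ + (-(k : ℝ) / ((k : ℝ) - 1)) • planeAdd Finset.univ θ :
        Subalgebra.center ℝ (Ext (2 * n))) : Ext (2 * n)) := by
    rw [Subalgebra.coe_add, Subalgebra.coe_smul, ← ofArr_planeSum_eq_coe, ← ofArr_planeSum_eq_coe,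
      ← hσ, ← hω, ← gEven_eq hkn h1 hΛ₀ hσ, ← map_smul, ← map_add]
    rfl
  have hpow : ofArr (2 * (k - 2)) (smulF (((k - 2).factorial : ℝ)⁻¹) (wpow ω₀ (k - 2)) x) =
      ((((k - 2).factorial : ℝ)⁻¹ • planeAdd Finset.univ θ ^ (k - 2) :
        Subalgebra.center ℝ (Ext (2 * n))) : Ext (2 * n)) := by
    refine (ofArr_volF ω₀ x).trans ?_
    rw [hω, ofArr_planeSum_eq_coe, Subalgebra.coe_smul, SubmonoidClass.coe_pow]
  have hlist : ofArr (2 * (n - k)) (wedgeList (2 * (n - k)) (fun i => dF (f i)) x) =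
      (planeProd (headSet n k)ᶜ θ : Ext (2 * n)) := by
    rw [ofArr_wedgeList, ← ιMulti_tailIdx hkn]
    simp only [hf]
  rw [coreForm, ofArr_wedgeF, ofArr_wedgeF, hadd, hpow, hlist, ← Subalgebra.coe_mul,
    ← Subalgebra.coe_mul, core_eq_neg_sum_planeProd θ hk (card_headSet hkn), Subalgebra.coe_neg,
    AddSubmonoidClass.coe_finsetSum]

theorem PsiBiv_eq_coreForm (hk : 2 ≤ k) (hkn : k ≤ n)
    (h1 : Matrix.of θ * (Matrix.of v).transpose = 1) (hω : ω₀ x = planeSum Finset.univ θ)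
    (hΛ₀ : Λ₀ x = planeSum Finset.univ v) (hσ : σ x = planeSum (headSet n k) θ)
    (hΛ : Λ x = planeSum (headSet n k) v) (hf : ∀ t, grad (f t) x = θ (tailIdx hkn t))
    (hdeg : 2 + 2 * (k - 2) + 2 * (n - k) = 2 * n - 2) (I : Fin (2 * n - 2) → Fin (2 * n)) :
    PsiBiv ω₀ Λ x I = -(fEven Λ₀ f x)⁻¹ * castF hdeg (coreForm k ω₀ Λ₀ σ f) x I := by
  have hcore := ofArr_coreForm hk hkn h1 hω hΛ₀ hσ hf
  rw [← ofArr_castF hdeg] at hcore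
  have halt : AltArr (castF hdeg (coreForm k ω₀ Λ₀ σ f) x) := altArr_castF hdeg (altArr_wedgeF _ _ x)
  rw [fEven_eq_one hkn h1 hΛ₀ hf]
  obtain ⟨m, rfl⟩ : ∃ m, n = m + 1 := ⟨n - 1, by omega⟩
  have := AltArr.ext_ofArr (p := 2 * m) (altArr_PsiBiv ω₀ Λ x) (halt.smul (-(1 : ℝ)⁻¹)) (by
    rw [ofArr_PsiBiv h1 hω hΛ]
    have := map_smul (ofArr (N := 2 * (m + 1)) (2 * m)) (-(1 : ℝ)⁻¹)
      (castF hdeg (coreForm k ω₀ Λ₀ σ f) x)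
    refine Eq.trans ?_ this.symm
    refine Eq.trans ?_ (congrArg ((-(1 : ℝ)⁻¹) • ·) hcore.symm)
    simp)
  exact congrFun this I

theorem eq_sum_smul (h2 : (Matrix.of θ).transpose * Matrix.of v = 1) (a : Fin (2 * n) → ℝ) :
    a = ∑ l, (∑ j, v l j * a j) • θ l := by
  funext i
  have : ∀ j, ∑ l, θ l i * v l j = if i = j then 1 else 0 := fun j => by
    have := congrFun (congrFun h2 i) j
    rwa [Matrix.mul_apply, Matrix.one_apply] at this
  simp only [Finset.sum_apply, Pi.smul_apply, smul_eq_mul, Finset.sum_mul]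
  rw [Finset.sum_comm]
  have h : ∀ j, ∑ l, v l j * a j * θ l i = (∑ l, θ l i * v l j) * a j := fun j => by
    rw [Finset.sum_mul]
    exact Finset.sum_congr rfl fun l _ => by ring
  simp [h, this]

theorem ι_mul_planeProd_erase (h2 : (Matrix.of θ).transpose * Matrix.of v = 1)
    (a : Fin (2 * n) → ℝ) (i : Fin n) :
    ι ℝ a * (planeProd (Finset.univ.erase i) θ : Ext (2 * n)) =
      (∑ j, v (i, 0) j * a j) • (ι ℝ (θ (i, 0)) * (planeProd (Finset.univ.erase i) θ : Ext _)) +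
      (∑ j, v (i, 1) j * a j) • (ι ℝ (θ (i, 1)) * (planeProd (Finset.univ.erase i) θ : Ext _)) := by
  have hz : ∀ l : Fin n × Fin 2, l.1 ≠ i →
      ι ℝ (θ l) * (planeProd (Finset.univ.erase i) θ : Ext (2 * n)) = 0 := by
    rintro ⟨m, b⟩ hm
    have hm' : m ∈ Finset.univ.erase i := Finset.mem_erase.2 ⟨hm, Finset.mem_univ m⟩
    rw [planeProd, ← Finset.mul_prod_erase _ _ hm', Subalgebra.coe_mul, ← mul_assoc]
    fin_cases b
    · exact (congrArg (· * _) (ι_mul_bivec_left _ _)).trans (zero_mul _)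
    · exact (congrArg (· * _) (ι_mul_bivec_right _ _)).trans (zero_mul _)
  conv_lhs => rw [eq_sum_smul h2 a]
  rw [map_sum, Finset.sum_mul, Fintype.sum_prod_type, Finset.sum_eq_single i]
  · simp only [map_smul, smul_mul_assoc, Fin.sum_univ_two]
  · intro m _ hm
    exact Finset.sum_eq_zero fun b _ => by rw [map_smul, smul_mul_assoc, hz (m, b) hm, smul_zero]
  · simp

theorem ι_mul_ι_mul_planeProd_erase (h2 : (Matrix.of θ).transpose * Matrix.of v = 1)
    (a b : Fin (2 * n) → ℝ) (i : Fin n) :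
    ι ℝ a * (ι ℝ b * (planeProd (Finset.univ.erase i) θ : Ext (2 * n))) =
      ((∑ j, v (i, 0) j * a j) * (∑ j, v (i, 1) j * b j) -
        (∑ j, v (i, 1) j * a j) * (∑ j, v (i, 0) j * b j)) •
          (planeProd Finset.univ θ : Ext (2 * n)) := by
  have hswap : ∀ (u w : Fin (2 * n) → ℝ) (y : Ext (2 * n)),
      ι ℝ u * (ι ℝ w * y) = -(ι ℝ w * (ι ℝ u * y)) := fun u w y => by
    rw [← mul_assoc, eq_neg_of_add_eq_zero_left (ι_add_mul_swap u w), neg_mul, mul_assoc]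
  have hsq : ∀ (u : Fin (2 * n) → ℝ) (y : Ext (2 * n)), ι ℝ u * (ι ℝ u * y) = 0 := fun u y => by
    rw [← mul_assoc, ι_sq_zero, zero_mul]
  have hu : (planeProd Finset.univ θ : Ext (2 * n)) = ι ℝ (θ (i, 0)) * (ι ℝ (θ (i, 1)) *
      (planeProd (Finset.univ.erase i) θ : Ext (2 * n))) := by
    rw [← mul_assoc, ← coe_bivec, ← Subalgebra.coe_mul, planeProd, planeProd,
      Finset.mul_prod_erase Finset.univ (fun i => bivec (θ (i, 0)) (θ (i, 1)))
        (Finset.mem_univ i)]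
  rw [ι_mul_planeProd_erase h2 b, mul_add, mul_smul_comm, mul_smul_comm, hswap a, hswap a,
    ι_mul_planeProd_erase h2 a, hu]
  simp only [mul_add, mul_smul_comm, hsq, smul_zero, zero_add, add_zero,
    hswap (θ (i, 1)) (θ (i, 0)), smul_neg, neg_neg, smul_smul, sub_smul]
  rw [← neg_smul, ← add_smul, ← sub_smul]
  congr 1
  ring

theorem bival_planeSum (s : Finset (Fin n)) (a b : Fin (2 * n) → ℝ) :
    bival (planeSum s v) a b = ∑ i ∈ s, ((∑ j, v (i, 0) j * a j) * (∑ j, v (i, 1) j * b j) -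
      (∑ j, v (i, 1) j * a j) * (∑ j, v (i, 0) j * b j)) := by
  simp only [bival, planeSum, Finset.sum_mul]
  simp only [Finset.sum_comm (s := Finset.univ) (t := s)]
  refine Finset.sum_congr rfl fun i _ => ?_
  rw [← Finset.sum_sub_distrib]
  refine Finset.sum_congr rfl fun j _ => ?_
  rw [Finset.mul_sum, Finset.mul_sum, ← Finset.sum_sub_distrib]
  refine Finset.sum_congr rfl fun l _ => ?_
  simp
  ring

theorem braF_mul_volF_eq (hk : 2 ≤ k) (hkn : k ≤ n)
    (h1 : Matrix.of θ * (Matrix.of v).transpose = 1)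
    (h2 : (Matrix.of θ).transpose * Matrix.of v = 1) (hω : ω₀ x = planeSum Finset.univ θ)
    (hΛ₀ : Λ₀ x = planeSum Finset.univ v) (hσ : σ x = planeSum (headSet n k) θ)
    (hΛ : Λ x = planeSum (headSet n k) v) (hf : ∀ t, grad (f t) x = θ (tailIdx hkn t))
    (hdeg : 2 + (2 + 2 * (k - 2) + 2 * (n - k)) = 2 * n) (g h : Pt (2 * n) → ℝ)
    (I : Fin (2 * n) → Fin (2 * n)) :
    braF Λ g h x * volF n ω₀ x I = -(fEven Λ₀ f x)⁻¹ *
      castF hdeg (wedgeF 2 (2 + 2 * (k - 2) + 2 * (n - k)) (wedgeF 1 1 (dF g) (dF h))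
        (coreForm k ω₀ Λ₀ σ f)) x I := by
  have hvol := ofArr_volF_planeSum (Finset.card_fin n) hω
  have hcore := ofArr_coreForm hk hkn h1 hω hΛ₀ hσ hf
  rw [fEven_eq_one hkn h1 hΛ₀ hf]
  refine congrFun (AltArr.ext_ofArr ((altArr_volF n ω₀ x).smul _)
    ((altArr_castF hdeg (altArr_wedgeF _ _ x)).smul (-(1 : ℝ)⁻¹)) ?_) I
  refine (map_smul (ofArr (2 * n)) (braF Λ g h x) (volF n ω₀ x)).trans
    (Eq.trans ?_ (map_smul (ofArr (2 * n)) (-(1 : ℝ)⁻¹) (castF hdeg _ x)).symm)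
  have hgh : ofArr 2 (wedgeF 1 1 (dF g) (dF h) x) = ι ℝ (grad g x) * ι ℝ (grad h x) :=
    (ofArr_wedgeF (p := 1) (q := 1) (dF g) (dF h) x).trans
      (congrArg₂ (· * ·) (ofArr_dF g x) (ofArr_dF h x))
  rw [ofArr_castF, ofArr_wedgeF (p := 2), hcore, hvol, braF_eq_bival, hΛ, bival_planeSum, hgh,
    mul_neg, inv_one, neg_one_smul, neg_neg, Finset.mul_sum, Finset.sum_smul]
  refine Finset.sum_congr rfl fun i _ => ?_
  rw [mul_assoc, ι_mul_ι_mul_planeProd_erase h2]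

end PointwiseFormulas

section ChangeOfFrame

variable {N : ℕ}

/-- The array obtained from `α` by substituting the covectors `A l` for the coordinate covectors. -/
def pull (A : Fin N → Fin N → ℝ) {p : ℕ} (α : (Fin p → Fin N) → ℝ) : (Fin p → Fin N) → ℝ :=
  fun I => ∑ K : Fin p → Fin N, α K * ∏ t, A (K t) (I t)

variable {A B : Fin N → Fin N → ℝ} {x y : Pt N}

theorem prod_sum_index {p : ℕ} (f : Fin p → Fin N → ℝ) :
    ∏ t, ∑ j, f t j = ∑ I : Fin p → Fin N, ∏ t, f t (I t) := by
  rw [Finset.prod_univ_sum, Fintype.piFinset_univ]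

theorem pull_smul {p : ℕ} (c : ℝ) (α : (Fin p → Fin N) → ℝ) :
    pull A (fun I => c * α I) = fun I => c * pull A α I := by
  funext I
  simp only [pull, Finset.mul_sum, mul_assoc]

theorem pull_planeSum {κ : Type} (s : Finset κ) (θ : κ × Fin 2 → Fin N → ℝ) :
    pull A (planeSum s θ) = planeSum s fun l i => ∑ m, θ l m * A m i := by
  funext I
  simp only [pull, planeSum]
  conv_lhs => simp only [Finset.sum_mul]
  rw [Finset.sum_comm]
  refine Finset.sum_congr rfl fun a _ => ?_
  have h : ∀ f g : Fin N → ℝ, (∑ m, f m * A m (I 0)) * ∑ m, g m * A m (I 1) =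
      ∑ K : Fin 2 → Fin N, f (K 0) * g (K 1) * ∏ t, A (K t) (I t) := by
    intro f g
    have := prod_sum_index fun (t : Fin 2) m => ![f, g] t m * A m (I t)
    simp only [Fin.prod_univ_two, Matrix.cons_val_zero, Matrix.cons_val_one] at this
    rw [this]
    exact Finset.sum_congr rfl fun K _ => by rw [Fin.prod_univ_two]; ring
  rw [h, h, ← Finset.sum_sub_distrib]
  exact Finset.sum_congr rfl fun K _ => by ring

theorem wedgeF_eq_pull {p q : ℕ} {ω ω' : Form N p} {η η' : Form N q}
    (hω : ω x = pull A (ω' y)) (hη : η x = pull A (η' y)) :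
    wedgeF p q ω η x = pull A (wedgeF p q ω' η' y) := by
  funext I
  simp only [wedgeF, hω, hη]
  conv_rhs => simp only [pull, wedgeF, Finset.mul_sum, Finset.sum_mul]
  rw [Finset.sum_comm, Finset.mul_sum]
  refine Finset.sum_congr rfl fun σ _ => ?_
  rw [← (σ.arrowCongr (Equiv.refl (Fin N))).sum_comp, ← (Fin.appendEquiv p q).sum_comp,
    Fintype.sum_prod_type, mul_assoc (_ : ℝ) (pull A _ _), pull, pull, Finset.sum_mul_sum,
    Finset.mul_sum, Finset.mul_sum]
  refine Finset.sum_congr rfl fun K _ => ?_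
  rw [Finset.mul_sum, Finset.mul_sum]
  refine Finset.sum_congr rfl fun L _ => ?_
  rw [← Equiv.prod_comp σ, Fin.prod_univ_add]
  simp [Fin.appendEquiv]
  ring

theorem wpow_eq_pull {ω ω' : Form N 2} (hω : ω x = pull A (ω' y)) (m : ℕ) :
    wpow ω m x = pull A (wpow ω' m y) := by
  induction m with
  | zero => funext I; simp [wpow, pull]
  | succ m ih => exact wedgeF_eq_pull ih hω

theorem volF_eq_pull {ω ω' : Form N 2} (hω : ω x = pull A (ω' y)) (m : ℕ) :
    volF m ω x = pull A (volF m ω' y) := by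
  have := pull_smul (A := A) ((m.factorial : ℝ)⁻¹) (wpow ω' m y)
  rw [← wpow_eq_pull hω] at this
  exact this.symm

theorem sharpF_eq_pull (hAB : ∀ l m, ∑ j, A l j * B m j = if l = m then 1 else 0) {p : ℕ}
    {Λ Λ' : Form N 2} {ζ ζ' : Form N p} (hΛ : Λ x = pull B (Λ' y)) (hζ : ζ x = pull A (ζ' y)) :
    sharpF Λ p ζ x = pull B (sharpF Λ' p ζ' y) := by
  have h2 : ∀ l b, ∑ i, A l i * Λ x ![i, b] = ∑ m, Λ' y ![l, m] * B m b := by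
    intro l b
    have hi : ∀ i, A l i * Λ x ![i, b] = ∑ c, ∑ m, (A l i * B c i) * (Λ' y ![c, m] * B m b) := by
      intro i
      rw [hΛ, pull, ← (finTwoArrowEquiv (Fin N)).symm.sum_comp, Fintype.sum_prod_type,
        Finset.mul_sum]
      refine Finset.sum_congr rfl fun c _ => ?_
      rw [Finset.mul_sum]
      refine Finset.sum_congr rfl fun m _ => ?_
      simp [Fin.prod_univ_two, finTwoArrowEquiv]
      ring
    simp only [hi]
    rw [Finset.sum_comm]
    simp only [Finset.sum_comm (s := (Finset.univ : Finset (Fin N))) (t := Finset.univ)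
      (f := fun i m => (A l i * B _ i) * (Λ' y ![_, m] * B m b)), ← Finset.sum_mul, hAB]
    rw [Finset.sum_eq_single l]
    · simp
    · intro c _ hc
      simp [Ne.symm hc]
    · simp
  funext J
  have hL : ∑ I : Fin p → Fin N, ζ x I * ∏ t, Λ x ![I t, J t] =
      ∑ K : Fin p → Fin N, ζ' y K * ∏ t, ∑ m, Λ' y ![K t, m] * B m (J t) := by
    simp only [hζ, pull, Finset.sum_mul]
    rw [Finset.sum_comm]
    refine Finset.sum_congr rfl fun K _ => ?_
    simp only [← h2]
    rw [prod_sum_index, Finset.mul_sum]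
    refine Finset.sum_congr rfl fun I _ => ?_
    rw [Finset.prod_mul_distrib, mul_assoc]
  rw [sharpF, hL, pull]
  simp only [sharpF, prod_sum_index, Finset.mul_sum, Finset.sum_mul]
  rw [Finset.sum_comm]
  refine Finset.sum_congr rfl fun K _ => Finset.sum_congr rfl fun L _ => ?_
  rw [Finset.prod_mul_distrib]
  ring

/-- `catIdx` as an equivalence. -/
def catIdxEquiv {p q : ℕ} (hpq : p ≤ q) :
    (Fin p → Fin N) × (Fin (q - p) → Fin N) ≃ (Fin q → Fin N) where
  toFun u := catIdx u.1 u.2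
  invFun L := (fun t => L ⟨t, by omega⟩, fun t => L ⟨p + t, by omega⟩)
  left_inv u := by
    ext t <;> simp [catIdx]
  right_inv L := by
    funext t
    by_cases h : (t : ℕ) < p
    · simp [catIdx, h]
    · simp only [catIdx, h, dif_neg, not_false_eq_true]
      congr 1
      ext
      simp
      omega

theorem prod_catIdx {p q : ℕ} (hpq : p ≤ q) (K I : Fin p → Fin N) (L J : Fin (q - p) → Fin N) :
    ∏ t, A (catIdx K L t) (catIdx I J t) = (∏ t, A (K t) (I t)) * ∏ t, A (L t) (J t) := by
  rw [← Equiv.prod_comp (finCongr (Nat.add_sub_cancel' hpq)), Fin.prod_univ_add]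
  simp [catIdx]

theorem iF_eq_pull (hAB : ∀ l m, ∑ j, A l j * B m j = if l = m then 1 else 0) {p q : ℕ}
    (hpq : p ≤ q) {P P' : Form N p} {η η' : Form N q} (hP : P x = pull B (P' y))
    (hη : η x = pull A (η' y)) : iF p q P η x = pull A (iF p q P' η' y) := by
  funext J
  have hL : ∑ I : Fin p → Fin N, P x I * η x (catIdx I J) =
      ∑ K : Fin p → Fin N, ∑ L : Fin (q - p) → Fin N, P' y K * η' y (catIdx K L) *
        ∏ t, A (L t) (J t) := by
    have h : ∀ I, P x I * η x (catIdx I J) = ∑ K : Fin p → Fin N, ∑ K' : Fin p → Fin N,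
        (∑ L, P' y K * (η' y (catIdx K' L) * ∏ t, A (L t) (J t))) *
          ∏ t, A (K' t) (I t) * B (K t) (I t) := by
      intro I
      rw [hP, hη, pull, pull, ← (catIdxEquiv hpq).sum_comp, Fintype.sum_prod_type,
        Finset.sum_mul_sum]
      refine Finset.sum_congr rfl fun K _ => Finset.sum_congr rfl fun K' _ => ?_
      rw [Finset.mul_sum, Finset.sum_mul]
      refine Finset.sum_congr rfl fun L _ => ?_
      rw [catIdxEquiv, Equiv.coe_fn_mk, prod_catIdx hpq, Finset.prod_mul_distrib]
      ring
    have hdual : ∀ K K' : Fin p → Fin N, ∑ I : Fin p → Fin N, ∏ t, A (K' t) (I t) * B (K t) (I t) =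
        ∏ t, if K' t = K t then 1 else 0 := fun K K' => by
      simp only [← hAB, prod_sum_index]
    simp only [h]
    rw [Finset.sum_comm]
    refine Finset.sum_congr rfl fun K _ => ?_
    rw [Finset.sum_comm]
    simp only [← Finset.mul_sum, hdual]
    rw [Finset.sum_eq_single K]
    · simp [Finset.mul_sum, mul_assoc]
    · intro K' _ hK'
      obtain ⟨t, ht⟩ := Function.ne_iff.1 hK'
      rw [Finset.prod_eq_zero (Finset.mem_univ t) (if_neg ht), mul_zero]
    · simp
  rw [iF, hL, pull]
  simp only [iF, Finset.mul_sum, Finset.sum_mul]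
  rw [Finset.sum_comm]
  refine Finset.sum_congr rfl fun K _ => Finset.sum_congr rfl fun L _ => ?_
  ring

theorem adjF_eq_pull {n : ℕ} {A B : Fin (2 * n) → Fin (2 * n) → ℝ} {x y : Pt (2 * n)}
    (hAB : ∀ l m, ∑ j, A l j * B m j = if l = m then 1 else 0) {p : ℕ} (hp : p ≤ 2 * n)
    {ω ω' Λ Λ' : Form (2 * n) 2} {φ φ' : Form (2 * n) p} (hω : ω x = pull A (ω' y))
    (hΛ : Λ x = pull B (Λ' y)) (hφ : φ x = pull A (φ' y)) :
    adjF ω Λ p φ x = pull A (adjF ω' Λ' p φ' y) := by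
  have := pull_smul (A := A) ((-1 : ℝ) ^ (p * (p - 1) / 2))
    (iF p (2 * n) (sharpF Λ' p φ') (volF n ω') y)
  rw [← iF_eq_pull hAB hp (sharpF_eq_pull hAB hΛ hφ) (volF_eq_pull hω n)] at this
  exact this.symm

end ChangeOfFrame

section ClosedForms

open Topology

variable {N : ℕ}

theorem prod_update_apply {p : ℕ} [DecidableEq (Fin p)] (w : Fin p → Fin N → ℝ) (i : Fin p)
    (c : Fin N → ℝ) (K : Fin p → Fin N) : ∏ t, Function.update w i c t (K t) =
      c (K i) * ∏ t ∈ Finset.univ.erase i, w t (K t) := by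
  rw [← Finset.mul_prod_erase _ _ (Finset.mem_univ i), Function.update_self]
  refine congrArg _ (Finset.prod_congr rfl fun t ht => ?_)
  rw [Function.update_of_ne (Finset.ne_of_mem_erase ht)]

/-- The constant-coefficient form with the given antisymmetric components. -/
def constForm {p : ℕ} (C : (Fin p → Fin N) → ℝ)
    (hC : ∀ (K : Fin p → Fin N) (i j : Fin p), i ≠ j → C (K ∘ Equiv.swap i j) = -C K) :
    (Fin N → ℝ) [⋀^Fin p]→L[ℝ] ℝ where
  toFun w := ∑ K, C K * ∏ t, w t (K t)
  map_update_add' w i a b := by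
    rw [← Finset.sum_add_distrib]
    refine Finset.sum_congr rfl fun K _ => ?_
    rw [prod_update_apply, prod_update_apply, prod_update_apply, Pi.add_apply]
    ring
  map_update_smul' w i c a := by
    rw [smul_eq_mul, Finset.mul_sum]
    refine Finset.sum_congr rfl fun K _ => ?_
    rw [prod_update_apply, prod_update_apply, Pi.smul_apply, smul_eq_mul]
    ring
  map_eq_zero_of_eq' w i j hw hij := by
    have h : ∑ K, C K * ∏ t, w t (K t) = -∑ K, C K * ∏ t, w t (K t) := by
      conv_lhs => rw [← ((Equiv.swap i j).arrowCongr (Equiv.refl (Fin N))).sum_comp]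
      rw [← Finset.sum_neg_distrib]
      refine Finset.sum_congr rfl fun K _ => ?_
      have e : ((Equiv.swap i j).arrowCongr (Equiv.refl (Fin N))) K = K ∘ Equiv.swap i j := rfl
      have hs : ∀ t, w (Equiv.swap i j t) = w t := fun t => by
        rw [Equiv.swap_apply_def]
        split_ifs with h1 h2
        · rw [h1, hw]
        · rw [h2, hw]
        · rfl
      rw [e, hC K i j hij, neg_mul, ← Equiv.prod_comp (Equiv.swap i j)]
      simp [hs]
    exact self_eq_neg.1 h
  cont := by
    fun_prop

theorem constForm_apply {p : ℕ} {C : (Fin p → Fin N) → ℝ}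
    (hC : ∀ (K : Fin p → Fin N) (i j : Fin p), i ≠ j → C (K ∘ Equiv.swap i j) = -C K)
    (w : Fin p → Fin N → ℝ) : constForm C hC w = ∑ K, C K * ∏ t, w t (K t) := rfl

/-- A form with constant coefficients in the coframe of a system of functions is closed. -/
theorem extd_eq_zero_of_pull {p : ℕ} {C : (Fin p → Fin N) → ℝ}
    (hC : ∀ (K : Fin p → Fin N) (i j : Fin p), i ≠ j → C (K ∘ Equiv.swap i j) = -C K)
    {V : Set (Pt N)} (hV : IsOpen V) {Y : Fin N → Pt N → ℝ}
    (hY : ∀ l, ContDiffOn ℝ (⊤ : ℕ∞) (Y l) V) {ω : Form N p}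
    (hω : ∀ x ∈ V, ω x = pull (fun l => grad (Y l) x) C) {x : Pt N} (hx : x ∈ V) :
    extd ω x = 0 := by
  set F : Pt N → Fin N → ℝ := fun x l => Y l x
  have hF : ∀ y ∈ V, ContDiffAt ℝ (⊤ : ℕ∞) F y := fun y hy =>
    contDiffAt_pi.2 fun l => (hY l).contDiffAt (hV.mem_nhds hy)
  have hFd : ∀ y ∈ V, ∀ i l, fderiv ℝ F y (Pi.single i 1) l = grad (Y l) y i := by
    intro y hy i l
    exact congrArg (· (Pi.single i 1)) (fderiv_apply ((hF y hy).differentiableAt (by simp)) l).symm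
  set Φ : Pt N → Pt N [⋀^Fin p]→L[ℝ] ℝ :=
    fun y => (constForm C hC).compContinuousLinearMap (fderiv ℝ F y)
  have hΦ : ∀ y ∈ V, ∀ J : Fin p → Fin N,
      ω y J = Φ y fun t => Pi.single (J t) 1 := by
    intro y hy J
    rw [hω y hy, pull]
    simp only [Φ, ContinuousAlternatingMap.compContinuousLinearMap_apply, constForm_apply,
      Function.comp_apply, hFd y hy]
  have hdΦ : DifferentiableAt ℝ Φ x :=
    (differentiableAt_const _).continuousAlternatingMapCompContinuousLinearMap
      (((hF x hx).fderiv_right (m := 1) (by norm_cast)).differentiableAt (by simp))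
  have hext : extDeriv Φ x = 0 := by
    have h := extDeriv_pullback (ω := fun _ : Fin N → ℝ => constForm C hC)
      (differentiableAt_const _) ((hF x hx).of_le (m := 2) (by norm_cast)) (by simp)
    rw [show extDeriv (fun _ : Fin N → ℝ => constForm C hC) (F x) = 0 by
      ext w
      rw [extDeriv_apply (differentiableAt_const _)]
      simp] at h
    exact h
  funext I
  have h := extDeriv_apply hdΦ fun t => Pi.single (I t) 1
  rw [hext] at h
  refine Eq.trans (Finset.sum_congr rfl fun i _ => ?_) h.symm
  rw [zsmul_eq_mul]
  push_cast
  refine congrArg (fun L : Pt N →L[ℝ] ℝ => (-1 : ℝ) ^ (i : ℕ) * L (Pi.single (I i) 1)) ?_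
  refine Filter.EventuallyEq.fderiv_eq ?_
  filter_upwards [hV.mem_nhds hx] with y hy
  exact hΦ y hy _

theorem iF_swap {p q : ℕ} (P : Form N p) {η : Form N q} {x : Pt N} (hη : AltArr (η x))
    (K : Fin (q - p) → Fin N) {i j : Fin (q - p)} (hij : i ≠ j) :
    iF p q P η x (K ∘ Equiv.swap i j) = -iF p q P η x K := by
  rw [iF, iF, ← mul_neg, ← Finset.sum_neg_distrib]
  refine congrArg _ (Finset.sum_congr rfl fun I _ => ?_)
  obtain ⟨e, hv⟩ : ∃ e : Fin (q - p) ↪ Fin q, ∀ t, (e t : ℕ) = p + t :=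
    ⟨⟨fun t => ⟨p + t, by omega⟩, fun a b h => by simpa [Fin.ext_iff] using h⟩, fun _ => rfl⟩
  have : catIdx I (K ∘ Equiv.swap i j) = catIdx I K ∘ Equiv.swap (e i) (e j) := by
    funext t
    by_cases h : (t : ℕ) < p
    · rw [Function.comp_apply, Equiv.swap_apply_of_ne_of_ne]
      · simp [catIdx, h]
      · rintro rfl; simp [hv] at h
      · rintro rfl; simp [hv] at h
    · obtain ⟨s, rfl⟩ : ∃ s, e s = t := ⟨⟨t - p, by omega⟩, Fin.ext (by rw [hv]; simp; omega)⟩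
      have he : ∀ s, catIdx I K (e s) = K s := fun s => by simp [catIdx, hv]
      have he' : catIdx I (K ∘ Equiv.swap i j) (e s) = K (Equiv.swap i j s) := by
        simp [catIdx, hv]
      rw [he', Function.comp_apply, ← e.injective.map_swap, he]
  rw [this, hη.1, Equiv.Perm.sign_swap (e.injective.ne hij)]
  simp

theorem codiffF_eq_zero {n p : ℕ} {ω₀ Λ₀ : Form (2 * n) 2} {φ : Form (2 * n) p} {x : Pt (2 * n)}
    (h : extd (adjF ω₀ Λ₀ p φ) x = 0) : codiffF ω₀ Λ₀ p φ x = 0 := by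
  have h0 : adjF ω₀ Λ₀ (2 * n - p + 1) (extd (adjF ω₀ Λ₀ p φ)) x = 0 := by
    funext I
    rw [adjF, smulF, iF]
    simp [sharpF, h]
  rw [codiffF, castT]
  split_ifs with hq
  · funext J
    exact congrFun h0 _
  · rfl

end ClosedForms

section DeltaCondition

variable {n : ℕ}

/-- The indexing of the coordinates by the pairs of a symplectic frame. -/
def frameIdx (n : ℕ) : Fin n × Fin 2 ≃ Fin (2 * n) :=
  finProdFinEquiv.trans (finCongr (Nat.mul_comm n 2))

/-- The standard frame. -/
def stdFrame (n : ℕ) : Fin n × Fin 2 → Fin (2 * n) → ℝ := fun l => Pi.single (frameIdx n l) 1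

theorem planeSum_eq_pull (s : Finset (Fin n)) (θ : Fin n × Fin 2 → Fin (2 * n) → ℝ) :
    planeSum s θ = pull (fun m => θ ((frameIdx n).symm m)) (planeSum s (stdFrame n)) := by
  rw [pull_planeSum]
  congr 1
  funext l i
  simp [stdFrame, Pi.single_apply]

variable {V : Set (Pt (2 * n))} {Y : Fin n × Fin 2 → Pt (2 * n) → ℝ}
  {v : Fin n × Fin 2 → Pt (2 * n) → Fin (2 * n) → ℝ} {ω₀ Λ₀ : Form (2 * n) 2}

theorem codiffF_eq_zero_of_pull (hV : IsOpen V) (hY : ∀ l, ContDiffOn ℝ (⊤ : ℕ∞) (Y l) V)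
    (hd : ∀ x ∈ V, ∀ l m, ∑ j, grad (Y l) x j * v m x j = if l = m then 1 else 0)
    (hω : ∀ x ∈ V, ω₀ x = planeSum Finset.univ fun l => grad (Y l) x)
    (hΛ : ∀ x ∈ V, Λ₀ x = planeSum Finset.univ fun l => v l x) {p : ℕ} (hp : p ≤ 2 * n)
    {φ φ' : Form (2 * n) p} (hφ : ∀ x ∈ V, φ x =
      pull (fun m => grad (Y ((frameIdx n).symm m)) x) (φ' 0)) {x : Pt (2 * n)} (hx : x ∈ V) :
    codiffF ω₀ Λ₀ p φ x = 0 := by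
  set σ' : Form (2 * n) 2 := fun _ => planeSum Finset.univ (stdFrame n)
  refine codiffF_eq_zero (extd_eq_zero_of_pull (C := adjF σ' σ' p φ' 0) (fun K i j hij => ?_) hV
    (fun m => hY ((frameIdx n).symm m)) (fun y hy => ?_) hx)
  · rw [adjF, smulF, smulF, iF_swap _ (altArr_volF n σ' 0) _ hij, mul_neg]
  · refine adjF_eq_pull (B := fun m => v ((frameIdx n).symm m) y) (fun l m => ?_) hp
      ((hω y hy).trans (planeSum_eq_pull _ _)) ((hΛ y hy).trans (planeSum_eq_pull _ _)) (hφ y hy)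
    simp [hd y hy]

/-- In a Darboux frame both codifferentials vanish. -/
theorem deltaCond_of_frame (hn : 2 ≤ n) (hV : IsOpen V)
    (hY : ∀ l, ContDiffOn ℝ (⊤ : ℕ∞) (Y l) V)
    (hd : ∀ x ∈ V, ∀ l m, ∑ j, grad (Y l) x j * v m x j = if l = m then 1 else 0)
    (hω : ∀ x ∈ V, ω₀ x = planeSum Finset.univ fun l => grad (Y l) x)
    (hΛ : ∀ x ∈ V, Λ₀ x = planeSum Finset.univ fun l => v l x) {s : Finset (Fin n)}
    {σ : Form (2 * n) 2} (hσ : ∀ x ∈ V, σ x = planeSum s fun l => grad (Y l) x) :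
    DeltaCond ω₀ Λ₀ σ V := by
  set σ' : Form (2 * n) 2 := fun _ => planeSum s (stdFrame n)
  have h : ∀ x ∈ V, σ x = pull (fun m => grad (Y ((frameIdx n).symm m)) x) (σ' 0) := fun x hx =>
    (hσ x hx).trans (planeSum_eq_pull _ _)
  intro x hx I
  rw [codiffF_eq_zero_of_pull hV hY hd hω hΛ (p := 4) (φ' := wedgeF 2 2 σ' σ') (by omega)
    (fun y hy => wedgeF_eq_pull (h y hy) (h y hy)) hx]
  simp [smulF, wedgeF, codiffF_eq_zero_of_pull hV hY hd hω hΛ (by omega) h hx]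

end DeltaCondition

section Assembly

theorem isFormOn_planeSum {N : ℕ} {κ : Type} {s : Finset κ} {V : Set (Pt N)}
    {w : κ × Fin 2 → Pt N → Fin N → ℝ}
    (hw : ∀ l j, ContDiffOn ℝ (⊤ : ℕ∞) (fun x => w l x j) V) :
    IsFormOn (fun x => planeSum s fun l => w l x) V :=
  ⟨fun _ _ => altArr_planeSum _ _, fun _ => ContDiffOn.sum fun _ _ =>
    ((hw _ _).mul (hw _ _)).sub ((hw _ _).mul (hw _ _))⟩

theorem linearIndependent_of_dual {N : ℕ} {κ τ : Type} [DecidableEq κ] [Fintype τ]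
    {θ v : κ → Fin N → ℝ} (hd : ∀ l m, ∑ j, θ l j * v m j = if l = m then 1 else 0)
    {a : τ → κ} (ha : Function.Injective a) : LinearIndependent ℝ fun t => θ (a t) := by
  rw [Fintype.linearIndependent_iff]
  intro c hc t
  have h : ∑ j, (∑ i, c i • θ (a i)) j * v (a t) j = 0 := by
    rw [hc]
    simp
  simp only [Finset.sum_apply, Pi.smul_apply, smul_eq_mul, Finset.sum_mul, mul_assoc] at h
  rw [Finset.sum_comm] at h
  simp only [← Finset.mul_sum, hd] at h
  rw [Finset.sum_eq_single t (fun i _ hi => by rw [if_neg (ha.ne hi), mul_zero]) (by simp)] at h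
  simpa using h

end Assembly

theorem local_normal_form_of_poisson_tensor_even
    (n k : ℕ) (hk : 2 ≤ k) (hkn : k ≤ n)
    (M : Set (Pt (2 * n))) (hMo : IsOpen M) (hMne : M.Nonempty)
    (Λ : Form (2 * n) 2) (hΛ : IsFormOn Λ M) (hPoisson : JacobiOn Λ M)
    (𝒰 : Set (Pt (2 * n))) (h𝒰o : IsOpen 𝒰) (h𝒰M : 𝒰 ⊆ M) (h𝒰d : M ⊆ closure 𝒰)
    (hrank : ∀ x ∈ 𝒰, Matrix.rank (mat2 Λ x) = 2 * k) :
    ∀ p ∈ 𝒰, ∃ V : Set (Pt (2 * n)), IsOpen V ∧ p ∈ V ∧ V ⊆ 𝒰 ∧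
      ∃ f : Fin (2 * (n - k)) → Pt (2 * n) → ℝ,
      ∃ ω₀ Λ₀ σ : Form (2 * n) 2,
        (∀ i, ContDiffOn ℝ (⊤ : ℕ∞) (f i) V) ∧
        (∀ x ∈ V, LinearIndependent ℝ fun i => grad (f i) x) ∧
        AlmostSymp ω₀ Λ₀ V ∧
        (∀ x ∈ V, fEven Λ₀ f x ≠ 0) ∧
        IsFormOn σ V ∧
        (∀ i, ∀ x ∈ V, ∀ b, ∑ a, σ x ![a, b] * hamV Λ₀ (f i) x a = 0) ∧
        (∀ x ∈ V, Matrix.rank (mat2 σ x) = 2 * k) ∧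
        DeltaCond ω₀ Λ₀ σ V ∧
        -- Λ = Λ₀^#(σ) on V
        (∀ x ∈ V, ∀ I : Fin 2 → Fin (2 * n), Λ x I = sharpF Λ₀ 2 σ x I) ∧
        -- Ψ(Λ) = -(1/f)(σ + (g/(k-1))ω₀)∧(ω₀^{k-2}/(k-2)!)∧df₁∧⋯∧df_{2(n-k)} on V
        (∀ x ∈ V, ∀ I : Fin (2 * n - 2) → Fin (2 * n),
          PsiBiv ω₀ Λ x I
            = -(fEven Λ₀ f x)⁻¹ * castF (by omega) (coreForm k ω₀ Λ₀ σ f) x I) ∧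
        -- and the bracket of Λ is given by formula (12) on V:
        (∀ h₁ h₂ : Pt (2 * n) → ℝ,
          ContDiffOn ℝ (⊤ : ℕ∞) h₁ V → ContDiffOn ℝ (⊤ : ℕ∞) h₂ V →
          ∀ x ∈ V, ∀ I : Fin (2 * n) → Fin (2 * n),
          braF Λ h₁ h₂ x * volF n ω₀ x I
            = -(fEven Λ₀ f x)⁻¹ *
              castF (by omega)
                (wedgeF 2 (2 + 2 * (k - 2) + 2 * (n - k))
                  (wedgeF 1 1 (dF h₁) (dF h₂)) (coreForm k ω₀ Λ₀ σ f)) x I) := by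
  intro p hp
  obtain ⟨V, hV, hpV, hVU, Y, v, hY, hv, hx⟩ := exists_darboux hkn hΛ hPoisson h𝒰o h𝒰M hrank hp
  have hd : ∀ x ∈ V, ∀ l m, ∑ j, grad (Y l) x j * v m x j = if l = m then 1 else 0 :=
    fun x h => (hx x h).1
  have h1 : ∀ x ∈ V, Matrix.of (fun l => grad (Y l) x) *
      (Matrix.of fun l => v l x).transpose = 1 := fun x h => by
    ext l m
    rw [Matrix.mul_apply, Matrix.one_apply]
    exact hd x h l m
  have h2 : ∀ x ∈ V, (Matrix.of fun l => grad (Y l) x).transpose *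
      (Matrix.of fun l => v l x) = 1 := fun x h => by
    ext i j
    rw [Matrix.mul_apply, Matrix.one_apply]
    exact (hx x h).2.1 i j
  have hΛV : ∀ x ∈ V, Λ x = planeSum (headSet n k) fun l => v l x := fun x h =>
    eq_planeSum_of_bival (by simpa using congrArg Matrix.transpose (h2 x h)) fun l m => by
      rw [(hx x h).2.2, hypTrunc, hypMat, Matrix.of_apply]
      simp only [mem_headSet]
  have hθ : ∀ l j, ContDiffOn ℝ (⊤ : ℕ∞) (fun x => grad (Y l) x j) V := fun l j =>
    contDiffOn_pd hV (hY l) j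
  refine ⟨V, hV, hpV, hVU, fun t => Y (tailIdx hkn t),
    fun x => planeSum Finset.univ fun l => grad (Y l) x, fun x => planeSum Finset.univ fun l => v l x,
    fun x => planeSum (headSet n k) fun l => grad (Y l) x, fun t => hY _,
    fun x h => linearIndependent_of_dual (hd x h) (tailIdx_injective hkn),
    ⟨isFormOn_planeSum hθ, isFormOn_planeSum hv,
      fun x h => planeSum_mul_planeSum_univ (h1 x h) (h2 x h)⟩,
    fun x h => ?_, isFormOn_planeSum hθ,
    fun t x h b => planeSum_univ_mul_planeSum_apply (h1 x h) _ (tailIdx_notMem hkn t) b,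
    fun x h => ?_,
    deltaCond_of_frame (hk.trans hkn) hV hY hd (fun _ _ => rfl) (fun _ _ => rfl) fun _ _ => rfl,
    fun x h I => ?_, fun x h I => ?_, fun g₁ g₂ _ _ x h I => ?_⟩
  · rw [fEven_eq_one hkn (h1 x h) rfl fun _ => rfl]
    exact one_ne_zero
  · refine (rank_planeSum (h1 x h) _).trans ?_
    rw [← hΛV x h]
    exact hrank x (hVU h)
  · rw [sharpF_two]
    refine Eq.trans ?_ (congrFun (congrFun (planeSum_conj (h1 x h) (headSet n k)).symm (I 0)) (I 1))
    rw [hΛV x h, Matrix.of_apply, ← eq_vec2]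
  · exact PsiBiv_eq_coreForm hk hkn (h1 x h) rfl rfl rfl (hΛV x h) (fun _ => rfl) _ I
  · exact braF_mul_volF_eq hk hkn (h1 x h) (h2 x h) rfl rfl rfl (hΛV x h) (fun _ => rfl) _ g₁ g₂ I

end
end Damianou
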